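/- Let N₃(ξ,η) denote the number of cubic fields K (fields with [K:ℚ]=3), counted up to isomorphism, satisfying ξ < Disc(K) < η. Then as X → ∞, N₃(0,X) = X/(12ζ(3)) + o(X) and N₃(−X,0) = X/(4ζ(3)) + o(X). -/

import Mathlib

open Filter

/-- The discriminant of a number field presented as a subfield of `ℂ`
(junk value `0` in the infinite-dimensional case). -/
noncomputable def fieldDisc (K : IntermediateField ℚ ℂ) : ℤ :=
  letI := Classical.dec (FiniteDimensional ℚ K)
  if h : FiniteDimensional ℚ K then
    letI := h
    letI : NumberField K := ⟨⟩
    NumberField.discr K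
  else 0

/-- The number of isomorphism classes of cubic fields `K` with `ξ < Disc K < η`. -/
noncomputable def cubicFieldCount (ξ η : ℝ) : ℕ :=
  Nat.card (Quot fun K L : { K : IntermediateField ℚ ℂ //
      Module.finrank ℚ K = 3 ∧ ξ < (fieldDisc K : ℝ) ∧ (fieldDisc K : ℝ) < η } =>
    Nonempty (↥K.1 ≃+* ↥L.1))

namespace DH

/-- The binary cubic form `a x³ + b x² y + c x y² + d y³` is encoded as `![a, b, c, d]`. -/
abbrev Form (R : Type*) := Fin 4 → R

/-- Two-by-two matrices. -/
abbrev Mat (R : Type*) := Matrix (Fin 2) (Fin 2) R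

theorem form_ext {R : Type*} {f g : Form R} (h0 : f 0 = g 0) (h1 : f 1 = g 1) (h2 : f 2 = g 2)
    (h3 : f 3 = g 3) : f = g := by
  funext i; fin_cases i <;> assumption

section Ring
variable {R : Type*} [CommRing R]

/-- The value of a binary cubic form at a point. -/
def ev (f : Form R) (x y : R) : R :=
  f 0 * x ^ 3 + f 1 * x ^ 2 * y + f 2 * x * y ^ 2 + f 3 * y ^ 3

/-- The discriminant of a binary cubic form. -/
def disc (f : Form R) : R :=
  f 1 ^ 2 * f 2 ^ 2 - 4 * f 0 * f 2 ^ 3 - 4 * f 1 ^ 3 * f 3 - 27 * f 0 ^ 2 * f 3 ^ 2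
    + 18 * f 0 * f 1 * f 2 * f 3

/-- Substitution of the linear forms given by the rows of `M`. -/
def act (f : Form R) (M : Mat R) : Form R :=
  ![f 0 * M 0 0 ^ 3 + f 1 * M 0 0 ^ 2 * M 1 0 + f 2 * M 0 0 * M 1 0 ^ 2 + f 3 * M 1 0 ^ 3,
    3 * f 0 * M 0 0 ^ 2 * M 0 1 + f 1 * (M 0 0 ^ 2 * M 1 1 + 2 * M 0 0 * M 0 1 * M 1 0)
      + f 2 * (2 * M 0 0 * M 1 0 * M 1 1 + M 0 1 * M 1 0 ^ 2) + 3 * f 3 * M 1 0 ^ 2 * M 1 1,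
    3 * f 0 * M 0 0 * M 0 1 ^ 2 + f 1 * (2 * M 0 0 * M 0 1 * M 1 1 + M 0 1 ^ 2 * M 1 0)
      + f 2 * (M 0 0 * M 1 1 ^ 2 + 2 * M 0 1 * M 1 0 * M 1 1) + 3 * f 3 * M 1 0 * M 1 1 ^ 2,
    f 0 * M 0 1 ^ 3 + f 1 * M 0 1 ^ 2 * M 1 1 + f 2 * M 0 1 * M 1 1 ^ 2 + f 3 * M 1 1 ^ 3]

theorem act_zero_apply (f : Form R) (M : Mat R) : act f M 0 = ev f (M 0 0) (M 1 0) := by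
  simp [act, ev]

theorem act_one (f : Form R) : act f 1 = f := by
  apply form_ext <;> simp [act]

theorem act_act (f : Form R) (M N : Mat R) : act (act f M) N = act f (M * N) := by
  apply form_ext <;> simp [act, Matrix.mul_apply, Fin.sum_univ_two] <;> ring

theorem ev_act (f : Form R) (M : Mat R) (x y : R) :
    ev (act f M) x y = ev f (M 0 0 * x + M 0 1 * y) (M 1 0 * x + M 1 1 * y) := by
  simp [act, ev]; ring

theorem disc_act (f : Form R) (M : Mat R) : disc (act f M) = M.det ^ 6 * disc f := by
  simp only [disc, act, Matrix.det_fin_two, Matrix.cons_val]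
  generalize M 0 0 = p, M 0 1 = q, M 1 0 = r, M 1 1 = s, f 0 = a, f 1 = b, f 2 = c, f 3 = d
  ring

theorem act_smul (t : R) (f : Form R) (M : Mat R) : act (t • f) M = t • act f M := by
  apply form_ext <;> simp [act] <;> ring

theorem disc_smul (t : R) (f : Form R) : disc (t • f) = t ^ 4 * disc f := by
  simp [disc]; ring

theorem ev_smul (t : R) (f : Form R) (x y : R) : ev (t • f) x y = t * ev f x y := by
  simp [ev]; ring

theorem act_neg_one (f : Form R) : act f (-1) = -f := by
  apply form_ext <;> simp [act] <;> ring

end Ring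

/-- Equivalence of integral binary cubic forms under `GL₂(ℤ)`. -/
def Eqv (f g : Form ℤ) : Prop := ∃ M : Mat ℤ, IsUnit M.det ∧ g = act f M

theorem Eqv.refl (f : Form ℤ) : Eqv f f := ⟨1, by simp, (act_one f).symm⟩

theorem Eqv.symm {f g : Form ℤ} (h : Eqv f g) : Eqv g f := by
  obtain ⟨M, hM, rfl⟩ := h
  refine ⟨M⁻¹, ?_, ?_⟩
  · simpa using hM
  · rw [act_act, Matrix.mul_nonsing_inv _ hM, act_one]

theorem Eqv.trans {f g k : Form ℤ} (h : Eqv f g) (h' : Eqv g k) : Eqv f k := by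
  obtain ⟨M, hM, rfl⟩ := h
  obtain ⟨N, hN, rfl⟩ := h'
  exact ⟨M * N, by simpa using hM.mul hN, act_act _ _ _⟩

/-- The setoid of `GL₂(ℤ)`-equivalence. -/
def eqvSetoid : Setoid (Form ℤ) := ⟨Eqv, Eqv.refl, Eqv.symm, Eqv.trans⟩

/-- `GL₂(ℤ)`-classes of integral binary cubic forms. -/
abbrev Cls := Quotient eqvSetoid

/-- The class of a form. -/
def cls (f : Form ℤ) : Cls := Quotient.mk eqvSetoid f

theorem cls_eq {f g : Form ℤ} : cls f = cls g ↔ Eqv f g := Quotient.eq (r := eqvSetoid)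

theorem Eqv.disc_eq {f g : Form ℤ} (h : Eqv f g) : disc g = disc f := by
  obtain ⟨M, hM, rfl⟩ := h
  rw [disc_act]
  have : M.det ^ 2 = 1 := by
    rcases Int.isUnit_iff.1 hM with h | h <;> simp [h]
  rw [show M.det ^ 6 = (M.det ^ 2) ^ 3 by ring, this]; ring

/-- A form without nontrivial integral zero (equivalently, irreducible over `ℚ`). -/
def Irr (f : Form ℤ) : Prop := ∀ x y : ℤ, ev f x y = 0 → x = 0 ∧ y = 0

theorem Irr.zero_ne {f : Form ℤ} (h : Irr f) : f 0 ≠ 0 := by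
  intro h0
  have := h 1 0 (by simp [ev, h0])
  simp at this

theorem Irr.act {f : Form ℤ} (h : Irr f) {M : Mat ℤ} (hM : M.det ≠ 0) : Irr (act f M) := by
  intro x y hxy
  rw [ev_act] at hxy
  obtain ⟨h1, h2⟩ := h _ _ hxy
  rw [Matrix.det_fin_two] at hM
  constructor
  · have : (M 0 0 * M 1 1 - M 0 1 * M 1 0) * x = 0 := by linear_combination M 1 1 * h1 - M 0 1 * h2
    simpa [hM] using this
  · have : (M 0 0 * M 1 1 - M 0 1 * M 1 0) * y = 0 := by linear_combination M 0 0 * h2 - M 1 0 * h1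
    simpa [hM] using this

theorem Irr.eqv {f g : Form ℤ} (h : Irr f) (e : Eqv f g) : Irr g := by
  obtain ⟨M, hM, rfl⟩ := e
  exact h.act hM.ne_zero

theorem Irr.of_smul {f : Form ℤ} {t : ℤ} (h : Irr (t • f)) : Irr f := by
  intro x y hxy
  exact h x y (by rw [ev_smul, hxy, mul_zero])

theorem eqv_neg (f : Form ℤ) : Eqv f (-f) :=
  ⟨-1, by simp [Matrix.det_fin_two], (act_neg_one f).symm⟩

/-- `f` fails to be maximal at `p`: the associated cubic ring has an overring of index divisible
by `p`. -/
def NonMax (p : ℕ) (f : Form ℤ) : Prop :=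
  (∀ i, (p : ℤ) ∣ f i) ∨ ∃ g, Eqv f g ∧ (p : ℤ) ^ 2 ∣ g 0 ∧ (p : ℤ) ∣ g 1

/-- Divisibility of all coefficients is preserved by substitution. -/
theorem dvd_act {R : Type*} [CommRing R] {p : R} {f : Form R} (h : ∀ i, p ∣ f i) (M : Mat R) (i : Fin 4) :
    p ∣ act f M i := by
  choose g hg using h
  have : f = p • g := funext hg
  rw [this, act_smul]
  exact ⟨_, rfl⟩

theorem NonMax.eqv {p : ℕ} {f g : Form ℤ} (h : NonMax p f) (e : Eqv f g) : NonMax p g := by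
  rcases h with h | ⟨k, hk, h0, h1⟩
  · obtain ⟨M, hM, rfl⟩ := e
    exact Or.inl (dvd_act h M)
  · exact Or.inr ⟨k, e.symm.trans hk, h0, h1⟩

section Realization
variable {K : Type*} [CommRing K]

/-- The multiplication table of the cubic ring attached to `f`, on a normalized basis
`1, w, t`. -/
def MulTable (f : Form ℤ) (w t : K) : Prop :=
  w * t = -(f 0 * f 3) ∧ w ^ 2 = -(f 0 * f 2) + f 1 * w - f 0 * t ∧
    t ^ 2 = -(f 1 * f 3) + f 3 * w - f 2 * t

/-- `1, w, t` are linearly independent over `ℤ`. -/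
def Indep (w t : K) : Prop := ∀ x y z : ℤ, (x : K) + y * w + z * t = 0 → x = 0 ∧ y = 0 ∧ z = 0

/-- Membership in the lattice spanned by `1, w, t`. -/
def InLat (w t x : K) : Prop := ∃ i j k : ℤ, x = i + j * w + k * t

theorem Indep.eq {w t : K} (h : Indep w t) {x y z x' y' z' : ℤ}
    (e : (x : K) + y * w + z * t = x' + y' * w + z' * t) : x = x' ∧ y = y' ∧ z = z' := by
  obtain ⟨h1, h2, h3⟩ := h (x - x') (y - y') (z - z') (by push_cast; linear_combination e)
  omega

theorem Indep.add {w t : K} (h : Indep w t) (i j : ℤ) : Indep (w + i) (t + j) := by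
  intro x y z e
  obtain ⟨h1, h2, h3⟩ := h (x + y * i + z * j) y z (by push_cast; linear_combination e)
  subst h2 h3
  simpa using h1

/-- Comparison of the forms of two lattices, one contained in the other. -/
theorem MulTable.det_smul {f g : Form ℤ} {w t w' t' : K} (hf : MulTable f w t)
    (hg : MulTable g w' t') (hi : Indep w' t') {p q r s i j : ℤ}
    (hw : w = i + p * w' + q * t') (ht : t = j + r * w' + s * t') :
    (p * s - q * r) • f = act g !![p, r; q, s] := by
  obtain ⟨f1, f2, f3⟩ := hf
  obtain ⟨g1, g2, g3⟩ := hg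
  subst hw ht
  obtain ⟨-, a1, a2⟩ := hi.eq (x := i * j - p * r * (g 0 * g 2) - q * s * (g 1 * g 3)
      - (p * s + q * r) * (g 0 * g 3)) (y := p * r * g 1 + q * s * g 3 + p * j + r * i)
    (z := - p * r * g 0 - q * s * g 2 + q * j + s * i) (x' := -(f 0 * f 3)) (y' := 0) (z' := 0)
    (by push_cast; linear_combination f1 - (p * s + q * r) * g1 - p * r * g2 - q * s * g3)
  obtain ⟨-, b1, b2⟩ := hi.eq (x := i ^ 2 - p ^ 2 * (g 0 * g 2) - q ^ 2 * (g 1 * g 3)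
      - 2 * p * q * (g 0 * g 3)) (y := p ^ 2 * g 1 + q ^ 2 * g 3 + 2 * p * i)
    (z := - p ^ 2 * g 0 - q ^ 2 * g 2 + 2 * q * i) (x' := -(f 0 * f 2) + f 1 * i - f 0 * j)
    (y' := f 1 * p - f 0 * r) (z' := f 1 * q - f 0 * s)
    (by push_cast; linear_combination f2 - 2 * p * q * g1 - p ^ 2 * g2 - q ^ 2 * g3)
  obtain ⟨-, c1, c2⟩ := hi.eq (x := j ^ 2 - r ^ 2 * (g 0 * g 2) - s ^ 2 * (g 1 * g 3)
      - 2 * r * s * (g 0 * g 3)) (y := r ^ 2 * g 1 + s ^ 2 * g 3 + 2 * r * j)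
    (z := - r ^ 2 * g 0 - s ^ 2 * g 2 + 2 * s * j) (x' := -(f 1 * f 3) + f 3 * i - f 2 * j)
    (y' := f 3 * p - f 2 * r) (z' := f 3 * q - f 2 * s)
    (by push_cast; linear_combination f3 - 2 * r * s * g1 - r ^ 2 * g2 - s ^ 2 * g3)
  apply form_ext <;> simp [act]
  · linear_combination p * b2 - q * b1
  · linear_combination (-s) * b1 + r * b2 + 2 * p * a2 - 2 * q * a1
  · linear_combination p * c2 - q * c1 - 2 * s * a1 + 2 * r * a2
  · linear_combination (-s) * c1 + r * c2

/-- A multiplicatively closed lattice `ℤ + ℤw + ℤt` has a normalized basis. -/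
theorem exists_mulTable {w t : K} (hi : Indep w t) (h1 : InLat w t (w * t))
    (h2 : InLat w t (w ^ 2)) (h3 : InLat w t (t ^ 2)) :
    ∃ (f : Form ℤ) (i j : ℤ), MulTable f (w + i) (t + j) := by
  obtain ⟨n, e, g, hn⟩ := h1
  obtain ⟨m, b, a, hm⟩ := h2
  obtain ⟨l, d, c, hl⟩ := h3
  have hi' := hi.add (-g) (-e)
  set W := w + ((-g : ℤ) : K) with hW
  set T := t + ((-e : ℤ) : K) with hT
  have hw : w = W + g := by simp [hW]
  have ht : t = T + e := by simp [hT]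
  clear_value W T
  subst hw ht
  have h1 : W * T = ((n + e * g : ℤ) : K) := by push_cast; linear_combination hn
  have h2 : W ^ 2 = ((m + b * g + a * e - g ^ 2 : ℤ) : K) + ((b - 2 * g : ℤ) : K) * W
      + (a : K) * T := by push_cast; linear_combination hm
  have h3 : T ^ 2 = ((l + d * g + c * e - e ^ 2 : ℤ) : K) + (d : K) * W
      + ((c - 2 * e : ℤ) : K) * T := by push_cast; linear_combination hl
  generalize m + b * g + a * e - g ^ 2 = m', b - 2 * g = b', l + d * g + c * e - e ^ 2 = l',
    c - 2 * e = c', n + e * g = n' at h1 h2 h3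
  obtain ⟨-, x2, x3⟩ := hi'.eq (x := b' * n' + a * l') (y := a * d) (z := m' + a * c')
    (x' := 0) (y' := n') (z' := 0) (by push_cast; linear_combination W * h1 - T * h2 - b' * h1
      - a * h3)
  obtain ⟨-, y2, y3⟩ := hi'.eq (x := d * m' + c' * n') (y := l' + d * b') (z := a * d)
    (x' := 0) (y' := 0) (z' := n') (by push_cast; linear_combination T * h1 - W * h3 - d * h2
      - c' * h1)
  refine ⟨![-a, b', -c', d], -g, -e, ?_⟩
  rw [← hW, ← hT]
  refine ⟨?_, ?_, ?_⟩ <;> simp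
  · rw [h1, ← x2]; push_cast; ring
  · have : (m' : K) + a * c' = 0 := by exact_mod_cast congrArg (Int.cast : ℤ → K) x3
    rw [h2]; linear_combination this
  · have : (l' : K) + d * b' = 0 := by exact_mod_cast congrArg (Int.cast : ℤ → K) y2
    rw [h3]; linear_combination this

theorem MulTable.cubic {f : Form ℤ} {w t : K} (h : MulTable f w t) :
    w ^ 3 + (-(f 1 : K)) * w ^ 2 + (f 0 * f 2 : K) * w + (-(f 0 ^ 2 * f 3 : K)) = 0 := by
  obtain ⟨h1, h2, h3⟩ := h
  linear_combination w * h2 - f 0 * h1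

/-- Unimodular changes of basis realize equivalent forms on the same lattice. -/
theorem MulTable.of_eqv {f g : Form ℤ} {w t : K} (hf : MulTable f w t) (hi : Indep w t)
    (e : Eqv f g) : ∃ w' t' : K, MulTable g w' t' ∧ Indep w' t' ∧
      ∀ x, InLat w t x → InLat w' t' x := by
  obtain ⟨M, hM, rfl⟩ := e
  set ε := M.det with hε
  have hεε : ε * ε = 1 := Int.isUnit_mul_self hM
  rw [Matrix.det_fin_two] at hε
  obtain ⟨p, hp⟩ : ∃ p, p = M 0 0 := ⟨_, rfl⟩
  obtain ⟨q, hq⟩ : ∃ q, q = M 0 1 := ⟨_, rfl⟩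
  obtain ⟨r, hr⟩ : ∃ r, r = M 1 0 := ⟨_, rfl⟩
  obtain ⟨s, hs⟩ : ∃ s, s = M 1 1 := ⟨_, rfl⟩
  rw [← hp, ← hq, ← hr, ← hs] at hε
  set W : K := ε * (p * w + r * t) with hW
  set T : K := ε * (q * w + s * t) with hT
  have hεK : (ε : K) * ε = 1 := by exact_mod_cast congrArg (Int.cast : ℤ → K) hεε
  have hdK : (ε : K) = p * s - q * r := by exact_mod_cast congrArg (Int.cast : ℤ → K) hε
  have hw : w = s * W - r * T := by
    rw [hW, hT]; linear_combination -w * hεK + w * ε * hdK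
  have ht : t = -q * W + p * T := by
    rw [hW, hT]; linear_combination -t * hεK + t * ε * hdK
  have hlat : ∀ x, InLat w t x → InLat W T x := by
    rintro x ⟨i, j, k, rfl⟩
    refine ⟨i, j * s - k * q, -j * r + k * p, ?_⟩
    push_cast
    linear_combination j * hw + k * ht
  have hin : Indep W T := by
    intro x y z e
    obtain ⟨h1, h2, h3⟩ := hi x (ε * (y * p + z * q)) (ε * (y * r + z * s))
      (by push_cast; linear_combination e)
    have hε0 : ε ≠ 0 := hM.ne_zero
    have h2 : y * p + z * q = 0 := by simpa [hε0] using h2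
    have h3 : y * r + z * s = 0 := by simpa [hε0] using h3
    refine ⟨h1, ?_, ?_⟩
    · linear_combination ε * s * h2 - ε * q * h3 - y * hεε + y * ε * hε
    · linear_combination -ε * r * h2 + ε * p * h3 - z * hεε + z * ε * hε
  obtain ⟨f1, f2, f3⟩ := hf
  have prod : ∀ a b c : ℤ, InLat w t (a * w ^ 2 + b * (w * t) + c * t ^ 2) := by
    intro a b c
    refine ⟨-a * (f 0 * f 2) - b * (f 0 * f 3) - c * (f 1 * f 3), a * f 1 + c * f 3,
      - a * f 0 - c * f 2, ?_⟩
    push_cast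
    linear_combination a * f2 + b * f1 + c * f3
  obtain ⟨g, i, j, hg⟩ := exists_mulTable hin
    (hlat _ (by
      convert prod (ε * ε * (p * q)) (ε * ε * (p * s + q * r)) (ε * ε * (r * s)) using 1
      rw [hW, hT]; push_cast; ring))
    (hlat _ (by
      convert prod (ε * ε * p ^ 2) (ε * ε * (2 * p * r)) (ε * ε * r ^ 2) using 1
      rw [hW]; push_cast; ring))
    (hlat _ (by
      convert prod (ε * ε * q ^ 2) (ε * ε * (2 * q * s)) (ε * ε * s ^ 2) using 1
      rw [hT]; push_cast; ring))
  have key := hg.det_smul ⟨f1, f2, f3⟩ hi (p := ε * p) (q := ε * r) (r := ε * q) (s := ε * s)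
    (i := i) (j := j) (by rw [hW]; push_cast; ring) (by rw [hT]; push_cast; ring)
  have hgact : g = act f M := by
    have e1 : ε * p * (ε * s) - ε * r * (ε * q) = ε := by
      linear_combination (p * s - q * r) * hεε - hε
    have e2 : (!![ε * p, ε * q; ε * r, ε * s] : Mat ℤ) = ε • M := by
      ext i j; fin_cases i <;> fin_cases j <;> simp [hp, hq, hr, hs]
    rw [e1, e2] at key
    rcases Int.isUnit_iff.1 hM with h | h
    · simpa [h] using key
    · rw [h] at key
      have h' : act f (-1 • M) = - act f M := by
        rw [show (-1 : ℤ) • M = M * (-1) by simp, ← act_act, act_neg_one]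
      rw [h'] at key
      simpa using key
  refine ⟨_, _, hgact ▸ hg, hin.add i j, fun x hx => ?_⟩
  obtain ⟨a, b, c, h⟩ := hlat x hx
  refine ⟨a - b * i - c * j, b, c, ?_⟩
  rw [h]; push_cast; ring

end Realization

/-- Diagonalization of an integral two-by-two matrix by unimodular row and column operations. -/
theorem exists_diag (M : Mat ℤ) (hM : M.det ≠ 0) : ∃ (U V : Mat ℤ) (d e : ℤ),
    IsUnit U.det ∧ IsUnit V.det ∧ M = U * !![d, 0; 0, e] * V := by
  let S : Set ℕ := {n | n ≠ 0 ∧ ∃ U V : Mat ℤ, IsUnit U.det ∧ IsUnit V.det ∧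
    ((U * M * V) 0 0).natAbs = n}
  have swap : IsUnit (!![0, 1; 1, 0] : Mat ℤ).det := by simp [Matrix.det_fin_two]
  have hS : S.Nonempty := by
    by_cases h0 : M 0 0 = 0
    · have h1 : M 0 1 ≠ 0 := by
        intro h1; apply hM; simp [Matrix.det_fin_two, h0, h1]
      exact ⟨(M 0 1).natAbs, by simpa using h1, 1, !![0, 1; 1, 0], by simp, swap, by
        simp [Matrix.mul_apply, Fin.sum_univ_two]⟩
    · exact ⟨(M 0 0).natAbs, by simpa using h0, 1, 1, by simp, by simp, by simp⟩
  obtain ⟨hn0, U, V, hU, hV, hn⟩ := Nat.sInf_mem hS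
  have hmin : ∀ U V : Mat ℤ, IsUnit U.det → IsUnit V.det → ((U * M * V) 0 0).natAbs < sInf S →
      (U * M * V) 0 0 = 0 := by
    intro U V hU hV h
    by_contra h0
    exact Nat.notMem_of_lt_sInf h ⟨by simpa using h0, U, V, hU, hV, rfl⟩
  set N := U * M * V with hN
  rw [← hn] at hmin hn0
  clear_value N
  have hn0' : N 0 0 ≠ 0 := by simpa using hn0
  -- the corner entry divides its neighbours
  have small : ∀ x : ℤ, (x - x / N 0 0 * N 0 0).natAbs < (N 0 0).natAbs := by
    intro x
    have h1 := Int.emod_nonneg x hn0'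
    have h2 := Int.emod_lt_abs x hn0'
    have h3 : x - x / N 0 0 * N 0 0 = x % N 0 0 := by
      linear_combination -Int.emod_add_mul_ediv x (N 0 0)
    rw [h3]; rw [Int.abs_eq_natAbs] at h2; omega
  have h01 : N 0 1 - N 0 1 / N 0 0 * N 0 0 = 0 := by
    have key := hmin U (V * !![-(N 0 1 / N 0 0), 1; 1, 0]) hU
      (by rw [Matrix.det_mul]; exact hV.mul (by simp [Matrix.det_fin_two]))
    have e : (U * M * (V * !![-(N 0 1 / N 0 0), 1; 1, 0])) 0 0
        = N 0 1 - N 0 1 / N 0 0 * N 0 0 := by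
      rw [← mul_assoc, ← hN]; simp [Matrix.mul_apply, Fin.sum_univ_two]; ring
    rw [e] at key
    exact key (small _)
  have h10 : N 1 0 - N 1 0 / N 0 0 * N 0 0 = 0 := by
    have key := hmin (!![-(N 1 0 / N 0 0), 1; 1, 0] * U) V
      (by rw [Matrix.det_mul]; exact IsUnit.mul (by simp [Matrix.det_fin_two]) hU) hV
    have e : (!![-(N 1 0 / N 0 0), 1; 1, 0] * U * M * V) 0 0
        = N 1 0 - N 1 0 / N 0 0 * N 0 0 := by
      rw [mul_assoc _ U, mul_assoc _ (U * M), ← hN]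
      simp [Matrix.mul_apply, Fin.sum_univ_two]; ring
    rw [e] at key
    exact key (small _)
  generalize hx : N 0 1 / N 0 0 = x at h01
  generalize hy : N 1 0 / N 0 0 = y at h10
  have hD : N = !![1, 0; y, 1] * !![N 0 0, 0; 0, N 1 1 - y * x * N 0 0] * !![1, x; 0, 1] := by
    ext i j; fin_cases i <;> fin_cases j <;> simp [Matrix.mul_apply, Fin.sum_univ_two]
    · linear_combination h01
    · linear_combination h10
    · ring
  refine ⟨U⁻¹ * !![1, 0; y, 1], !![1, x; 0, 1] * V⁻¹, N 0 0, N 1 1 - y * x * N 0 0, ?_, ?_, ?_⟩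
  · rw [Matrix.det_mul]
    exact IsUnit.mul (by simpa using hU) (by simp [Matrix.det_fin_two])
  · rw [Matrix.det_mul]
    exact IsUnit.mul (by simp [Matrix.det_fin_two]) (by simpa using hV)
  · have : M = U⁻¹ * N * V⁻¹ := by
      rw [hN, mul_assoc U, Matrix.nonsing_inv_mul_cancel_left _ _ hU,
        Matrix.mul_nonsing_inv_cancel_right _ _ hV]
    rw [this]
    conv_lhs => rw [hD]
    simp only [mul_assoc]

theorem nonMax_of_diag_aux {p : ℕ} (hp : p.Prime) {f g : Form ℤ} {i j : ℕ} {d e : ℤ}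
    (hd : ¬ (p : ℤ) ∣ d) (he : ¬ (p : ℤ) ∣ e) (hij : j ≤ i) (hi : i ≠ 0)
    (h0 : p ^ j * e * f 0 = (p ^ i * d) ^ 2 * g 0) (h1 : f 1 = p ^ i * d * g 1)
    (h2 : f 2 = p ^ j * e * g 2) (h3 : p ^ i * d * f 3 = (p ^ j * e) ^ 2 * g 3) :
    NonMax p f := by
  have hp' : Prime (p : ℤ) := Nat.prime_iff_prime_int.1 hp
  have hpi : (p : ℤ) ∣ p ^ i := dvd_pow_self _ hi
  rcases hij.eq_or_lt with rfl | hlt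
  · have hpj : (p : ℤ) ^ j ≠ 0 := pow_ne_zero _ hp'.ne_zero
    left
    have a0 : e * f 0 = p ^ j * (d ^ 2 * g 0) := by
      apply mul_left_cancel₀ hpj; linear_combination h0
    have a3 : d * f 3 = p ^ j * (e ^ 2 * g 3) := by
      apply mul_left_cancel₀ hpj; linear_combination h3
    intro k
    fin_cases k
    · exact (hp'.dvd_or_dvd (a0 ▸ hpi.mul_right _)).resolve_left he
    · exact h1 ▸ (hpi.mul_right _).mul_right _
    · exact h2 ▸ (hpi.mul_right _).mul_right _
    · exact (hp'.dvd_or_dvd (a3 ▸ hpi.mul_right _)).resolve_left hd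
  · right
    refine ⟨f, Eqv.refl f, ?_, h1 ▸ (hpi.mul_right _).mul_right _⟩
    obtain ⟨k, rfl⟩ := Nat.exists_eq_add_of_lt hlt
    have hpj : (p : ℤ) ^ j ≠ 0 := pow_ne_zero _ hp'.ne_zero
    have a0 : e * f 0 = p ^ 2 * (p ^ (j + 2 * k) * d ^ 2 * g 0) := by
      apply mul_left_cancel₀ hpj; linear_combination h0
    exact (IsCoprime.pow_left ((Prime.coprime_iff_not_dvd hp').2 he)).dvd_of_dvd_mul_left
      (a0 ▸ dvd_mul_right _ _)

/-- If the lattice of `f` has nontrivial index in that of `g`, then `f` is not maximal. -/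
theorem exists_nonMax_of_det {f g : Form ℤ} {M : Mat ℤ} (h0 : M.det ≠ 0) (hu : ¬ IsUnit M.det)
    (h : M.det • f = act g M) : ∃ p : ℕ, p.Prime ∧ NonMax p f := by
  obtain ⟨U, V, d, e, hU, hV, rfl⟩ := exists_diag M h0
  have hdet : (U * !![d, 0; 0, e] * V).det = U.det * V.det * (d * e) := by
    simp [Matrix.det_fin_two_of]; ring
  obtain ⟨p, hp, hpd⟩ : ∃ p : ℕ, p.Prime ∧ (p : ℤ) ∣ d * e := by
    have : (d * e).natAbs ≠ 1 := by
      intro h1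
      apply hu
      rw [hdet]
      exact (hU.mul hV).mul (Int.isUnit_iff_natAbs_eq.2 h1)
    obtain ⟨p, hp, hpd⟩ := Nat.exists_prime_and_dvd this
    exact ⟨p, hp, Int.natCast_dvd.2 hpd⟩
  refine ⟨p, hp, ?_⟩
  have hde : d * e ≠ 0 := by
    intro h; apply h0; rw [hdet, h, mul_zero]
  have hd : d ≠ 0 := left_ne_zero_of_mul hde
  have he : e ≠ 0 := right_ne_zero_of_mul hde
  set f₁ := act f V⁻¹ with hf₁
  have hff₁ : Eqv f₁ f := ⟨V, hV, by rw [hf₁, act_act, Matrix.nonsing_inv_mul _ hV, act_one]⟩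
  obtain ⟨g₁, hg₁⟩ : ∃ g₁ : Form ℤ, (d * e) • f₁ = act g₁ !![d, 0; 0, e] := by
    have h2 : (U.det * V.det * (d * e)) • f₁ = act (act g U) !![d, 0; 0, e] := by
      rw [hf₁, ← act_smul, ← hdet, h, act_act, act_act, mul_assoc, mul_assoc,
        Matrix.mul_nonsing_inv _ hV, mul_one]
    have hu2 := Int.isUnit_mul_self (hU.mul hV)
    refine ⟨(U.det * V.det) • act g U, ?_⟩
    rw [act_smul, ← h2, smul_smul, ← mul_assoc, hu2, one_mul]
  apply NonMax.eqv _ hff₁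
  have c0 := congrFun hg₁ 0
  have c1 := congrFun hg₁ 1
  have c2 := congrFun hg₁ 2
  have c3 := congrFun hg₁ 3
  simp [act] at c0 c1 c2 c3
  replace c0 : e * f₁ 0 = d ^ 2 * g₁ 0 := by
    apply mul_left_cancel₀ hd; linear_combination c0
  replace c1 : f₁ 1 = d * g₁ 1 := by
    apply mul_left_cancel₀ hde; linear_combination c1
  replace c2 : f₁ 2 = e * g₁ 2 := by
    apply mul_left_cancel₀ hde; linear_combination c2
  replace c3 : d * f₁ 3 = e ^ 2 * g₁ 3 := by
    apply mul_left_cancel₀ he; linear_combination c3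
  have hp' : Prime (p : ℤ) := Nat.prime_iff_prime_int.1 hp
  have fin : ∀ x : ℤ, x ≠ 0 → ∃ (i : ℕ) (y : ℤ), ¬ (p : ℤ) ∣ y ∧ x = p ^ i * y := by
    intro x hx
    obtain ⟨y, h1, h2⟩ := (Int.finiteMultiplicity_iff (a := (p : ℤ)).2
      ⟨by simpa using hp.ne_one, hx⟩).exists_eq_pow_mul_and_not_dvd
    exact ⟨_, y, h2, h1⟩
  obtain ⟨i, d', hd', rfl⟩ := fin d hd
  obtain ⟨j, e', he', rfl⟩ := fin e he
  have hij : i ≠ 0 ∨ j ≠ 0 := by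
    by_contra! hc
    rw [hc.1, hc.2] at hpd
    rcases hp'.dvd_or_dvd hpd with h | h
    · exact hd' (by simpa using h)
    · exact he' (by simpa using h)
  rcases le_total j i with hji | hji
  · exact nonMax_of_diag_aux hp hd' he' hji (by omega) c0 c1 c2 c3
  · have hs : Eqv f₁ (act f₁ !![0, 1; 1, 0]) := ⟨_, by simp [Matrix.det_fin_two], rfl⟩
    refine NonMax.eqv (nonMax_of_diag_aux (g := act g₁ !![0, 1; 1, 0]) hp he' hd' hji (by omega)
      ?_ ?_ ?_ ?_) hs.symm <;> simpa [act]

theorem MulTable.isIntegral {K : Type*} [CommRing K] {f : Form ℤ} {w t : K}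
    (h : MulTable f w t) : IsIntegral ℤ w := by
  refine ⟨Polynomial.X ^ 3 + Polynomial.C (-f 1) * Polynomial.X ^ 2
    + Polynomial.C (f 0 * f 2) * Polynomial.X + Polynomial.C (-(f 0 ^ 2 * f 3)),
    by monicity!, ?_⟩
  simp only [Polynomial.eval₂_add, Polynomial.eval₂_mul, Polynomial.eval₂_pow,
    Polynomial.eval₂_X, Polynomial.eval₂_C, algebraMap_int_eq, Int.coe_castRingHom]
  push_cast
  linear_combination h.cubic

section Nonmaximal
variable {K : Type*} [Field K] [CharZero K]

/-- A form that is not maximal at `p` produces an integral element outside its lattice. -/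
theorem NonMax.exists_integral {f : Form ℤ} {w t : K} (h : MulTable f w t) (hi : Indep w t)
    {p : ℕ} (hp : p.Prime) (hf : NonMax p f) : ∃ x : K, IsIntegral ℤ x ∧ ¬ InLat w t x := by
  have hp0 : (p : K) ≠ 0 := by exact_mod_cast hp.ne_zero
  have main : ∀ (g g' : Form ℤ) (w' t' T : K), MulTable g w' t' → Indep w' t' →
      MulTable g' (w' / p) T → (∀ x, InLat w t x → InLat w' t' x) →
      ∃ x : K, IsIntegral ℤ x ∧ ¬ InLat w t x := by
    intro g g' w' t' T hg hi' hg' hl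
    refine ⟨w' / p, ?_, fun hx => ?_⟩
    · exact hg'.isIntegral
    · obtain ⟨i, j, k, e⟩ := hl _ hx
      rw [div_eq_iff hp0] at e
      have := (hi'.eq (x := 0) (y := 1) (z := 0) (x' := i * p) (y' := j * p) (z' := k * p)
        (by push_cast; linear_combination e)).2.1
      have h1 : (p : ℤ) ∣ 1 := Dvd.intro_left j this.symm
      exact hp.one_lt.ne' (by exact_mod_cast Int.eq_one_of_dvd_one (by positivity) h1)
  rcases hf with hf | ⟨g, hg, h0, h1⟩
  · choose g hg using hf
    refine main f g w t (t / p) h hi ?_ fun x hx => hx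
    obtain ⟨f1, f2, f3⟩ := h
    simp only [hg] at f1 f2 f3
    push_cast at f1 f2 f3
    refine ⟨?_, ?_, ?_⟩ <;> field_simp
    · linear_combination f1
    · linear_combination f2
    · linear_combination f3
  · obtain ⟨w', t', hg', hi', hl⟩ := h.of_eqv hi hg
    obtain ⟨a, ha⟩ := h0
    obtain ⟨b, hb⟩ := h1
    refine main g ![a, b, g 2, p * g 3] w' t' t' hg' hi' ?_ hl
    obtain ⟨f1, f2, f3⟩ := hg'
    simp only [ha, hb] at f1 f2 f3
    push_cast at f1 f2 f3
    refine ⟨?_, ?_, ?_⟩ <;> simp <;> field_simp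
    · linear_combination f1
    · linear_combination f2
    · linear_combination f3

end Nonmaximal

/-- The form of a basis `1, w, t` has the discriminant of the basis. -/
theorem discr_eq_disc {S : Type*} [CommRing S] (b : Module.Basis (Fin 3) ℤ S) {f : Form ℤ}
    (h0 : b 0 = 1) (h : MulTable f (b 1) (b 2)) : Algebra.discr ℤ b = disc f := by
  obtain ⟨h1, h2, h3⟩ := h
  have r0 : ∀ (x : S) (i j k : ℤ), x = i + j * b 1 + k * b 2 →
      b.repr x = Finsupp.single 0 i + Finsupp.single 1 j + Finsupp.single 2 k := by
    rintro x i j k rfl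
    have : (i + j * b 1 + k * b 2 : S) = i • b 0 + j • b 1 + k • b 2 := by
      simp [h0]
    rw [this, map_add, map_add, map_smul, map_smul, map_smul]
    simp
  have tr : ∀ (x : S) (i0 j0 k0 i1 j1 k1 i2 j2 k2 : ℤ), x * b 0 = i0 + j0 * b 1 + k0 * b 2 →
      x * b 1 = i1 + j1 * b 1 + k1 * b 2 → x * b 2 = i2 + j2 * b 1 + k2 * b 2 →
      Algebra.trace ℤ S x = i0 + j1 + k2 := by
    intro x i0 j0 k0 i1 j1 k1 i2 j2 k2 e0 e1 e2
    rw [Algebra.trace_eq_matrix_trace b, Matrix.trace, Fin.sum_univ_three]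
    simp [Algebra.leftMulMatrix_eq_repr_mul, r0 _ _ _ _ e0, r0 _ _ _ _ e1, r0 _ _ _ _ e2]
  have t1 : Algebra.trace ℤ S 1 = 3 := by
    rw [tr 1 1 0 0 0 1 0 0 0 1 (by simp [h0]) (by simp) (by simp)]; norm_num
  have tw : Algebra.trace ℤ S (b 1) = f 1 := by
    rw [tr (b 1) 0 1 0 (-(f 0 * f 2)) (f 1) (-f 0) (-(f 0 * f 3)) 0 0 (by simp [h0])
      (by push_cast; linear_combination h2) (by push_cast; linear_combination h1)]; ring
  have tt : Algebra.trace ℤ S (b 2) = -f 2 := by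
    rw [tr (b 2) 0 0 1 (-(f 0 * f 3)) 0 0 (-(f 1 * f 3)) (f 3) (-f 2) (by simp [h0])
      (by push_cast; linear_combination h1) (by push_cast; linear_combination h3)]; ring
  have ti : ∀ i : ℤ, Algebra.trace ℤ S (i : S) = 3 * i := by
    intro i
    rw [show (i : S) = i • 1 by simp, map_smul, t1, smul_eq_mul, mul_comm]
  have tm : ∀ (i j k : ℤ), Algebra.trace ℤ S (i + j * b 1 + k * b 2) = 3 * i + j * f 1 - k * f 2 := by
    intro i j k
    rw [map_add, map_add, ti, show (j : S) * b 1 = j • b 1 by simp,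
      show (k : S) * b 2 = k • b 2 by simp, map_smul, map_smul, tw, tt, smul_eq_mul, smul_eq_mul]
    ring
  have e1 : b 1 * b 2 = ((-(f 0 * f 3) : ℤ) : S) + (0 : ℤ) * b 1 + (0 : ℤ) * b 2 := by
    push_cast; linear_combination h1
  have e1' : b 2 * b 1 = ((-(f 0 * f 3) : ℤ) : S) + (0 : ℤ) * b 1 + (0 : ℤ) * b 2 := by
    push_cast; linear_combination h1
  have e2 : b 1 * b 1 = ((-(f 0 * f 2) : ℤ) : S) + (f 1) * b 1 + (-f 0 : ℤ) * b 2 := by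
    push_cast; linear_combination h2
  have e3 : b 2 * b 2 = ((-(f 1 * f 3) : ℤ) : S) + (f 3) * b 1 + (-f 2 : ℤ) * b 2 := by
    push_cast; linear_combination h3
  rw [Algebra.discr_def, Matrix.det_fin_three]
  simp only [Algebra.traceMatrix_apply, Algebra.traceForm_apply, h0, one_mul, mul_one, t1, tw, tt,
    e1, e1', e2, e3, tm, disc]
  ring

section NumberField
variable {K : Type*} [Field K] [NumberField K]

/-- `1, w, t` is a normalized integral basis, with form `f`. -/
structure IntBasis (f : Form ℤ) (w t : K) : Prop where
  table : MulTable f w t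
  indep : Indep w t
  mem : ∀ x : K, IsIntegral ℤ x → InLat w t x

theorem MulTable.swap {K : Type*} [Field K] {f : Form ℤ} {w t : K} (h : MulTable f w t) :
    MulTable ![-f 3, -f 2, -f 1, -f 0] t w := by
  obtain ⟨h1, h2, h3⟩ := h
  refine ⟨?_, ?_, ?_⟩ <;> simp
  · linear_combination h1
  · linear_combination h3
  · linear_combination h2

theorem IntBasis.discr_eq {f : Form ℤ} {w t : K} (h : IntBasis f w t) :
    NumberField.discr K = disc f := by
  let w' : NumberField.RingOfIntegers K := ⟨w, h.table.isIntegral⟩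
  let t' : NumberField.RingOfIntegers K := ⟨t, h.table.swap.isIntegral⟩
  have hli : LinearIndependent ℤ ![1, w', t'] := by
    rw [Fintype.linearIndependent_iff]
    intro g hg
    rw [Fin.sum_univ_three] at hg
    have := congrArg (algebraMap (NumberField.RingOfIntegers K) K) hg
    simp only [Matrix.cons_val_zero, Matrix.cons_val_one, Matrix.cons_val, map_add, zsmul_eq_mul,
      map_mul, map_intCast, mul_one, map_zero] at this
    obtain ⟨h1, h2, h3⟩ := h.indep _ _ _ this
    intro i; fin_cases i <;> assumption
  have hsp : ⊤ ≤ Submodule.span ℤ (Set.range ![1, w', t']) := by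
    rintro x -
    obtain ⟨i, j, k, e⟩ := h.mem x x.2
    have : x = i • 1 + j • w' + k • t' := by
      apply NumberField.RingOfIntegers.ext
      simp only [e, map_add, zsmul_eq_mul, map_mul, map_intCast, mul_one]
      rfl
    rw [this]
    have hm : ∀ a : Fin 3, ![1, w', t'] a ∈ Submodule.span ℤ (Set.range ![1, w', t']) :=
      fun a => Submodule.subset_span ⟨a, rfl⟩
    exact add_mem (add_mem (Submodule.smul_mem _ _ (hm 0)) (Submodule.smul_mem _ _ (hm 1)))
      (Submodule.smul_mem _ _ (hm 2))
  let b := Module.Basis.mk hli hsp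
  have hb : ∀ i, b i = ![1, w', t'] i := fun i => Module.Basis.mk_apply hli hsp i
  rw [← NumberField.discr_eq_discr K b]
  apply discr_eq_disc
  · simp [hb]
  · rw [hb, hb]
    obtain ⟨h1, h2, h3⟩ := h.table
    refine ⟨?_, ?_, ?_⟩ <;> apply NumberField.RingOfIntegers.ext <;> simpa [w', t']

theorem exists_intBasis (hK : Module.finrank ℚ K = 3) :
    ∃ (f : Form ℤ) (w t : K), IntBasis f w t := by
  let R := NumberField.RingOfIntegers K
  let N : Submodule ℤ R := Submodule.span ℤ {1}
  have tf : Module.IsTorsionFree ℤ (R ⧸ N) := by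
    rw [Module.isTorsionFree_iff_smul_eq_zero]
    intro n x hx
    by_contra! hc
    obtain ⟨hn, hc⟩ := hc
    obtain ⟨x, rfl⟩ := Submodule.Quotient.mk_surjective N x
    rw [← Submodule.Quotient.mk_smul, Submodule.Quotient.mk_eq_zero,
      Submodule.mem_span_singleton] at hx
    obtain ⟨m, hm⟩ := hx
    apply hc
    rw [Submodule.Quotient.mk_eq_zero, Submodule.mem_span_singleton]
    have hm' := congrArg (algebraMap R K) hm
    simp only [zsmul_eq_mul, map_mul, map_intCast, mul_one] at hm'
    have hx' : algebraMap R K x = algebraMap ℚ K (m / n) := by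
      have : (n : K) ≠ 0 := by exact_mod_cast hn
      rw [map_div₀, eq_div_iff (by simpa using this)]
      simp only [map_intCast]
      rw [hm', mul_comm]
    have hI : IsIntegral ℤ (algebraMap ℚ K (m / n)) := hx' ▸ x.isIntegral_coe
    rw [isIntegral_algebraMap_iff (algebraMap ℚ K).injective,
      IsIntegrallyClosed.isIntegral_iff] at hI
    obtain ⟨y, hy⟩ := hI
    refine ⟨y, NumberField.RingOfIntegers.ext ?_⟩
    change algebraMap R K (y • 1) = algebraMap R K x
    rw [hx', ← hy]
    simp
  have : Module.Finite ℤ R := inferInstance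
  have : Module.Free ℤ (R ⧸ N) := Module.free_of_finite_type_torsion_free'
  have hN : Module.finrank ℤ N = 1 := by
    rw [← (LinearEquiv.toSpanNonzeroSingleton ℤ R 1 one_ne_zero).finrank_eq]
    simp
  have hr : Module.finrank ℤ (R ⧸ N) = 2 := by
    have := Submodule.finrank_quotient_add_finrank N
    have h2 : Module.finrank ℤ R = 3 := by rw [NumberField.RingOfIntegers.rank, hK]
    omega
  let c := Module.finBasisOfFinrankEq ℤ (R ⧸ N) hr
  obtain ⟨w, hw⟩ := Submodule.Quotient.mk_surjective N (c 0)
  obtain ⟨t, ht⟩ := Submodule.Quotient.mk_surjective N (c 1)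
  have hi : Indep (w : K) (t : K) := by
    intro x y z e
    have e' : (x : R) + y * w + z * t = 0 := by
      apply NumberField.RingOfIntegers.ext
      simpa using e
    have hx : N.mkQ (x : R) = 0 := by
      rw [Submodule.mkQ_apply, Submodule.Quotient.mk_eq_zero, Submodule.mem_span_singleton]
      exact ⟨x, by simp⟩
    have h2 : y • c 0 + z • c 1 = 0 := by
      have := congrArg N.mkQ e'
      rw [map_add, map_add, hx, zero_add, map_zero, ← zsmul_eq_mul, ← zsmul_eq_mul, map_zsmul,
        map_zsmul] at this
      rw [← hw, ← ht]; exact this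
    have h3 := Fintype.linearIndependent_iff.1 c.linearIndependent ![y, z]
      (by rw [Fin.sum_univ_two]; simpa using h2)
    have hy : y = 0 := h3 0
    have hz : z = 0 := h3 1
    subst hy hz
    simpa using e
  have hl : ∀ x : K, IsIntegral ℤ x → InLat (w : K) (t : K) x := by
    intro x hx
    let x' : R := ⟨x, hx⟩
    have h1 := c.sum_repr (N.mkQ x')
    rw [Fin.sum_univ_two, ← hw, ← ht] at h1
    have h2 : N.mkQ (x' - (c.repr (N.mkQ x') 0 • w + c.repr (N.mkQ x') 1 • t)) = 0 := by
      rw [map_sub, sub_eq_zero]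
      exact h1.symm
    rw [Submodule.mkQ_apply, Submodule.Quotient.mk_eq_zero, Submodule.mem_span_singleton] at h2
    obtain ⟨i, hi⟩ := h2
    refine ⟨i, c.repr (N.mkQ x') 0, c.repr (N.mkQ x') 1, ?_⟩
    have := congrArg (algebraMap R K) hi
    simp only [map_sub, map_add, zsmul_eq_mul, map_mul, map_intCast, mul_one] at this
    have e : algebraMap R K x' = x := rfl
    rw [e] at this
    linear_combination -this
  obtain ⟨f, i, j, hf⟩ := exists_mulTable hi (hl _ (w.isIntegral_coe.mul t.isIntegral_coe))
    (hl _ (w.isIntegral_coe.pow 2))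
    (hl _ (t.isIntegral_coe.pow 2))
  refine ⟨f, _, _, hf, hi.add i j, fun x hx => ?_⟩
  obtain ⟨a, b, c, h⟩ := hl x hx
  refine ⟨a - b * i - c * j, b, c, ?_⟩
  rw [h]; push_cast; ring

end NumberField

/-- A primitive integer vector extends to a unimodular matrix; every integer vector is a multiple
of a primitive one. -/
theorem exists_primitive {x y : ℤ} (h : ¬ (x = 0 ∧ y = 0)) :
    ∃ (M : Mat ℤ) (k : ℤ), M.det = 1 ∧ k ≠ 0 ∧ x = k * M 0 0 ∧ y = k * M 1 0 := by
  have hg : 0 < Int.gcd x y := Nat.pos_of_ne_zero fun h0 => h (Int.gcd_eq_zero_iff.1 h0)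
  obtain ⟨x', y', h1, hx, hy⟩ := Int.exists_gcd_one hg
  obtain ⟨u, v, huv⟩ := Int.isCoprime_iff_gcd_eq_one.2 h1
  refine ⟨!![x', -v; y', u], Int.gcd x y, ?_, by exact_mod_cast hg.ne', ?_, ?_⟩
  · rw [Matrix.det_fin_two]; simp; linear_combination huv
  · simpa [mul_comm] using hx
  · simpa [mul_comm] using hy

theorem ev_mul (f : Form ℤ) (k x y : ℤ) : ev f (k * x) (k * y) = k ^ 3 * ev f x y := by
  simp only [ev]; ring

theorem exists_eqv_zero {f : Form ℤ} (h : ¬ Irr f) : ∃ g, Eqv f g ∧ g 0 = 0 := by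
  simp only [Irr, not_forall] at h
  obtain ⟨x, y, he, h⟩ := h
  obtain ⟨M, k, hM, hk, rfl, rfl⟩ := exists_primitive h
  refine ⟨act f M, ⟨M, by simp [hM], rfl⟩, ?_⟩
  rw [ev_mul] at he
  rw [act_zero_apply]
  simpa [hk] using he

theorem MulTable.irr {K : Type*} [Field K] {f : Form ℤ} {w t : K} (h : MulTable f w t)
    (hi : Indep w t) : Irr f := by
  by_contra hf
  obtain ⟨g, e, g0⟩ := exists_eqv_zero hf
  obtain ⟨w', t', ⟨-, h2, -⟩, hi', -⟩ := h.of_eqv hi e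
  rw [g0] at h2
  have h3 : w' * (w' - g 1) = 0 := by linear_combination h2
  rcases mul_eq_zero.1 h3 with h | h
  · have := (hi' 0 1 0 (by simp [h])).2.1
    omega
  · have := (hi' (-g 1) 1 0 (by push_cast; linear_combination h)).2.1
    omega

theorem eqv_of_smul {f g : Form ℤ} {M : Mat ℤ} (hM : IsUnit M.det) (h : M.det • f = act g M) :
    Eqv f g := by
  rcases Int.isUnit_iff.1 hM with h1 | h1
  · rw [h1, one_smul] at h
    exact Eqv.symm ⟨M, hM, h⟩
  · refine Eqv.symm (Eqv.trans ⟨M, hM, rfl⟩ ?_)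
    rw [← h, h1]
    simpa using eqv_neg (-f)

section NumberField
variable {K : Type*} [Field K] [NumberField K]

theorem IntBasis.maximal {f : Form ℤ} {w t : K} (h : IntBasis f w t) {p : ℕ} (hp : p.Prime) :
    ¬ NonMax p f := fun hf => by
  obtain ⟨x, hx, hx'⟩ := hf.exists_integral h.table h.indep hp
  exact hx' (h.mem x hx)

theorem IntBasis.eqv_of_maximal {f g : Form ℤ} {w t w' t' : K} (hf : MulTable f w t)
    (hi : Indep w t) (hm : ∀ p : ℕ, p.Prime → ¬ NonMax p f) (hg : IntBasis g w' t') :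
    Eqv f g := by
  obtain ⟨i, p, q, hw⟩ := hg.mem w hf.isIntegral
  obtain ⟨j, r, s, ht⟩ := hg.mem t hf.swap.isIntegral
  have key := hf.det_smul hg.table hg.indep hw ht
  have hd : (!![p, r; q, s] : Mat ℤ).det = p * s - q * r := by
    rw [Matrix.det_fin_two]; simp; ring
  rw [← hd] at key
  by_cases hu : IsUnit (!![p, r; q, s] : Mat ℤ).det
  · exact eqv_of_smul hu key
  · exfalso
    have hne : (!![p, r; q, s] : Mat ℤ).det ≠ 0 := by
      intro h0
      rw [hd] at h0
      have h0' : (p : K) * s - q * r = 0 := by exact_mod_cast congrArg (Int.cast : ℤ → K) h0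
      obtain ⟨-, hs, hq⟩ := hi (-(s * i) + q * j) s (-q) (by
        rw [hw, ht]; push_cast; linear_combination w' * h0')
      obtain ⟨-, hr, hp⟩ := hi (-(r * i) + p * j) r (-p) (by
        rw [hw, ht]; push_cast; linear_combination -t' * h0')
      have hq : q = 0 := by omega
      have hp : p = 0 := by omega
      rw [hp, hq] at hw
      have := (hi (-i) 1 0 (by rw [hw]; push_cast; ring)).2.1
      omega
    obtain ⟨p, hp, h⟩ := exists_nonMax_of_det hne hu key
    exact hm p hp h

theorem IntBasis.eqv_of_ringEquiv {L : Type*} [Field L] [NumberField L] (e : L ≃+* K)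
    {f g : Form ℤ} {w t : K} {w' t' : L} (h : IntBasis f w t) (h' : IntBasis g w' t') :
    Eqv g f := by
  have h1 : MulTable g (e w') (e t') := by
    obtain ⟨h1, h2, h3⟩ := h'.table
    refine ⟨?_, ?_, ?_⟩
    · simpa using congrArg e h1
    · simpa using congrArg e h2
    · simpa using congrArg e h3
  refine IntBasis.eqv_of_maximal h1 (fun x y z hxyz => h'.indep x y z ?_)
    (fun p hp => h'.maximal hp) h
  apply e.injective
  simpa using hxyz

open Polynomial in
theorem MulTable.minpoly_eq {f : Form ℤ} {w t : K} (h : MulTable f w t) (hi : Indep w t)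
    (hK : Module.finrank ℚ K = 3) : minpoly ℚ w = X ^ 3 + C (-f 1 : ℚ) * X ^ 2
    + C (f 0 * f 2 : ℚ) * X + C (-(f 0 ^ 2 * f 3) : ℚ) := by
  have hw : IsIntegral ℚ w := h.isIntegral.tower_top
  have hm : (X ^ 3 + C (-f 1 : ℚ) * X ^ 2
    + C (f 0 * f 2 : ℚ) * X + C (-(f 0 ^ 2 * f 3) : ℚ)).Monic := by monicity!
  have h1 : (minpoly ℚ w).natDegree ≠ 1 := by
    intro h1
    have h2 := minpoly.natDegree_eq_one_iff.1 h1
    obtain ⟨q, hq⟩ := h2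
    have hq' : (q.den : K) ≠ 0 := by exact_mod_cast q.den_nz
    have : w = (q.num : K) / q.den := by
      rw [← hq]
      conv_lhs => rw [← Rat.num_div_den q]
      simp
    rw [eq_div_iff hq'] at this
    have := (hi (-q.num) q.den 0 (by push_cast; linear_combination this)).2.1
    exact q.den_nz (by exact_mod_cast this)
  have h3 : (minpoly ℚ w).natDegree = 3 := by
    have := minpoly.degree_dvd hw
    rw [hK] at this
    exact ((Nat.dvd_prime Nat.prime_three).1 this).resolve_left h1
  have h4 : aeval w (X ^ 3 + C (-f 1 : ℚ) * X ^ 2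
    + C (f 0 * f 2 : ℚ) * X + C (-(f 0 ^ 2 * f 3) : ℚ)) = 0 := by
    simp only [map_add, map_mul, map_pow, aeval_X, aeval_C]
    simpa using h.cubic
  have h5 : (X ^ 3 + C (-f 1 : ℚ) * X ^ 2
    + C (f 0 * f 2 : ℚ) * X + C (-(f 0 ^ 2 * f 3) : ℚ)).natDegree ≤ 3 := by compute_degree
  exact (eq_of_monic_of_dvd_of_natDegree_le (minpoly.monic hw) hm (minpoly.dvd _ _ h4)
    (h5.trans h3.ge)).symm

theorem MulTable.exists_powerBasis {f : Form ℤ} {w t : K} (h : MulTable f w t) (hi : Indep w t)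
    (hK : Module.finrank ℚ K = 3) : ∃ b : PowerBasis ℚ K, b.gen = w := by
  have hw : IsIntegral ℚ w := h.isIntegral.tower_top
  have h1 : IntermediateField.adjoin ℚ {w} = ⊤ := by
    rw [Field.primitive_element_iff_minpoly_natDegree_eq, h.minpoly_eq hi hK, hK]
    compute_degree!
  refine ⟨PowerBasis.ofAdjoinEqTop hw ?_, ?_⟩
  · rw [← IntermediateField.adjoin_simple_toSubalgebra_of_isAlgebraic hw.isAlgebraic, h1]
    rfl
  · exact PowerBasis.ofAdjoinEqTop_gen _ _

theorem MulTable.ringEquiv {L : Type*} [Field L] [NumberField L] {f : Form ℤ} {w t : K}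
    {w' t' : L} (h : MulTable f w t) (hi : Indep w t) (hK : Module.finrank ℚ K = 3)
    (h' : MulTable f w' t') (hi' : Indep w' t') (hL : Module.finrank ℚ L = 3) :
    Nonempty (K ≃+* L) := by
  obtain ⟨b, hb⟩ := h.exists_powerBasis hi hK
  obtain ⟨b', hb'⟩ := h'.exists_powerBasis hi' hL
  refine ⟨(b.equivOfMinpoly b' ?_).toRingEquiv⟩
  rw [hb, hb', h.minpoly_eq hi hK, h'.minpoly_eq hi' hL]

end NumberField

open Polynomial in
/-- Every irreducible form comes from a cubic subfield of `ℂ`. -/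
theorem Irr.exists_field {f : Form ℤ} (hf : Irr f) : ∃ K : IntermediateField ℚ ℂ,
    Module.finrank ℚ K = 3 ∧ ∃ w t : K, MulTable f w t ∧ Indep w t := by
  set P : ℚ[X] := C (f 0 : ℚ) * X ^ 3 + C (f 1 : ℚ) * X ^ 2 + C (f 2 : ℚ) * X + C (f 3 : ℚ) with hP
  have h0 : (f 0 : ℚ) ≠ 0 := by exact_mod_cast hf.zero_ne
  have hd : P.natDegree = 3 := by rw [hP]; exact natDegree_cubic h0
  have hirr : Irreducible P := by
    rw [irreducible_iff_roots_eq_zero_of_degree_le_three (by omega) (by omega)]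
    refine Multiset.eq_zero_of_forall_notMem fun q hq => ?_
    have hq := isRoot_of_mem_roots hq
    simp [hP] at hq
    have hden : (q.den : ℚ) ≠ 0 := by exact_mod_cast q.den_nz
    have h1 : ev f q.num q.den = 0 := by
      have : ((ev f q.num q.den : ℤ) : ℚ) = q.den ^ 3 * (f 0 * q ^ 3 + f 1 * q ^ 2 + f 2 * q + f 3) := by
        have e : (q.num : ℚ) = q * q.den := by rw [Rat.mul_den_eq_num]
        simp only [ev]
        push_cast
        rw [e]
        ring
      rw [hq, mul_zero] at this
      exact_mod_cast this
    have := (hf _ _ h1).2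
    exact q.den_nz (by exact_mod_cast this)
  obtain ⟨ρ, hρ⟩ := IsAlgClosed.exists_aeval_eq_zero ℂ P (by
    rw [degree_eq_natDegree hirr.ne_zero, hd]; norm_num)
  have hint : IsIntegral ℚ ρ := IsAlgebraic.isIntegral ⟨P, hirr.ne_zero, hρ⟩
  have hmin : (minpoly ℚ ρ).natDegree = 3 := by
    rw [← minpoly.eq_of_irreducible hirr hρ, natDegree_mul_C (by simpa using hirr.ne_zero), hd]
  set r : IntermediateField.adjoin ℚ {ρ} := IntermediateField.AdjoinSimple.gen ℚ ρ with hr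
  have hρ' : f 0 * ρ ^ 3 + f 1 * ρ ^ 2 + f 2 * ρ + f 3 = 0 := by
    simpa [hP] using hρ
  have hr' : f 0 * r ^ 3 + f 1 * r ^ 2 + f 2 * r + f 3 = 0 := by
    apply Subtype.ext
    simpa [hr] using hρ'
  refine ⟨IntermediateField.adjoin ℚ {ρ}, ?_, -f 0 * r, -(f 0 * r ^ 2 + f 1 * r + f 2), ?_, ?_⟩
  · rw [IntermediateField.adjoin.finrank hint, hmin]
  · refine ⟨?_, ?_, ?_⟩
    · linear_combination f 0 * hr'
    · ring
    · linear_combination (f 0 * r + f 1) * hr'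
  · intro x y z h
    have h' := congrArg (algebraMap _ ℂ) h
    obtain ⟨Q, hQ⟩ : ∃ Q : ℚ[X], Q = C (-z * f 0 : ℚ) * X ^ 2 + C (-y * f 0 - z * f 1 : ℚ) * X
      + C (x - z * f 2 : ℚ) := ⟨_, rfl⟩
    have hQ0 : Q = 0 := by
      by_contra hne
      have h1 := natDegree_le_natDegree (minpoly.degree_le_of_ne_zero ℚ ρ (p := Q) hne (by
        simp [hr] at h'
        simp [hQ]
        linear_combination h'))
      rw [hmin] at h1
      have h2 : Q.natDegree ≤ 2 := by rw [hQ]; exact natDegree_quadratic_le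
      omega
    have hco : ∀ a b c : ℚ, C a * X ^ 2 + C b * X + C c = 0 → a = 0 ∧ b = 0 ∧ c = 0 := by
      intro a b c e
      have c2 := congrArg (coeff · 2) e
      have c1 := congrArg (coeff · 1) e
      have c0 := congrArg (coeff · 0) e
      simp [coeff_X, coeff_C] at c0 c1 c2
      exact ⟨c2, c1, c0⟩
    obtain ⟨c2, c1, c0⟩ := hco _ _ _ (hQ.symm.trans hQ0)
    have hz : z = 0 := by simpa [hf.zero_ne] using c2
    subst hz
    have hy : y = 0 := by simpa [hf.zero_ne] using c1
    exact ⟨by simpa using c0, hy, rfl⟩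

theorem fieldDisc_eq (K : IntermediateField ℚ ℂ) [h : NumberField K] :
    fieldDisc K = NumberField.discr K := by
  have : FiniteDimensional ℚ K := h.to_finiteDimensional
  simp [fieldDisc, this]

/-- Classes of irreducible forms, maximal at every prime, with discriminant in `(ξ, η)`. -/
def maxCls (ξ η : ℝ) : Set Cls :=
  {c | ∃ f, cls f = c ∧ Irr f ∧ (∀ p : ℕ, p.Prime → ¬ NonMax p f) ∧
    ξ < ((disc f : ℤ) : ℝ) ∧ ((disc f : ℤ) : ℝ) < η}

/-- The Delone–Faddeev correspondence, for maximal orders of cubic fields. -/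
theorem cubicFieldCount_eq (ξ η : ℝ) : cubicFieldCount ξ η = (maxCls ξ η).ncard := by
  have nf : ∀ K : IntermediateField ℚ ℂ, Module.finrank ℚ K = 3 → NumberField K := fun K hK =>
    { to_charZero := inferInstance
      to_finiteDimensional := Module.finite_of_finrank_pos (by omega) }
  have ex : ∀ K : { K : IntermediateField ℚ ℂ //
      Module.finrank ℚ K = 3 ∧ ξ < (fieldDisc K : ℝ) ∧ (fieldDisc K : ℝ) < η },
      ∃ (_ : NumberField K.1) (f : Form ℤ) (w t : K.1), IntBasis f w t := by
    intro K
    have := nf K.1 K.2.1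
    exact ⟨this, exists_intBasis K.2.1⟩
  choose inst f w t hI using ex
  unfold cubicFieldCount
  rw [← Nat.card_coe_set_eq]
  refine Nat.card_eq_of_bijective (Quot.lift (fun K => (⟨cls (f K), f K, rfl,
    (hI K).table.irr (hI K).indep, fun p hp => (hI K).maximal hp, ?_⟩ : maxCls ξ η)) ?_) ⟨?_, ?_⟩
  · rw [← (hI K).discr_eq, ← fieldDisc_eq]
    exact K.2.2
  · rintro K L ⟨e⟩
    exact Subtype.ext (cls_eq.2 ((hI L).eqv_of_ringEquiv e (hI K)))
  · rintro ⟨K⟩ ⟨L⟩ h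
    have h : Eqv (f K) (f L) := cls_eq.1 (congrArg Subtype.val h)
    obtain ⟨w', t', h1, h2, -⟩ := (hI K).table.of_eqv (hI K).indep h
    exact Quot.sound (h1.ringEquiv h2 K.2.1 (hI L).table (hI L).indep L.2.1)
  · rintro ⟨c, g, rfl, hg, hm, hd⟩
    obtain ⟨K, hK, w', t', h1, h2⟩ := hg.exists_field
    have := nf K hK
    obtain ⟨g', w₁, t₁, hg'⟩ := exists_intBasis hK
    have e := IntBasis.eqv_of_maximal h1 h2 hm hg'
    have hd' : ξ < (fieldDisc K : ℝ) ∧ (fieldDisc K : ℝ) < η := by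
      rw [fieldDisc_eq, hg'.discr_eq, e.disc_eq]
      exact hd
    refine ⟨Quot.mk _ ⟨K, hK, hd'⟩, Subtype.ext (cls_eq.2 ?_)⟩
    exact (IntBasis.eqv_of_maximal h1 h2 hm (hI ⟨K, hK, hd'⟩)).symm

/-- The real form with coefficients `(A, (2+σ)B, (-1-2σ)A, -σB)`, evaluated at `(x - u y, v y)`.
The sign `σ` is the sign of the discriminant. -/
def psi (σ : ℝ) (u v A B : ℝ) : Form ℝ :=
  ![A, (2 + σ) * B * v - 3 * u * A,
    3 * u ^ 2 * A - 2 * u * v * ((2 + σ) * B) + v ^ 2 * ((-1 - 2 * σ) * A),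
    -u ^ 3 * A + u ^ 2 * v * ((2 + σ) * B) - u * v ^ 2 * ((-1 - 2 * σ) * A) + v ^ 3 * (-σ * B)]

theorem psi_zero (σ u v A B : ℝ) : psi σ u v A B 0 = A := rfl

theorem disc_psi {σ : ℝ} (hσ : σ = 1 ∨ σ = -1) (u v A B : ℝ) :
    σ * disc (psi σ u v A B) = (56 + 52 * σ) * (A ^ 2 + B ^ 2) ^ 2 * v ^ 6 := by
  rcases hσ with rfl | rfl <;> simp [psi, disc] <;> ring

theorem psi_injective {σ : ℝ} (hσ : σ = 1 ∨ σ = -1) {u v A B u' v' A' B' : ℝ} (hA : A ≠ 0)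
    (hv : 0 < v) (hv' : 0 < v') (h : psi σ u v A B = psi σ u' v' A' B') :
    u = u' ∧ v = v' ∧ A = A' ∧ B = B' := by
  have e0 := congrFun h 0
  have e1 := congrFun h 1
  have e2 := congrFun h 2
  have e3 := congrFun h 3
  simp [psi] at e0 e1 e2 e3
  subst e0
  have key : u = u' ∧ v = v' := by
    rcases hσ with rfl | rfl
    · have hP : A ^ 2 + B ^ 2 > 0 := by positivity
      have hP' : A ^ 2 + B' ^ 2 > 0 := by positivity
      obtain ⟨b, hb⟩ : ∃ b, b = (2 + 1) * B * v - 3 * u * A := ⟨_, rfl⟩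
      obtain ⟨c, hc⟩ : ∃ c, c = 3 * u ^ 2 * A - 2 * u * v * ((2 + 1) * B)
        + v ^ 2 * ((-1 - 2 * 1) * A) := ⟨_, rfl⟩
      obtain ⟨d, hd⟩ : ∃ d, d = -(u ^ 3 * A) + u ^ 2 * v * ((2 + 1) * B)
        - u * v ^ 2 * ((-1 - 2 * 1) * A) + -(v ^ 3 * (1 * B)) := ⟨_, rfl⟩
      rw [← hb] at e1
      rw [← hc] at e2
      rw [← hd] at e3
      have p1 : b ^ 2 - 3 * A * c = 9 * (A ^ 2 + B ^ 2) * v ^ 2 := by rw [hb, hc]; ring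
      have p2 : b ^ 2 - 3 * A * c = 9 * (A ^ 2 + B' ^ 2) * v' ^ 2 := by rw [e1, e2]; ring
      have q1 : b * c - 9 * A * d = -2 * u * (9 * (A ^ 2 + B ^ 2) * v ^ 2) := by
        rw [hb, hc, hd]; ring
      have q2 : b * c - 9 * A * d = -2 * u' * (9 * (A ^ 2 + B' ^ 2) * v' ^ 2) := by
        rw [e1, e2, e3]; ring
      have r1 : c ^ 2 - 3 * b * d = (u ^ 2 + v ^ 2) * (9 * (A ^ 2 + B ^ 2) * v ^ 2) := by
        rw [hb, hc, hd]; ring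
      have r2 : c ^ 2 - 3 * b * d = (u' ^ 2 + v' ^ 2) * (9 * (A ^ 2 + B' ^ 2) * v' ^ 2) := by
        rw [e1, e2, e3]; ring
      rw [← p2] at q2 r2
      rw [← p1] at q1 r1
      have hp : b ^ 2 - 3 * A * c ≠ 0 := by rw [p1]; positivity
      have hu : u = u' := by
        apply mul_right_cancel₀ hp; linear_combination (q1 - q2) / 2
      refine ⟨hu, ?_⟩
      subst hu
      have : v ^ 2 = v' ^ 2 := by
        apply mul_right_cancel₀ hp; linear_combination (r2 - r1)
      exact (pow_left_inj₀ hv.le hv'.le two_ne_zero).1 this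
    · -- compare the values of both forms at the complex root of the first one
      norm_num at e1 e2 e3
      obtain ⟨x, hx⟩ : ∃ x, x = u - u' := ⟨_, rfl⟩
      obtain rfl : u' = u - x := by linarith
      obtain ⟨t, ht⟩ : ∃ t, t = A * x + B' * v' := ⟨_, rfl⟩
      have hB : B' * v' = t - A * x := by linarith
      have hB1 : B * v = t + 2 * A * x := by linear_combination e1 + hB
      have E2 : A * (v ^ 2 - v' ^ 2 - x ^ 2) = 2 * x * t := by
        linear_combination e2 + 2 * u * hB1 - 2 * (u - x) * hB
      have E3 : t * (v ^ 2 - v' ^ 2 - x ^ 2) = -2 * A * x * v ^ 2 := by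
        linear_combination e3 + u * e2 + (u ^ 2 - v ^ 2) * hB1 + (v' ^ 2 - u ^ 2 + x ^ 2) * hB
      have E4 : (A ^ 2 * v ^ 2 + t ^ 2) * (v ^ 2 - v' ^ 2 - x ^ 2) = 0 := by
        linear_combination A * v ^ 2 * E2 + t * E3
      have E5 : v ^ 2 - v' ^ 2 - x ^ 2 = 0 := by
        have : A ^ 2 * v ^ 2 + t ^ 2 ≠ 0 := by positivity
        simpa [this] using E4
      rw [E5, mul_zero] at E3
      have hx0 : x = 0 := by
        have : A * v ^ 2 ≠ 0 := by positivity
        apply mul_left_cancel₀ this; linear_combination E3 / 2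
      subst hx0
      refine ⟨by ring, (pow_left_inj₀ hv.le hv'.le two_ne_zero).1 (by linear_combination E5)⟩
  obtain ⟨rfl, rfl⟩ := key
  refine ⟨rfl, rfl, rfl, ?_⟩
  have : (2 + σ) * v ≠ 0 := by rcases hσ with rfl | rfl <;> norm_num <;> positivity
  apply mul_left_cancel₀ this
  linear_combination e1

theorem exists_cubic_root (b c d : ℝ) : ∃ x : ℝ, x ^ 3 + b * x ^ 2 + c * x + d = 0 := by
  obtain ⟨S, hS⟩ : ∃ S, S = 1 + |b| + |c| + |d| := ⟨_, rfl⟩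
  have hb := abs_nonneg b
  have hc := abs_nonneg c
  have hd := abs_nonneg d
  have h1 : 1 ≤ S := by linarith
  have key : |b| * S ^ 2 + |c| * S + |d| ≤ S ^ 3 := by
    have e : S ^ 3 = S ^ 2 + |b| * S ^ 2 + |c| * S ^ 2 + |d| * S ^ 2 := by
      have : S ^ 3 = S * S ^ 2 := by ring
      rw [this]; nth_rewrite 1 [hS]; ring
    have h2 : S ≤ S ^ 2 := by nlinarith
    have h3 : 1 ≤ S ^ 2 := by nlinarith
    nlinarith [mul_le_mul_of_nonneg_left h2 hc, mul_le_mul_of_nonneg_left h3 hd]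
  have p2 := abs_le.1 (abs_mul b (S ^ 2)).le
  have p1 := abs_le.1 (abs_mul c S).le
  have p0 := abs_le.1 (le_refl |d|)
  rw [abs_of_nonneg (by positivity : 0 ≤ S ^ 2)] at p2
  rw [abs_of_nonneg (by positivity : 0 ≤ S)] at p1
  obtain ⟨x, -, hx⟩ := intermediate_value_Icc (by linarith : -S ≤ S)
    (f := fun x => x ^ 3 + b * x ^ 2 + c * x + d) (by fun_prop)
    (⟨by ring_nf at *; linarith, by ring_nf at *; linarith⟩ : (0 : ℝ) ∈ Set.Icc _ _)
  exact ⟨x, hx⟩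

theorem exists_psi {σ : ℝ} (hσ : σ = 1 ∨ σ = -1) {f : Form ℝ} (h0 : f 0 ≠ 0)
    (hd : 0 < σ * disc f) : ∃ u v A B : ℝ, 0 < v ∧ f = psi σ u v A B := by
  rcases hσ with rfl | rfl
  · obtain ⟨a, b, c, d, rfl⟩ : ∃ a b c d, f = ![a, b, c, d] :=
      ⟨f 0, f 1, f 2, f 3, by ext i; fin_cases i <;> rfl⟩
    simp [disc] at h0 hd
    set D := b ^ 2 * c ^ 2 - 4 * a * c ^ 3 - 4 * b ^ 3 * d - 27 * a ^ 2 * d ^ 2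
      + 18 * a * b * c * d with hD
    set P := b ^ 2 - 3 * a * c with hP
    have hP0 : 0 < P := by
      have : 4 * P ^ 3 = (2 * b ^ 3 - 9 * a * b * c + 27 * a ^ 2 * d) ^ 2 + 27 * a ^ 2 * D := by
        rw [hP, hD]; ring
      have h3 : 0 < P ^ 3 := by nlinarith [sq_nonneg (2 * b ^ 3 - 9 * a * b * c + 27 * a ^ 2 * d), mul_pos (by positivity : 0 < a ^ 2) hd]
      by_contra! hc
      nlinarith [pow_nonneg (neg_nonneg.2 hc) 3]
    set Q := b * c - 9 * a * d with hQ
    set R := c ^ 2 - 3 * b * d with hR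
    have hsq := Real.sq_sqrt (by positivity : 0 ≤ 3 * D)
    have hspos : 0 < √(3 * D) := Real.sqrt_pos.2 (by positivity)
    obtain ⟨u, hu⟩ : ∃ u, u = -Q / (2 * P) := ⟨_, rfl⟩
    obtain ⟨v, hv⟩ : ∃ v, v = √(3 * D) / (2 * P) := ⟨_, rfl⟩
    have hv0 : 0 < v := by rw [hv]; positivity
    have hu1 : 2 * u * P = -Q := by rw [hu]; field_simp
    have hv1 : (u ^ 2 + v ^ 2) * P = R := by
      have h1 : 4 * (v ^ 2 * P) * P = 3 * D := by
        rw [← hsq, hv]; field_simp; ring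
      have h2 : 4 * (u ^ 2 * P) * P = Q ^ 2 := by linear_combination (2 * u * P - Q) * hu1
      apply mul_left_cancel₀ (by positivity : 4 * P ≠ 0)
      linear_combination h1 + h2 + (by rw [hQ, hD, hP, hR]; ring : Q ^ 2 + 3 * D = 4 * P * R)
    refine ⟨u, v, a, (b + 3 * u * a) / (3 * v), hv0, ?_⟩
    have hB : (2 + 1) * ((b + 3 * u * a) / (3 * v)) * v = b + 3 * u * a := by field_simp; ring
    have hB' : (b + 3 * u * a) / (3 * v) * v = (b + 3 * u * a) / 3 := by field_simp
    apply form_ext <;> simp [psi]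
    · linear_combination -hB
    · apply mul_right_cancel₀ hP0.ne'
      linear_combination 2 * u * P * hB + b * hu1 + 3 * a * hv1
    · apply mul_right_cancel₀ hP0.ne'
      linear_combination (- u ^ 2 + v ^ 2 / 3) * P * hB + (-2 * a * u + b / 3) * hv1
        - 2 / 3 * b * u * hu1 + c / 3 * hu1
  · obtain ⟨a, b, c, d, rfl⟩ : ∃ a b c d, f = ![a, b, c, d] :=
      ⟨f 0, f 1, f 2, f 3, by ext i; fin_cases i <;> rfl⟩
    simp [disc] at h0 hd
    obtain ⟨ρ, hρ⟩ := exists_cubic_root (b / a) (c / a) (d / a)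
    replace hρ : a * ρ ^ 3 + b * ρ ^ 2 + c * ρ + d = 0 := by
      field_simp at hρ; linear_combination hρ
    obtain ⟨β, hβ⟩ : ∃ β, b = a * (β - ρ) := ⟨b / a + ρ, by field_simp; ring⟩
    obtain ⟨γ, hγ⟩ : ∃ γ, c = a * (γ - ρ * β) := ⟨c / a + ρ * β, by field_simp; ring⟩
    have hd' : d = -a * ρ * γ := by rw [hβ, hγ] at hρ; linear_combination hρ
    subst hβ hγ hd'
    have hpos : 0 < γ - β ^ 2 / 4 := by
      by_contra! hc
      nlinarith [mul_nonneg (sq_nonneg (a ^ 2 * (ρ ^ 2 + β * ρ + γ))) (neg_nonneg.2 hc)]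
    have hsq := Real.sq_sqrt hpos.le
    have hspos := Real.sqrt_pos.2 hpos
    generalize √(γ - β ^ 2 / 4) = v at hsq hspos
    obtain rfl : γ = v ^ 2 + β ^ 2 / 4 := by linarith
    refine ⟨-β / 2, v, a, a * (-β / 2 - ρ) / v, hspos, ?_⟩
    have hB' : a * (-β / 2 - ρ) / v * v = a * (-β / 2 - ρ) := by field_simp
    apply form_ext <;> simp [psi]
    · linear_combination - hB'
    · linear_combination - β * hB'
    · linear_combination - (v ^ 2 + β ^ 2 / 4) * hB'

/-- An integral form viewed over `ℝ`. -/
def toR (f : Form ℤ) : Form ℝ := fun i => (f i : ℝ)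

theorem toR_injective : Function.Injective toR := fun f g h => by
  funext i
  have h := congrFun h i
  simp only [toR] at h
  exact_mod_cast h

theorem toR_act (f : Form ℤ) (M : Mat ℤ) :
    toR (act f M) = act (toR f) !![(M 0 0 : ℝ), M 0 1; M 1 0, M 1 1] := by
  apply form_ext <;> simp [toR, act]

theorem disc_toR (f : Form ℤ) : disc (toR f) = ((disc f : ℤ) : ℝ) := by
  simp [toR, disc]

theorem toR_neg (f : Form ℤ) : toR (-f) = -toR f := by
  funext i; simp [toR]

theorem psi_neg (σ u v A B : ℝ) : psi σ u v (-A) (-B) = -psi σ u v A B := by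
  apply form_ext <;> simp [psi] <;> ring

theorem psi_act_diag (σ u v A B : ℝ) :
    act (psi σ u v A B) !![1, 0; 0, -1] = psi σ (-u) v A (-B) := by
  apply form_ext <;> simp [psi, act] <;> ring

theorem psi_eq_act (σ u v A B : ℝ) : psi σ u v A B = act (psi σ 0 1 A B) !![1, -u; 0, v] := by
  apply form_ext <;> simp [psi, act] <;> ring

theorem act_rotation {σ : ℝ} (hσ : σ = 1 ∨ σ = -1) (A B s t : ℝ) :
    ∃ A' B', act (psi σ 0 1 A B) !![s, t; -t, s] = psi σ 0 1 A' B' := by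
  rcases hσ with rfl | rfl
  · refine ⟨A * (s ^ 3 - 3 * s * t ^ 2) - B * (3 * s ^ 2 * t - t ^ 3),
      A * (3 * s ^ 2 * t - t ^ 3) + B * (s ^ 3 - 3 * s * t ^ 2), ?_⟩
    apply form_ext <;> simp [psi, act] <;> ring
  · refine ⟨(s ^ 2 + t ^ 2) * (A * s - B * t), (s ^ 2 + t ^ 2) * (A * t + B * s), ?_⟩
    apply form_ext <;> simp [psi, act] <;> ring

theorem psi_act {σ : ℝ} (hσ : σ = 1 ∨ σ = -1) {u v u' v' p q r s : ℝ} (A B : ℝ)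
    (h1 : (p - r * u) * u' + r * v * v' = s * u - q) (h2 : (p - r * u) * v' - r * v * u' = s * v) :
    ∃ A' B', act (psi σ u v A B) !![p, q; r, s] = psi σ u' v' A' B' := by
  obtain ⟨A', B', h⟩ := act_rotation hσ A B (p - u * r) (-v * r)
  refine ⟨A', B', ?_⟩
  rw [psi_eq_act σ u', ← h, psi_eq_act σ u, act_act, act_act]
  congr 1
  ext i j
  fin_cases i <;> fin_cases j <;> simp [Matrix.mul_apply]
  · ring
  · linear_combination h1
  · linear_combination -h2

open UpperHalfPlane MatrixGroups

/-- `z` is the point of the upper half plane attached to the form `f`. -/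
def HasPoint (σ : ℝ) (f : Form ℝ) (z : ℍ) : Prop := ∃ A B, f = psi σ z.re z.im A B

theorem HasPoint.act {σ : ℝ} (hσ : σ = 1 ∨ σ = -1) {f : Form ℤ} {z : ℍ}
    (h : HasPoint σ (toR f) z) (γ : SL(2, ℤ)) :
    HasPoint σ (toR (act f !![γ 1 1, -γ 0 1; -γ 1 0, γ 0 0])) (γ • z) := by
  obtain ⟨A, B, h⟩ := h
  have hz := UpperHalfPlane.coe_specialLinearGroup_apply γ z
  have hdet : (γ 0 0 : ℝ) * γ 1 1 - γ 0 1 * γ 1 0 = 1 := by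
    have := γ.det_coe
    rw [Matrix.det_fin_two] at this
    exact_mod_cast this
  have hz0 : ((γ 1 0 : ℝ) : ℂ) * z + ((γ 1 1 : ℝ) : ℂ) ≠ 0 := by
    intro h0
    have h1 := congrArg Complex.im h0
    have h2 := congrArg Complex.re h0
    simp [z.im_ne_zero] at h1 h2
    rw [h1] at h2 hdet
    simp at h2
    rw [h2] at hdet
    norm_num at hdet
  simp only [algebraMap_int_eq, Int.coe_castRingHom] at hz
  rw [eq_div_iff (by simpa using hz0)] at hz
  have hre := congrArg Complex.re hz
  have him := congrArg Complex.im hz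
  simp at hre him
  rw [toR_act, h]
  refine psi_act hσ A B ?_ ?_ <;> simp
  · linear_combination hre
  · linear_combination him

/-- Reduced forms: a closed fundamental domain. -/
def Red (σ : ℝ) (f : Form ℤ) : Prop := ∃ u v A B : ℝ, toR f = psi σ u v A B ∧ 0 < A ∧ 0 ≤ u ∧
  u ≤ 1 / 2 ∧ 1 ≤ u ^ 2 + v ^ 2 ∧ 0 < v

/-- The open fundamental domain. -/
def RedOpen (σ : ℝ) (f : Form ℤ) : Prop := ∃ u v A B : ℝ, toR f = psi σ u v A B ∧ 0 < A ∧ 0 < u ∧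
  u < 1 / 2 ∧ 1 < u ^ 2 + v ^ 2 ∧ 0 < v

theorem Red.exists_eqv {σ : ℝ} (hσ : σ = 1 ∨ σ = -1) {f : Form ℤ} (hf : Irr f)
    (hd : 0 < σ * ((disc f : ℤ) : ℝ)) : ∃ g, Eqv f g ∧ Red σ g := by
  obtain ⟨u, v, A, B, hv, h⟩ := exists_psi hσ (f := toR f) (by simpa [toR] using hf.zero_ne)
    (by rwa [disc_toR])
  obtain ⟨γ, hγ⟩ := ModularGroup.exists_smul_mem_fd ⟨⟨u, v⟩, hv⟩
  have h1 : HasPoint σ (toR f) ⟨⟨u, v⟩, hv⟩ := ⟨A, B, h⟩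
  have h2 := h1.act hσ γ
  set g := DH.act f !![γ 1 1, -γ 0 1; -γ 1 0, γ 0 0] with hg
  have hfg : Eqv f g := ⟨_, by
    have := γ.det_coe
    rw [Matrix.det_fin_two] at this ⊢
    simp
    rw [mul_comm, this]; simp, hg⟩
  clear_value g
  obtain ⟨A, B, h2⟩ := h2
  generalize γ • (⟨⟨u, v⟩, hv⟩ : ℍ) = z at *
  have hn : 1 ≤ z.re ^ 2 + z.im ^ 2 := by
    have := hγ.1
    rw [Complex.normSq_apply] at this
    simpa [sq] using this
  obtain ⟨g', u', B', hg', h3, hu1, hu2, hu3⟩ : ∃ (g' : Form ℤ) (u' B' : ℝ), Eqv f g' ∧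
      toR g' = psi σ u' z.im A B' ∧ 0 ≤ u' ∧ u' ≤ 1 / 2 ∧ u' ^ 2 = z.re ^ 2 := by
    rcases le_total 0 z.re with h0 | h0
    · exact ⟨g, z.re, B, hfg, h2, h0, (abs_le.1 hγ.2).2, rfl⟩
    · refine ⟨DH.act g !![1, 0; 0, -1], -z.re, -B, hfg.trans ⟨_, by simp, rfl⟩, ?_, by linarith,
        by linarith [(abs_le.1 hγ.2).1], by ring⟩
      rw [toR_act, h2, ← psi_act_diag]
      simp
  have hA : A ≠ 0 := by
    have h5 := congrFun h3 0
    rw [psi_zero] at h5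
    rw [← h5]
    simpa [toR] using (hf.eqv hg').zero_ne
  rcases hA.lt_or_gt with h0 | h0
  · refine ⟨-g', hg'.trans (eqv_neg _), u', z.im, -A, -B', ?_, by linarith, hu1, hu2, by linarith,
      z.im_pos⟩
    rw [toR_neg, psi_neg, h3]
  · exact ⟨g', hg', u', z.im, A, B', h3, h0, hu1, hu2, by linarith, z.im_pos⟩

theorem RedOpen.unique {σ : ℝ} (hσ : σ = 1 ∨ σ = -1) {f g : Form ℤ} (hf : RedOpen σ f)
    (hg : RedOpen σ g) (h : Eqv f g) : f = g := by
  obtain ⟨u, v, A, B, h1, hA, hu, hu', hn, hv⟩ := hf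
  obtain ⟨u', v', A', B', h1', hA', hv1, hv', hn', hv2⟩ := hg
  obtain ⟨M, hM, rfl⟩ := h
  have mem : ∀ (u v : ℝ) (hv : 0 < v), |u| < 1 / 2 → 1 < u ^ 2 + v ^ 2 →
      (⟨⟨u, v⟩, hv⟩ : ℍ) ∈ ModularGroup.fdo := by
    intro u v hv hu hn
    refine ⟨?_, hu⟩
    rw [Complex.normSq_apply]
    simpa [sq] using hn
  have key : ∀ (N : Mat ℤ) (u'' B'' : ℝ), N.det = 1 → |u''| < 1 / 2 → 1 < u'' ^ 2 + v' ^ 2 →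
      toR (act f N) = psi σ u'' v' A' B'' → u = u'' ∧ (N = 1 ∨ N = -1) := by
    intro N u'' B'' hN hu2 hn2 h2
    let γ : SL(2, ℤ) := ⟨!![N 1 1, -N 0 1; -N 1 0, N 0 0], by
      rw [Matrix.det_fin_two] at hN ⊢; simp; linarith⟩
    have h3 : HasPoint σ (toR f) ⟨⟨u, v⟩, hv⟩ := ⟨A, B, h1⟩
    have h4 := h3.act hσ γ
    have h5 : (!![γ 1 1, -γ 0 1; -γ 1 0, γ 0 0] : Mat ℤ) = N := by
      ext i j; fin_cases i <;> fin_cases j <;> simp [γ]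
    rw [h5] at h4
    obtain ⟨A₁, B₁, h4⟩ := h4
    rw [h2] at h4
    obtain ⟨e1, e2, -, -⟩ := psi_injective hσ hA'.ne' hv2 (UpperHalfPlane.im_pos _) h4
    have hz : γ • (⟨⟨u, v⟩, hv⟩ : ℍ) = ⟨⟨u'', v'⟩, hv2⟩ := by
      apply UpperHalfPlane.ext
      apply Complex.ext
      · simpa using e1.symm
      · simpa using e2.symm
    have m1 := mem u v hv (by rw [abs_lt]; constructor <;> linarith) hn
    have m2 := mem u'' v' hv2 hu2 hn2
    rw [← hz] at m2
    have h6 := ModularGroup.eq_one_or_neg_one_of_mem_fdo_mem_fdo m1 m2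
    have h7 : γ • (⟨⟨u, v⟩, hv⟩ : ℍ) = ⟨⟨u, v⟩, hv⟩ := by
      rcases h6 with h | h <;> simp [h]
    refine ⟨?_, ?_⟩
    · rw [h7] at hz
      simpa using congrArg UpperHalfPlane.re hz
    · rw [← h5]
      rcases h6 with h | h
      · left; rw [h]; ext i j; fin_cases i <;> fin_cases j <;> simp
      · right; rw [h]; ext i j; fin_cases i <;> fin_cases j <;> simp
  rcases Int.isUnit_iff.1 hM with hd | hd
  · rcases (key M u' B' hd (by rw [abs_lt]; constructor <;> linarith) hn' h1').2 with rfl | rfl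
    · rw [act_one]
    · exfalso
      rw [act_neg_one, toR_neg, h1] at h1'
      have := congrFun h1' 0
      rw [Pi.neg_apply, psi_zero, psi_zero] at this
      linarith
  · have := (key (M * !![1, 0; 0, -1]) (-u') (-B') (by simp [hd])
      (by rw [abs_lt]; constructor <;> linarith) (by linarith) (by
        rw [← act_act, toR_act, h1', ← psi_act_diag]; simp)).1
    linarith

end DH

namespace DH

open MeasureTheory Topology

/-- The integral vectors of the scaled shifted lattice lying in `B`. -/
def boxPts (B : Set (Form ℝ)) (m : ℝ) (r : Form ℝ) (N : ℝ) : Set (Form ℤ) :=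
  {g | (fun i => (m * g i + r i) / N) ∈ B}

theorem finite_boxPts {B : Set (Form ℝ)} (hB : Bornology.IsBounded B) {m : ℝ} (hm : 0 < m)
    (r : Form ℝ) {N : ℝ} (hN : 0 < N) : (boxPts B m r N).Finite := by
  obtain ⟨R, hR⟩ := hB.exists_norm_le
  refine (Set.Finite.pi' (t := fun i => Set.Icc ⌊((-R) * N - r i) / m⌋ ⌈(R * N - r i) / m⌉)
    (fun i => Set.finite_Icc _ _)).subset ?_
  intro g hg i
  have h1 := (norm_le_pi_norm _ i).trans (hR _ hg)
  rw [Real.norm_eq_abs, abs_le, le_div_iff₀ hN, div_le_iff₀ hN] at h1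
  constructor
  · rw [Int.floor_le_iff, div_lt_iff₀ hm]
    nlinarith
  · rw [Int.le_ceil_iff, lt_div_iff₀ hm]
    nlinarith

theorem volume_floor_preimage {B : Set (Form ℝ)} (hB : Bornology.IsBounded B) {m : ℝ}
    (hm : 0 < m) (r : Form ℝ) {N : ℝ} (hN : 0 < N) :
    volume {y : Form ℝ | (fun i => (m * ⌊y i * N / m⌋ + r i) / N) ∈ B} =
      ENNReal.ofReal ((m / N) ^ 4 * (boxPts B m r N).ncard) ∧
    MeasurableSet {y : Form ℝ | (fun i => (m * ⌊y i * N / m⌋ + r i) / N) ∈ B} := by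
  have hfin := finite_boxPts hB hm r hN
  have h1 : {y : Form ℝ | (fun i => (m * ⌊y i * N / m⌋ + r i) / N) ∈ B} =
      ⋃ g ∈ hfin.toFinset, Set.univ.pi (fun i => Set.Ico (g i * (m / N)) ((g i + 1) * (m / N))) := by
    ext y
    simp only [Set.mem_iUnion, Set.Finite.mem_toFinset, exists_prop, Set.mem_ofPred_eq]
    have key : ∀ g : Form ℤ, y ∈ Set.univ.pi
        (fun i => Set.Ico (g i * (m / N)) ((g i + 1) * (m / N))) ↔ g = fun i => ⌊y i * N / m⌋ := by
      intro g
      rw [Set.mem_univ_pi, funext_iff]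
      refine forall_congr' fun i => ?_
      rw [eq_comm, Int.floor_eq_iff, Set.mem_Ico, le_div_iff₀ hm, div_lt_iff₀ hm, mul_div_assoc',
        mul_div_assoc', div_le_iff₀ hN, lt_div_iff₀ hN]
    constructor
    · intro h
      exact ⟨_, h, (key _).2 rfl⟩
    · rintro ⟨g, hg, h⟩
      rw [key] at h
      subst h
      exact hg
  have hmeas : ∀ g : Form ℤ, MeasurableSet (Set.univ.pi
      (fun i => Set.Ico (g i * (m / N)) ((g i + 1) * (m / N)))) := fun g =>
    MeasurableSet.univ_pi fun i => measurableSet_Ico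
  refine ⟨?_, ?_⟩
  · rw [h1, measure_biUnion_finset _ fun g _ => hmeas g]
    · have : ∀ g : Form ℤ, volume (Set.univ.pi
          (fun i => Set.Ico (g i * (m / N)) ((g i + 1) * (m / N)))) =
            ENNReal.ofReal ((m / N) ^ 4) := by
        intro g
        rw [Real.volume_pi_Ico]
        rw [ENNReal.ofReal_pow (by positivity)]
        simp [← sub_mul]
      rw [Finset.sum_congr rfl fun g _ => this g, Finset.sum_const, Set.ncard_eq_toFinset_card _ hfin,
        ENNReal.ofReal_mul (by positivity), nsmul_eq_mul, mul_comm, ENNReal.ofReal_natCast]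
    · intro g _ g' _ hne
      rw [Function.onFun, Set.disjoint_left]
      intro y hy hy'
      apply hne
      rw [Set.mem_univ_pi] at hy hy'
      have hc : 0 < m / N := by positivity
      funext i
      have a := hy i
      have b := hy' i
      have h3 : (g i : ℝ) < g' i + 1 := lt_of_mul_lt_mul_right (a.1.trans_lt b.2) hc.le
      have h4 : (g' i : ℝ) < g i + 1 := lt_of_mul_lt_mul_right (b.1.trans_lt a.2) hc.le
      have h3' : g i < g' i + 1 := by exact_mod_cast h3
      have h4' : g' i < g i + 1 := by exact_mod_cast h4
      omega
  · rw [h1]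
    exact Finset.measurableSet_biUnion _ fun g _ => hmeas g

theorem tendsto_boxPts {B : Set (Form ℝ)} (hB : Bornology.IsBounded B) (hBm : MeasurableSet B)
    (hfr : volume (frontier B) = 0) {m : ℝ} (hm : 0 < m) (r : Form ℝ) :
    Tendsto (fun N : ℝ => ((boxPts B m r N).ncard : ℝ) / N ^ 4) atTop
      (𝓝 (volume.real B / m ^ 4)) := by
  obtain ⟨R, hR⟩ := hB.exists_norm_le
  have hφ : ∀ y : Form ℝ, Tendsto (fun N : ℝ => (fun i => (m * ⌊y i * N / m⌋ + r i) / N : Form ℝ))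
      atTop (𝓝 y) := by
    intro y
    rw [tendsto_pi_nhds]
    intro i
    have h1 : Tendsto (fun N : ℝ => y i - (m + |r i|) / N) atTop (𝓝 (y i - 0)) :=
      tendsto_const_nhds.sub (tendsto_const_nhds.div_atTop tendsto_id)
    have h2 : Tendsto (fun N : ℝ => y i + (m + |r i|) / N) atTop (𝓝 (y i + 0)) :=
      tendsto_const_nhds.add (tendsto_const_nhds.div_atTop tendsto_id)
    rw [sub_zero] at h1
    rw [add_zero] at h2
    refine tendsto_of_tendsto_of_tendsto_of_le_of_le' h1 h2 ?_ ?_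
    · filter_upwards [eventually_gt_atTop 0] with N hN
      rw [le_div_iff₀ hN, sub_mul, div_mul_cancel₀ _ hN.ne']
      have := Int.lt_floor_add_one (y i * N / m)
      rw [div_lt_iff₀ hm] at this
      nlinarith [neg_abs_le (r i)]
    · filter_upwards [eventually_gt_atTop 0] with N hN
      rw [div_le_iff₀ hN, add_mul, div_mul_cancel₀ _ hN.ne']
      have := Int.floor_le (y i * N / m)
      rw [le_div_iff₀ hm] at this
      nlinarith [le_abs_self (r i)]
  have hlim := tendsto_measure_of_ae_tendsto_indicator (μ := (volume : Measure (Form ℝ))) atTop hBm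
    (As := fun N : ℝ => {y : Form ℝ | 0 < N ∧ 1 ≤ N ∧ (fun i => (m * ⌊y i * N / m⌋ + r i) / N) ∈ B})
    (fun N => by
      by_cases hN : 1 ≤ N
      · have := (volume_floor_preimage hB hm r (zero_lt_one.trans_le hN)).2
        simpa [hN, zero_lt_one.trans_le hN] using this
      · simp [hN])
    (B := Metric.closedBall 0 (R + m + ‖r‖)) measurableSet_closedBall
    (measure_closedBall_lt_top).ne (by
      refine Eventually.of_forall fun N y ⟨h0, h1, hy⟩ => ?_
      rw [mem_closedBall_zero_iff, pi_norm_le_iff_of_nonneg]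
      · intro i
        have h2 := (norm_le_pi_norm _ i).trans (hR _ hy)
        have h3 := norm_le_pi_norm r i
        rw [Real.norm_eq_abs, abs_le] at h2 h3 ⊢
        rw [le_div_iff₀ h0, div_le_iff₀ h0] at h2
        have a1 := Int.lt_floor_add_one (y i * N / m)
        rw [div_lt_iff₀ hm] at a1
        have a2 := Int.floor_le (y i * N / m)
        rw [le_div_iff₀ hm] at a2
        have hr := norm_nonneg r
        constructor
        · by_contra! h
          nlinarith
        · by_contra! h
          nlinarith
      · have := (norm_nonneg _).trans (hR _ hy)
        positivity)
    (by
      have : ∀ᵐ y ∂(volume : Measure (Form ℝ)), y ∉ frontier B := measure_eq_zero_iff_ae_notMem.1 hfr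
      filter_upwards [this] with y hy
      have hev := hφ y
      by_cases hin : y ∈ interior B
      · have h3 := hev.eventually (isOpen_interior.mem_nhds hin)
        filter_upwards [h3, eventually_ge_atTop 1] with N hN h1
        exact ⟨fun _ => interior_subset hin,
          fun _ => ⟨zero_lt_one.trans_le h1, h1, interior_subset hN⟩⟩
      · have hcl : y ∉ closure B := fun h => hy ⟨h, hin⟩
        have h3 := hev.eventually (isClosed_closure.isOpen_compl.mem_nhds hcl)
        filter_upwards [h3] with N hN
        exact ⟨fun h => absurd (subset_closure h.2.2) hN, fun h => absurd (subset_closure h) hcl⟩)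
  have h2 := (ENNReal.tendsto_toReal hB.measure_lt_top.ne).comp hlim
  have h3 : Tendsto (fun N : ℝ => (m / N) ^ 4 * ((boxPts B m r N).ncard : ℝ)) atTop
      (𝓝 (volume.real B)) := by
    refine h2.congr' ?_
    filter_upwards [eventually_ge_atTop 1] with N hN
    have h0 := zero_lt_one.trans_le hN
    simp only [Function.comp, h0, hN, true_and]
    rw [(volume_floor_preimage hB hm r h0).1, ENNReal.toReal_ofReal (by positivity)]
  have h4 := h3.div_const (m ^ 4)
  refine h4.congr' ?_
  filter_upwards [eventually_ge_atTop 1] with N hN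
  field_simp

end DH

namespace DH

open MeasureTheory Topology

/-- Reduction of an integral form modulo `m`. -/
def redm (m : ℕ) (f : Form ℤ) : Form (ZMod m) := fun i => (f i : ZMod m)

/-- The integral forms in the dilate `N • B`. -/
def dil (B : Set (Form ℝ)) (N : ℝ) : Set (Form ℤ) := {f | (fun i => (f i : ℝ) / N) ∈ B}

theorem finite_dil {B : Set (Form ℝ)} (hB : Bornology.IsBounded B) {N : ℝ} (hN : 0 < N) :
    (dil B N).Finite := by
  simpa [boxPts, dil] using finite_boxPts hB one_pos 0 hN

theorem ncard_dil_residue {B : Set (Form ℝ)} (m : ℕ) [NeZero m] (s : Form (ZMod m)) (N : ℝ) :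
    {f ∈ dil B N | redm m f = s}.ncard = (boxPts B m (fun i => ((s i).val : ℝ)) N).ncard := by
  rw [← Set.ncard_image_of_injective (boxPts B m _ N) (f := fun g : Form ℤ => fun i => (m : ℤ) * g i + (s i).val)]
  · congr 1
    ext f
    constructor
    · rintro ⟨h1, rfl⟩
      have h : ∀ i, ∃ k : ℤ, f i = m * k + ((redm m f i).val : ℕ) := by
        intro i
        have : ((f i - (redm m f i).val : ℤ) : ZMod m) = 0 := by
          simp [redm]
        rw [ZMod.intCast_zmod_eq_zero_iff_dvd] at this
        obtain ⟨k, hk⟩ := this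
        exact ⟨k, by linarith⟩
      choose k hk using h
      refine ⟨k, ?_, funext fun i => (hk i).symm⟩
      change _ ∈ B
      change _ ∈ B at h1
      convert h1 using 3 with i
      rw [hk i]
      push_cast
      rfl
    · rintro ⟨g, hg, rfl⟩
      refine ⟨?_, ?_⟩
      · change _ ∈ B
        change _ ∈ B at hg
        convert hg using 3 with i
        push_cast
        rfl
      · funext i
        simp [redm]
  · intro g g' h
    funext i
    have := congrFun h i
    simpa [NeZero.ne m] using this

theorem tendsto_dil_periodic {B : Set (Form ℝ)} (hB : Bornology.IsBounded B)
    (hBm : MeasurableSet B) (hfr : volume (frontier B) = 0) (m : ℕ) [NeZero m]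
    (S : Set (Form (ZMod m))) :
    Tendsto (fun N : ℝ => ({f ∈ dil B N | redm m f ∈ S}.ncard : ℝ) / N ^ 4) atTop
      (𝓝 (volume.real B * (S.ncard / m ^ 4))) := by
  classical
  have hm : (0 : ℝ) < m := by exact_mod_cast NeZero.pos m
  have hS : S.Finite := Set.toFinite S
  have h1 := tendsto_finsetSum hS.toFinset fun s _ =>
    tendsto_boxPts hB hBm hfr hm (fun i => ((s i).val : ℝ))
  have h2 : ∑ s ∈ hS.toFinset, volume.real B / (m : ℝ) ^ 4 =
      volume.real B * (S.ncard / m ^ 4) := by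
    rw [Finset.sum_const, ← Set.ncard_eq_toFinset_card _ hS, nsmul_eq_mul]
    ring
  rw [h2] at h1
  refine h1.congr' ?_
  filter_upwards [eventually_gt_atTop 0] with N hN
  rw [← Finset.sum_div]
  congr 1
  have hf : {f ∈ dil B N | redm m f ∈ S}.Finite := (finite_dil hB hN).subset fun f hf => hf.1
  rw [Set.ncard_eq_toFinset_card _ hf, Finset.card_eq_sum_card_fiberwise (f := redm m)
    (t := hS.toFinset) (by intro f; simp)]
  push_cast
  refine Finset.sum_congr rfl fun s hs => ?_
  rw [← ncard_dil_residue, Set.ncard_eq_toFinset_card _ ((finite_dil hB hN).subset fun f hf => hf.1)]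
  congr 2
  ext f
  simp only [Finset.mem_filter, Set.Finite.mem_toFinset, Set.mem_ofPred_eq] at hs ⊢
  constructor
  · rintro ⟨h, rfl⟩; exact ⟨⟨h, hs⟩, rfl⟩
  · rintro ⟨h, rfl⟩; exact ⟨h.1, rfl⟩

end DH

namespace DH

open MeasureTheory Topology

/-- `psi` as a map on `ℝ⁴`. -/
noncomputable def psiMap (σ : ℝ) (e : Form ℝ) : Form ℝ := psi σ (e 0) (e 1) (e 2) (e 3)

/-- The Jacobian matrix of `psiMap`. -/
noncomputable def psiJac (σ : ℝ) (e : Form ℝ) : Matrix (Fin 4) (Fin 4) ℝ :=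
  !![0, 0, 1, 0;
    -3 * e 2, (2 + σ) * e 3, -3 * e 0, (2 + σ) * e 1;
    6 * e 0 * e 2 - 2 * e 1 * ((2 + σ) * e 3),
      -2 * e 0 * ((2 + σ) * e 3) + 2 * e 1 * ((-1 - 2 * σ) * e 2),
      3 * e 0 ^ 2 + e 1 ^ 2 * (-1 - 2 * σ), -2 * e 0 * e 1 * (2 + σ);
    -3 * e 0 ^ 2 * e 2 + 2 * e 0 * e 1 * ((2 + σ) * e 3) - e 1 ^ 2 * ((-1 - 2 * σ) * e 2),
      e 0 ^ 2 * ((2 + σ) * e 3) - 2 * e 0 * e 1 * ((-1 - 2 * σ) * e 2)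
        + 3 * e 1 ^ 2 * (-σ * e 3),
      -e 0 ^ 3 - e 0 * e 1 ^ 2 * (-1 - 2 * σ), e 0 ^ 2 * e 1 * (2 + σ) + e 1 ^ 3 * (-σ)]

theorem det_psiJac {σ : ℝ} (hσ : σ = 1 ∨ σ = -1) (e : Form ℝ) :
    (psiJac σ e).det = (20 + 16 * σ) * (e 2 ^ 2 + e 3 ^ 2) * e 1 ^ 4 ∨
    (psiJac σ e).det = -((20 + 16 * σ) * (e 2 ^ 2 + e 3 ^ 2) * e 1 ^ 4) := by
  rcases hσ with rfl | rfl
  · left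
    rw [psiJac, Matrix.det_succ_row_zero]
    simp [Fin.sum_univ_succ, Matrix.det_fin_three, Fin.succAbove]
    ring
  · right
    rw [psiJac, Matrix.det_succ_row_zero]
    simp [Fin.sum_univ_succ, Matrix.det_fin_three, Fin.succAbove]
    ring

/-- The coordinate functionals on `ℝ⁴`. -/
noncomputable def coord (i : Fin 4) : Form ℝ →L[ℝ] ℝ := ContinuousLinearMap.proj i

theorem coord_apply (i : Fin 4) (x : Form ℝ) : coord i x = x i := rfl

/-- A matrix as a continuous linear map of `ℝ⁴`. -/
noncomputable def matCLM (J : Matrix (Fin 4) (Fin 4) ℝ) : Form ℝ →L[ℝ] Form ℝ :=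
  LinearMap.toContinuousLinearMap (Matrix.toLin' J)

theorem matCLM_apply (J : Matrix (Fin 4) (Fin 4) ℝ) (x : Form ℝ) (i : Fin 4) :
    matCLM J x i = J i 0 * x 0 + J i 1 * x 1 + J i 2 * x 2 + J i 3 * x 3 := by
  simp [matCLM, Matrix.mulVec, dotProduct, Fin.sum_univ_four]

theorem det_matCLM (J : Matrix (Fin 4) (Fin 4) ℝ) : (matCLM J).det = J.det := by
  simp [matCLM, ContinuousLinearMap.det]

theorem hasStrictFDerivAt_psiMap (σ : ℝ) (e : Form ℝ) :
    HasStrictFDerivAt (psiMap σ) (matCLM (psiJac σ e)) e := by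
  have h0 : HasStrictFDerivAt (fun e : Form ℝ => e 0) (coord 0) e :=
    hasStrictFDerivAt_apply 0 e
  have h1 : HasStrictFDerivAt (fun e : Form ℝ => e 1) (coord 1) e :=
    hasStrictFDerivAt_apply 1 e
  have h2 : HasStrictFDerivAt (fun e : Form ℝ => e 2) (coord 2) e :=
    hasStrictFDerivAt_apply 2 e
  have h3 : HasStrictFDerivAt (fun e : Form ℝ => e 3) (coord 3) e :=
    hasStrictFDerivAt_apply 3 e
  have hB := h3.const_mul (2 + σ)
  have hA := h2.const_mul (-1 - 2 * σ)
  have hD := h3.const_mul (-σ)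
  rw [hasStrictFDerivAt_pi']
  intro i
  fin_cases i
  · refine HasStrictFDerivAt.congr_fderiv (f' := coord 2) h2 ?_
    ext x
    simp [coord_apply, matCLM_apply, psiJac]
  · refine ((hB.mul h1).sub ((h0.const_mul 3).mul h2)).congr_fderiv ?_
    ext x
    simp [coord_apply, matCLM_apply, psiJac]
    ring
  · refine (((((h0.pow 2).const_mul 3).mul h2).sub
      (((h0.const_mul 2).mul h1).mul hB)).add ((h1.pow 2).mul hA)).congr_fderiv ?_
    ext x
    simp [coord_apply, matCLM_apply, psiJac]
    ring
  · refine (((((h0.pow 3).neg.mul h2).add (((h0.pow 2).mul h1).mul hB)).sub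
      ((h0.mul (h1.pow 2)).mul hA)).add ((h1.pow 3).mul hD)).congr_fderiv ?_
    ext x
    simp [coord_apply, matCLM_apply, psiJac]
    ring

/-- The radius in adapted coordinates. -/
noncomputable def radius (κ : ℝ) (e : Form ℝ) : ℝ :=
  (e 2 * (e 1 ^ 6 * (κ * Real.cos (e 0) ^ 6)⁻¹)) ^ (1 / 4 : ℝ)

/-- Coordinates in which the fundamental domain is a box. -/
noncomputable def polarMap (κ : ℝ) (e : Form ℝ) : Form ℝ :=
  ![Real.sin (e 0), Real.cos (e 0) * (e 1)⁻¹, radius κ e * Real.cos (e 3),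
    radius κ e * Real.sin (e 3)]

theorem hasStrictFDerivAt_polarMap {κ : ℝ} (hκ : 0 < κ) {e : Form ℝ} (h0 : 0 < Real.cos (e 0))
    (h1 : 0 < e 1) (h2 : 0 < e 2) : ∃ J, HasStrictFDerivAt (polarMap κ) (matCLM J) e ∧
    4 * κ * Real.cos (e 0) ^ 4 * radius κ e ^ 2 * J.det = - e 1 ^ 4 := by
  have d0 : HasStrictFDerivAt (fun e : Form ℝ => e 0) (coord 0) e :=
    hasStrictFDerivAt_apply 0 e
  have d1 : HasStrictFDerivAt (fun e : Form ℝ => e 1) (coord 1) e :=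
    hasStrictFDerivAt_apply 1 e
  have d2 : HasStrictFDerivAt (fun e : Form ℝ => e 2) (coord 2) e :=
    hasStrictFDerivAt_apply 2 e
  have d3 : HasStrictFDerivAt (fun e : Form ℝ => e 3) (coord 3) e :=
    hasStrictFDerivAt_apply 3 e
  have dG : HasStrictDerivAt (fun x => (κ * Real.cos x ^ 6)⁻¹)
      (deriv (fun x => (κ * Real.cos x ^ 6)⁻¹) (e 0)) (e 0) := by
    have : ContDiffAt ℝ 1 (fun x => (κ * Real.cos x ^ 6)⁻¹) (e 0) := by
      apply ContDiffAt.inv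
      · fun_prop
      · positivity
    exact this.hasStrictDerivAt one_ne_zero
  generalize deriv (fun x => (κ * Real.cos x ^ 6)⁻¹) (e 0) = G' at dG
  have dg := dG.comp_hasStrictFDerivAt e d0
  have dy := d2.mul ((d1.pow 6).mul dg)
  have hy : 0 < e 2 * (e 1 ^ 6 * (κ * Real.cos (e 0) ^ 6)⁻¹) := by positivity
  have dr := (Real.hasStrictDerivAt_rpow_const (p := 1 / 4) (Or.inl hy.ne')).comp_hasStrictFDerivAt e dy
  have hr : 0 < radius κ e := Real.rpow_pos_of_pos hy _
  have hr4 : radius κ e ^ 4 = e 2 * (e 1 ^ 6 * (κ * Real.cos (e 0) ^ 6)⁻¹) := by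
    rw [radius, ← Real.rpow_natCast, ← Real.rpow_mul hy.le]
    norm_num
  rw [Real.rpow_sub_one hy.ne'] at dr
  change HasStrictFDerivAt (radius κ) ((1 / 4 * (radius κ e / _)) • _) e at dr
  rw [← hr4] at dr
  obtain ⟨p, q, w, hw, dr⟩ : ∃ p q w : ℝ, 4 * κ * Real.cos (e 0) ^ 6 * radius κ e ^ 3 * w = e 1 ^ 6 ∧
      HasStrictFDerivAt (radius κ) (p • coord 0 + q • coord 1
        + w • coord 2 : Form ℝ →L[ℝ] ℝ) e := by
    refine ⟨1 / 4 * (radius κ e / radius κ e ^ 4) * (e 2 * e 1 ^ 6 * G'),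
      1 / 4 * (radius κ e / radius κ e ^ 4) * (e 2 * (κ * Real.cos (e 0) ^ 6)⁻¹ * (6 * e 1 ^ 5)),
      1 / 4 * (radius κ e / radius κ e ^ 4) * (e 1 ^ 6 * (κ * Real.cos (e 0) ^ 6)⁻¹), ?_,
      dr.congr_fderiv ?_⟩
    · field_simp
    · ext x
      simp [coord_apply]
      ring
  refine ⟨!![Real.cos (e 0), 0, 0, 0; -Real.sin (e 0) * (e 1)⁻¹, -Real.cos (e 0) * (e 1 ^ 2)⁻¹, 0, 0;
    p * Real.cos (e 3), q * Real.cos (e 3), w * Real.cos (e 3), -radius κ e * Real.sin (e 3);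
    p * Real.sin (e 3), q * Real.sin (e 3), w * Real.sin (e 3), radius κ e * Real.cos (e 3)],
    ?_, ?_⟩
  · have s0 := (Real.hasStrictDerivAt_sin (e 0)).comp_hasStrictFDerivAt e d0
    have c0 := (Real.hasStrictDerivAt_cos (e 0)).comp_hasStrictFDerivAt e d0
    have s3 := (Real.hasStrictDerivAt_sin (e 3)).comp_hasStrictFDerivAt e d3
    have c3 := (Real.hasStrictDerivAt_cos (e 3)).comp_hasStrictFDerivAt e d3
    have i1 := (hasStrictDerivAt_inv h1.ne').comp_hasStrictFDerivAt e d1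
    rw [hasStrictFDerivAt_pi']
    intro i
    fin_cases i
    · refine HasStrictFDerivAt.congr_fderiv s0 ?_
      ext x
      simp [coord_apply, matCLM_apply]
    · refine HasStrictFDerivAt.congr_fderiv (c0.mul i1) ?_
      ext x
      simp [coord_apply, matCLM_apply]
      ring
    · refine HasStrictFDerivAt.congr_fderiv (dr.mul c3) ?_
      ext x
      simp [coord_apply, matCLM_apply]
      ring
    · refine HasStrictFDerivAt.congr_fderiv (dr.mul s3) ?_
      ext x
      simp [coord_apply, matCLM_apply]
      ring
  · have hdet : Matrix.det !![Real.cos (e 0), 0, 0, 0;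
        -Real.sin (e 0) * (e 1)⁻¹, -Real.cos (e 0) * (e 1 ^ 2)⁻¹, 0, 0;
        p * Real.cos (e 3), q * Real.cos (e 3), w * Real.cos (e 3), -radius κ e * Real.sin (e 3);
        p * Real.sin (e 3), q * Real.sin (e 3), w * Real.sin (e 3), radius κ e * Real.cos (e 3)] =
        Real.cos (e 0) * (-Real.cos (e 0) * (e 1 ^ 2)⁻¹) * (radius κ e * w) := by
      rw [Matrix.det_succ_row_zero]
      simp [Fin.sum_univ_succ, Matrix.det_fin_three, Fin.succAbove]
      linear_combination (Real.cos (e 0) * (-Real.cos (e 0) * (e 1 ^ 2)⁻¹) * (radius κ e * w)) *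
        Real.sin_sq_add_cos_sq (e 3)
    rw [hdet]
    field_simp
    linear_combination -hw

end DH

namespace DH

open MeasureTheory Topology

/-- The fundamental domain parametrised by a box. -/
noncomputable def par (σ : ℝ) (e : Form ℝ) : Form ℝ := psiMap σ (polarMap (56 + 52 * σ) e)

/-- Lower corner of the parameter box. -/
noncomputable def boxLo (ε : ℝ) : Form ℝ := ![0, ε, 0, -(Real.pi / 2)]

/-- Upper corner of the parameter box. -/
noncomputable def boxHi : Form ℝ := ![Real.pi / 6, 1, 1, Real.pi / 2]

/-- The open truncated fundamental domain. -/
noncomputable def inB (σ ε : ℝ) : Set (Form ℝ) :=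
  par σ '' Set.univ.pi fun i => Set.Ioo (boxLo ε i) (boxHi i)

/-- The compact truncated fundamental domain. -/
noncomputable def outB (σ ε : ℝ) : Set (Form ℝ) := par σ '' Set.Icc (boxLo ε) boxHi

theorem mem_openBox {ε : ℝ} {e : Form ℝ} :
    (e ∈ Set.univ.pi fun i => Set.Ioo (boxLo ε i) (boxHi i)) ↔
      (0 < e 0 ∧ e 0 < Real.pi / 6) ∧ (ε < e 1 ∧ e 1 < 1) ∧ (0 < e 2 ∧ e 2 < 1) ∧
        (-(Real.pi / 2) < e 3 ∧ e 3 < Real.pi / 2) := by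
  rw [Set.mem_univ_pi]
  simp [Fin.forall_fin_succ, boxLo, boxHi]

theorem mem_closedBox {ε : ℝ} {e : Form ℝ} :
    e ∈ Set.Icc (boxLo ε) boxHi ↔
      (0 ≤ e 0 ∧ e 0 ≤ Real.pi / 6) ∧ (ε ≤ e 1 ∧ e 1 ≤ 1) ∧ (0 ≤ e 2 ∧ e 2 ≤ 1) ∧
        (-(Real.pi / 2) ≤ e 3 ∧ e 3 ≤ Real.pi / 2) := by
  rw [Set.mem_Icc, Pi.le_def, Pi.le_def]
  simp [Fin.forall_fin_succ, boxLo, boxHi]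
  tauto

theorem openBox_subset (ε : ℝ) : (Set.univ.pi fun i => Set.Ioo (boxLo ε i) (boxHi i)) ⊆
    Set.Icc (boxLo ε) boxHi := by
  intro e he
  rw [mem_openBox] at he
  rw [mem_closedBox]
  obtain ⟨⟨h1, h2⟩, ⟨h3, h4⟩, ⟨h5, h6⟩, h7, h8⟩ := he
  exact ⟨⟨h1.le, h2.le⟩, ⟨h3.le, h4.le⟩, ⟨h5.le, h6.le⟩, h7.le, h8.le⟩

theorem cos_pos_of_mem {x : ℝ} (h0 : 0 ≤ x) (h1 : x ≤ Real.pi / 6) : 0 < Real.cos x :=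
  Real.cos_pos_of_mem_Ioo ⟨by linarith [Real.pi_pos], by linarith [Real.pi_pos]⟩

theorem kappa_pos {σ : ℝ} (hσ : σ = 1 ∨ σ = -1) : 0 < 56 + 52 * σ := by
  rcases hσ with rfl | rfl <;> norm_num

theorem continuousOn_par {σ ε : ℝ} (hσ : σ = 1 ∨ σ = -1) (hε : 0 < ε) :
    ContinuousOn (par σ) (Set.Icc (boxLo ε) boxHi) := by
  have hκ := kappa_pos hσ
  have h1 : Continuous (psiMap σ) := continuous_iff_continuousAt.2 fun e =>
    (hasStrictFDerivAt_psiMap σ e).continuousAt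
  refine h1.comp_continuousOn ?_
  rw [continuousOn_pi]
  have hc : ∀ e ∈ Set.Icc (boxLo ε) boxHi, 0 < Real.cos (e 0) := by
    intro e he
    rw [mem_closedBox] at he
    exact cos_pos_of_mem he.1.1 he.1.2
  have hr : ContinuousOn (radius (56 + 52 * σ)) (Set.Icc (boxLo ε) boxHi) := by
    refine ContinuousOn.rpow_const ?_ fun e he => Or.inr (by norm_num)
    refine ContinuousOn.mul (by fun_prop) (ContinuousOn.mul (by fun_prop) ?_)
    refine ContinuousOn.inv₀ (by fun_prop) fun e he => ?_
    have := hc e he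
    positivity
  intro i
  fin_cases i
  · exact Continuous.continuousOn (f := fun e : Form ℝ => Real.sin (e 0)) (by fun_prop)
  · refine ContinuousOn.mul (f := fun e : Form ℝ => Real.cos (e 0)) (g := fun e => (e 1)⁻¹)
      (by fun_prop) (ContinuousOn.inv₀ (by fun_prop) fun e he => ?_)
    rw [mem_closedBox] at he
    linarith [he.2.1.1]
  · exact hr.mul (Continuous.continuousOn (f := fun e : Form ℝ => Real.cos (e 3)) (by fun_prop))
  · exact hr.mul (Continuous.continuousOn (f := fun e : Form ℝ => Real.sin (e 3)) (by fun_prop))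

theorem hasStrictFDerivAt_par {σ : ℝ} (hσ : σ = 1 ∨ σ = -1) {e : Form ℝ}
    (h0 : 0 < Real.cos (e 0)) (h1 : 0 < e 1) (h2 : 0 < e 2) :
    ∃ L : Form ℝ →L[ℝ] Form ℝ, HasStrictFDerivAt (par σ) L e ∧
      |L.det| = (20 + 16 * σ) / (4 * (56 + 52 * σ)) := by
  have hκ := kappa_pos hσ
  obtain ⟨J, hJ, hdet⟩ := hasStrictFDerivAt_polarMap hκ h0 h1 h2
  refine ⟨_, (hasStrictFDerivAt_psiMap σ _).comp e hJ, ?_⟩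
  have hd : ((matCLM (psiJac σ (polarMap (56 + 52 * σ) e))).comp (matCLM J)).det =
      (psiJac σ (polarMap (56 + 52 * σ) e)).det * J.det := by
    rw [← det_matCLM, ← det_matCLM]
    exact LinearMap.det_comp _ _
  rw [hd]
  have hC : 0 < 20 + 16 * σ := by rcases hσ with rfl | rfl <;> norm_num
  have key : |(psiJac σ (polarMap (56 + 52 * σ) e)).det| =
      (20 + 16 * σ) * (radius (56 + 52 * σ) e ^ 2) * (Real.cos (e 0) * (e 1)⁻¹) ^ 4 := by
    have h3 : polarMap (56 + 52 * σ) e 2 ^ 2 + polarMap (56 + 52 * σ) e 3 ^ 2 =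
        radius (56 + 52 * σ) e ^ 2 := by
      simp [polarMap]
      linear_combination radius (56 + 52 * σ) e ^ 2 * Real.sin_sq_add_cos_sq (e 3)
    have h4 : polarMap (56 + 52 * σ) e 1 = Real.cos (e 0) * (e 1)⁻¹ := by simp [polarMap]
    rcases det_psiJac hσ (polarMap (56 + 52 * σ) e) with h | h
    · rw [h, h3, h4, abs_of_nonneg (by positivity)]
    · rw [h, h3, h4, abs_neg, abs_of_nonneg (by positivity)]
  have key2 : 4 * (56 + 52 * σ) * Real.cos (e 0) ^ 4 * radius (56 + 52 * σ) e ^ 2 * |J.det| =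
      e 1 ^ 4 := by
    have := congrArg abs hdet
    rwa [abs_mul, abs_neg, abs_of_nonneg (a := e 1 ^ 4) (by positivity), abs_of_nonneg
      (a := 4 * (56 + 52 * σ) * Real.cos (e 0) ^ 4 * radius (56 + 52 * σ) e ^ 2)
      (by positivity)] at this
  generalize 56 + 52 * σ = κ at *
  rw [abs_mul, key, eq_div_iff (by positivity)]
  field_simp
  linear_combination key2

theorem radius_pow {κ : ℝ} (hκ : 0 < κ) {e : Form ℝ} (h0 : 0 < Real.cos (e 0))
    (h1 : 0 < e 1) (h2 : 0 ≤ e 2) :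
    radius κ e ^ 4 = e 2 * (e 1 ^ 6 * (κ * Real.cos (e 0) ^ 6)⁻¹) := by
  have hy : 0 ≤ e 2 * (e 1 ^ 6 * (κ * Real.cos (e 0) ^ 6)⁻¹) := by positivity
  rw [radius, ← Real.rpow_natCast, ← Real.rpow_mul hy]
  norm_num

theorem radius_pos {κ : ℝ} (hκ : 0 < κ) {e : Form ℝ} (h0 : 0 < Real.cos (e 0))
    (h1 : 0 < e 1) (h2 : 0 < e 2) : 0 < radius κ e :=
  Real.rpow_pos_of_pos (by positivity) _

theorem kappa_radius {κ : ℝ} (hκ : 0 < κ) {e : Form ℝ} (h0 : 0 < Real.cos (e 0))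
    (h1 : 0 < e 1) (h2 : 0 ≤ e 2) : κ * (polarMap κ e 2 ^ 2 + polarMap κ e 3 ^ 2) ^ 2 *
      polarMap κ e 1 ^ 6 = e 2 := by
  have h3 : polarMap κ e 2 ^ 2 + polarMap κ e 3 ^ 2 = radius κ e ^ 2 := by
    simp [polarMap]
    linear_combination radius κ e ^ 2 * Real.sin_sq_add_cos_sq (e 3)
  rw [h3]
  have h4 : polarMap κ e 1 = Real.cos (e 0) * (e 1)⁻¹ := by simp [polarMap]
  have := radius_pow hκ h0 h1 h2
  rw [h4, ← pow_mul, this]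
  field_simp

theorem injOn_par {σ ε : ℝ} (hσ : σ = 1 ∨ σ = -1) (hε : 0 < ε) :
    Set.InjOn (par σ) (Set.univ.pi fun i => Set.Ioo (boxLo ε i) (boxHi i)) := by
  have hκ := kappa_pos hσ
  intro e he e' he' h
  rw [mem_openBox] at he he'
  have c := cos_pos_of_mem he.1.1.le he.1.2.le
  have c' := cos_pos_of_mem he'.1.1.le he'.1.2.le
  have p1 : 0 < e 1 := by linarith [he.2.1.1]
  have p1' : 0 < e' 1 := by linarith [he'.2.1.1]
  have c3 := Real.cos_pos_of_mem_Ioo he.2.2.2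
  have c3' := Real.cos_pos_of_mem_Ioo he'.2.2.2
  have r := radius_pos hκ c p1 he.2.2.1.1
  have r' := radius_pos hκ c' p1' he'.2.2.1.1
  have k := kappa_radius hκ c p1 he.2.2.1.1.le
  have k' := kappa_radius hκ c' p1' he'.2.2.1.1.le
  obtain ⟨h0, h1, h2, h3⟩ := psi_injective hσ (by simpa [polarMap] using ⟨r.ne', c3.ne'⟩)
    (by simp [polarMap]; positivity) (by simp [polarMap]; positivity) h
  rw [h1, h2, h3, k'] at k
  have e0 : e 0 = e' 0 := by
    refine Real.injOn_sin ⟨?_, ?_⟩ ⟨?_, ?_⟩ (by simpa [polarMap] using h0) <;>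
      linarith [Real.pi_pos, he.1.1, he.1.2, he'.1.1, he'.1.2]
  have e1 : e 1 = e' 1 := by
    simp only [polarMap, Matrix.cons_val_one, Matrix.cons_val_zero] at h1
    rw [e0] at h1
    exact inv_injective (mul_left_cancel₀ c'.ne' h1)
  have er : radius (56 + 52 * σ) e = radius (56 + 52 * σ) e' := by
    rw [radius, radius, e0, e1, k]
  have e3 : e 3 = e' 3 := by
    refine Real.injOn_sin ⟨he.2.2.2.1.le, he.2.2.2.2.le⟩ ⟨he'.2.2.2.1.le, he'.2.2.2.2.le⟩ ?_
    simp only [polarMap, Matrix.cons_val] at h3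
    rw [er] at h3
    exact mul_left_cancel₀ r'.ne' h3
  funext i
  fin_cases i
  exacts [e0, e1, k.symm, e3]

theorem isOpen_inB {σ ε : ℝ} (hσ : σ = 1 ∨ σ = -1) (hε : 0 < ε) : IsOpen (inB σ ε) := by
  rw [isOpen_iff_mem_nhds]
  rintro _ ⟨e, he, rfl⟩
  have ho : IsOpen (Set.univ.pi fun i => Set.Ioo (boxLo ε i) (boxHi i)) :=
    isOpen_set_pi Set.finite_univ fun i _ => isOpen_Ioo
  have hnhds := ho.mem_nhds he
  rw [mem_openBox] at he
  obtain ⟨L, hL, hdet⟩ := hasStrictFDerivAt_par hσ (cos_pos_of_mem he.1.1.le he.1.2.le)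
    (by linarith [he.2.1.1]) he.2.2.1.1
  have hne : L.det ≠ 0 := by
    rw [← abs_pos, hdet]
    rcases hσ with rfl | rfl <;> norm_num
  have h3 := HasStrictFDerivAt.map_nhds_eq_of_equiv
    (f' := L.toContinuousLinearEquivOfDetNeZero hne) (f := par σ) (a := e) (by simpa using hL)
  rw [← h3]
  exact image_mem_map hnhds

theorem isCompact_outB {σ ε : ℝ} (hσ : σ = 1 ∨ σ = -1) (hε : 0 < ε) : IsCompact (outB σ ε) :=
  isCompact_Icc.image_of_continuousOn (continuousOn_par hσ hε)

theorem inB_subset_outB (σ ε : ℝ) : inB σ ε ⊆ outB σ ε := Set.image_mono (openBox_subset ε)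

theorem volume_outB_diff {σ ε : ℝ} (hσ : σ = 1 ∨ σ = -1) (hε : 0 < ε) :
    volume (outB σ ε \ inB σ ε) = 0 := by
  set O := Set.univ.pi fun i => Set.Ioo (boxLo ε i) (boxHi i) with hO
  have hsub : outB σ ε \ inB σ ε ⊆
      par σ '' ((Set.Icc (boxLo ε) boxHi \ O) ∩ {e | 0 < e 2}) ∪ {0} := by
    rintro _ ⟨⟨e, he, rfl⟩, hn⟩
    by_cases h2 : 0 < e 2
    · left
      exact ⟨e, ⟨⟨he, fun h => hn ⟨e, h, rfl⟩⟩, h2⟩, rfl⟩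
    · right
      rw [mem_closedBox] at he
      have h3 : e 2 = 0 := le_antisymm (not_lt.1 h2) he.2.2.1.1
      have : radius (56 + 52 * σ) e = 0 := by
        rw [radius, h3, zero_mul, Real.zero_rpow (by norm_num)]
      rw [Set.mem_singleton_iff]
      apply form_ext <;> simp [par, psiMap, polarMap, this, psi]
  refine measure_mono_null hsub (measure_union_null ?_ (measure_singleton 0))
  refine addHaar_image_eq_zero_of_differentiableOn_of_addHaar_eq_zero volume ?_ ?_
  · rintro e ⟨⟨he, -⟩, h2⟩
    rw [mem_closedBox] at he
    obtain ⟨L, hL, -⟩ := hasStrictFDerivAt_par hσ (cos_pos_of_mem he.1.1 he.1.2)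
      (by linarith [he.2.1.1]) h2
    exact hL.hasFDerivAt.differentiableAt.differentiableWithinAt
  · refine measure_mono_null Set.inter_subset_left ?_
    have := Measure.univ_pi_Ioo_ae_eq_Icc (μ := fun _ : Fin 4 => (volume : Measure ℝ))
      (f := boxLo ε) (g := boxHi)
    exact (ae_le_set.1 this.symm.le)

theorem measureReal_outB {σ ε : ℝ} (hσ : σ = 1 ∨ σ = -1) (hε : 0 < ε) :
    volume.real (outB σ ε) = volume.real (inB σ ε) := by
  rw [measureReal_def, measureReal_def]
  congr 1
  refine le_antisymm ?_ (measure_mono (inB_subset_outB σ ε))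
  calc volume (outB σ ε) ≤ volume (inB σ ε ∪ (outB σ ε \ inB σ ε)) :=
        measure_mono fun x hx => by by_cases h : x ∈ inB σ ε; exacts [.inl h, .inr ⟨hx, h⟩]
    _ ≤ _ := measure_union_le _ _
    _ = _ := by rw [volume_outB_diff hσ hε, add_zero]

theorem volume_frontier_inB {σ ε : ℝ} (hσ : σ = 1 ∨ σ = -1) (hε : 0 < ε) :
    volume (frontier (inB σ ε)) = 0 := by
  refine measure_mono_null ?_ (volume_outB_diff hσ hε)
  rw [(isOpen_inB hσ hε).frontier_eq]
  exact Set.sdiff_subset_sdiff_left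
    (closure_minimal (inB_subset_outB σ ε) (isCompact_outB hσ hε).isClosed)

theorem volume_frontier_outB {σ ε : ℝ} (hσ : σ = 1 ∨ σ = -1) (hε : 0 < ε) :
    volume (frontier (outB σ ε)) = 0 := by
  refine measure_mono_null ?_ (volume_outB_diff hσ hε)
  rw [(isCompact_outB hσ hε).isClosed.frontier_eq]
  exact Set.sdiff_subset_sdiff_right
    (interior_maximal (inB_subset_outB σ ε) (isOpen_inB hσ hε))

theorem measureReal_inB {σ ε : ℝ} (hσ : σ = 1 ∨ σ = -1) (hε : 0 < ε) (hε1 : ε < 1) :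
    volume.real (inB σ ε) =
      (20 + 16 * σ) / (4 * (56 + 52 * σ)) * (Real.pi ^ 2 / 6 * (1 - ε)) := by
  set O := Set.univ.pi fun i => Set.Ioo (boxLo ε i) (boxHi i) with hO
  have hd : ∀ e, ∃ L : Form ℝ →L[ℝ] Form ℝ, e ∈ O → HasFDerivWithinAt (par σ) L O e ∧
      |L.det| = (20 + 16 * σ) / (4 * (56 + 52 * σ)) := by
    intro e
    by_cases h : e ∈ O
    · have he := h
      rw [mem_openBox] at he
      obtain ⟨L, hL, hdet⟩ := hasStrictFDerivAt_par hσ (cos_pos_of_mem he.1.1.le he.1.2.le)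
        (by linarith [he.2.1.1]) he.2.2.1.1
      exact ⟨L, fun _ => ⟨hL.hasFDerivAt.hasFDerivWithinAt, hdet⟩⟩
    · exact ⟨0, fun h' => absurd h' h⟩
  choose L hL using hd
  have hOm : MeasurableSet O := MeasurableSet.univ_pi fun i => measurableSet_Ioo
  have h1 := lintegral_abs_det_fderiv_eq_addHaar_image volume hOm (fun e he => (hL e he).1)
    (injOn_par hσ hε)
  rw [setLIntegral_congr_fun hOm (g := fun _ => ENNReal.ofReal
    ((20 + 16 * σ) / (4 * (56 + 52 * σ)))) (fun e he => by rw [(hL e he).2]),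
    setLIntegral_const] at h1
  have hC : 0 ≤ (20 + 16 * σ) / (4 * (56 + 52 * σ)) := by
    rcases hσ with rfl | rfl <;> norm_num
  rw [measureReal_def, inB, ← h1, ENNReal.toReal_mul, ENNReal.toReal_ofReal hC, Real.volume_pi_Ioo]
  congr 1
  have := Real.pi_pos
  simp [Fin.prod_univ_four, boxLo, boxHi]
  rw [ENNReal.toReal_ofReal (by positivity), ENNReal.toReal_ofReal (by linarith),
    ENNReal.toReal_ofReal (by linarith)]
  ring

end DH

namespace DH

theorem exists_of_mem_inB {σ ε : ℝ} (hσ : σ = 1 ∨ σ = -1) (hε : 0 < ε) {g : Form ℝ}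
    (hg : g ∈ inB σ ε) : ∃ u v A B : ℝ, g = psi σ u v A B ∧ 0 < A ∧ 0 < u ∧ u < 1 / 2 ∧
      1 < u ^ 2 + v ^ 2 ∧ 0 < v ∧ (56 + 52 * σ) * (A ^ 2 + B ^ 2) ^ 2 * v ^ 6 < 1 := by
  have hκ := kappa_pos hσ
  obtain ⟨e, he, rfl⟩ := hg
  rw [mem_openBox] at he
  have c := cos_pos_of_mem he.1.1.le he.1.2.le
  have p1 : 0 < e 1 := by linarith [he.2.1.1]
  have c3 := Real.cos_pos_of_mem_Ioo he.2.2.2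
  have r := radius_pos hκ c p1 he.2.2.1.1
  have k := kappa_radius hκ c p1 he.2.2.1.1.le
  refine ⟨_, _, _, _, rfl, ?_, ?_, ?_, ?_, ?_, ?_⟩
  · simp only [polarMap, Matrix.cons_val]
    positivity
  · exact Real.sin_pos_of_pos_of_lt_pi he.1.1 (by linarith [he.1.2, Real.pi_pos])
  · change Real.sin (e 0) < 1 / 2
    rw [← Real.sin_pi_div_six]
    exact Real.sin_lt_sin_of_lt_of_le_pi_div_two (by linarith [he.1.1, Real.pi_pos])
      (by linarith [Real.pi_pos]) he.1.2
  · change 1 < Real.sin (e 0) ^ 2 + (Real.cos (e 0) * (e 1)⁻¹) ^ 2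
    have h1 : 1 < (e 1)⁻¹ := (one_lt_inv₀ p1).2 he.2.1.2
    have h2 : 1 < (e 1)⁻¹ ^ 2 := one_lt_pow₀ h1 two_ne_zero
    have h3 := Real.sin_sq_add_cos_sq (e 0)
    have h4 : 0 < Real.cos (e 0) ^ 2 := by positivity
    rw [mul_pow]
    nlinarith
  · change 0 < Real.cos (e 0) * (e 1)⁻¹
    positivity
  · rw [k]
    exact he.2.2.1.2

theorem mem_outB {σ ε : ℝ} (hσ : σ = 1 ∨ σ = -1) {u v A B : ℝ} (hA : 0 < A)
    (hu : 0 ≤ u) (hu1 : u ≤ 1 / 2) (hn : 1 ≤ u ^ 2 + v ^ 2) (hv : 0 < v) (hv1 : 2 * v * ε ≤ 1)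
    (hq : (56 + 52 * σ) * (A ^ 2 + B ^ 2) ^ 2 * v ^ 6 ≤ 1) : psi σ u v A B ∈ outB σ ε := by
  have hκ := kappa_pos hσ
  set r := Real.sqrt (A ^ 2 + B ^ 2) with hr
  have hr2 : r ^ 2 = A ^ 2 + B ^ 2 := Real.sq_sqrt (by positivity)
  have hr0 : 0 < r := Real.sqrt_pos.2 (by positivity)
  have hBr : |B| ≤ r := by
    rw [hr]
    exact Real.abs_le_sqrt (by nlinarith)
  have hBr' : -1 ≤ B / r ∧ B / r ≤ 1 := by
    rw [abs_le] at hBr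
    constructor
    · rw [le_div_iff₀ hr0]; linarith
    · rw [div_le_one hr0]; linarith
  have hs3 : Real.sin (Real.arcsin (B / r)) = B / r := Real.sin_arcsin hBr'.1 hBr'.2
  have hc3 : Real.cos (Real.arcsin (B / r)) = A / r := by
    rw [Real.cos_arcsin, Real.sqrt_eq_iff_mul_self_eq (by
      have := abs_le_one_iff_mul_self_le_one.1 (abs_le.2 hBr'); nlinarith) (by positivity)]
    field_simp
    linarith
  have hs0 : Real.sin (Real.arcsin u) = u := Real.sin_arcsin (by linarith) (by linarith)
  have hc0 : Real.cos (Real.arcsin u) = Real.sqrt (1 - u ^ 2) := Real.cos_arcsin u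
  set c := Real.sqrt (1 - u ^ 2) with hc
  have hc2 : c ^ 2 = 1 - u ^ 2 := Real.sq_sqrt (by nlinarith)
  have hcpos : 0 < c := Real.sqrt_pos.2 (by nlinarith)
  have hchalf : 1 / 2 ≤ c := by
    by_contra! h
    nlinarith
  have hcv : c ≤ v := by
    by_contra! h
    nlinarith
  let e : Form ℝ := ![Real.arcsin u, c / v, (56 + 52 * σ) * (A ^ 2 + B ^ 2) ^ 2 * v ^ 6,
    Real.arcsin (B / r)]
  have hrad : radius (56 + 52 * σ) e = r := by
    have h0 : e 2 * (e 1 ^ 6 * ((56 + 52 * σ) * Real.cos (e 0) ^ 6)⁻¹) = r ^ 4 := by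
      simp only [e, Matrix.cons_val]
      rw [hc0, ← hr2]
      field_simp
    rw [radius, h0, ← Real.rpow_natCast, ← Real.rpow_mul hr0.le]
    norm_num
  refine ⟨e, ?_, ?_⟩
  · rw [mem_closedBox]
    refine ⟨⟨Real.arcsin_nonneg.2 hu, ?_⟩, ⟨?_, ?_⟩, ⟨?_, hq⟩, Real.neg_pi_div_two_le_arcsin _,
      Real.arcsin_le_pi_div_two _⟩
    · change Real.arcsin u ≤ _
      rw [Real.arcsin_le_iff_le_sin ⟨by linarith, by linarith⟩
        ⟨by linarith [Real.pi_pos], by linarith [Real.pi_pos]⟩, Real.sin_pi_div_six]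
      exact hu1
    · change ε ≤ c / v
      rw [le_div_iff₀ hv]
      nlinarith
    · change c / v ≤ 1
      rwa [div_le_one hv]
    · change 0 ≤ (56 + 52 * σ) * (A ^ 2 + B ^ 2) ^ 2 * v ^ 6
      positivity
  · have h0 : polarMap (56 + 52 * σ) e 0 = u := hs0
    have h1 : polarMap (56 + 52 * σ) e 1 = v := by
      change Real.cos (Real.arcsin u) * (c / v)⁻¹ = v
      rw [hc0]
      field_simp
    have h2 : polarMap (56 + 52 * σ) e 2 = A := by
      change radius (56 + 52 * σ) e * Real.cos (Real.arcsin (B / r)) = A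
      rw [hrad, hc3]
      field_simp
    have h3 : polarMap (56 + 52 * σ) e 3 = B := by
      change radius (56 + 52 * σ) e * Real.sin (Real.arcsin (B / r)) = B
      rw [hrad, hs3]
      field_simp
    rw [par, psiMap, h0, h1, h2, h3]

theorem psi_smul (σ u v A B t : ℝ) : psi σ u v (t * A) (t * B) = t • psi σ u v A B := by
  apply form_ext <;> simp [psi] <;> ring

theorem toR_eq_of_div {σ u v A B N : ℝ} (hN : 0 < N) {f : Form ℤ}
    (h : (fun i => (f i : ℝ) / N) = psi σ u v A B) : toR f = psi σ u v (N * A) (N * B) := by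
  rw [psi_smul, ← h]
  funext i
  simp [toR]
  field_simp

theorem sigma_disc {σ u v A B : ℝ} (hσ : σ = 1 ∨ σ = -1) {f : Form ℤ}
    (h : toR f = psi σ u v A B) :
    σ * ((disc f : ℤ) : ℝ) = (56 + 52 * σ) * (A ^ 2 + B ^ 2) ^ 2 * v ^ 6 := by
  rw [← disc_toR, h, disc_psi hσ]

theorem of_mem_dil_inB {σ ε N : ℝ} (hσ : σ = 1 ∨ σ = -1) (hε : 0 < ε) (hN : 0 < N) {f : Form ℤ}
    (hf : f ∈ dil (inB σ ε) N) :
    RedOpen σ f ∧ 0 < σ * ((disc f : ℤ) : ℝ) ∧ σ * ((disc f : ℤ) : ℝ) < N ^ 4 := by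
  have hκ := kappa_pos hσ
  obtain ⟨u, v, A, B, h, hA, hu, hu1, hn, hv, hq⟩ := exists_of_mem_inB hσ hε hf
  have h1 := toR_eq_of_div hN h
  rw [sigma_disc hσ h1]
  refine ⟨⟨u, v, N * A, N * B, h1, by positivity, hu, hu1, hn, hv⟩, by positivity, ?_⟩
  have : (56 + 52 * σ) * ((N * A) ^ 2 + (N * B) ^ 2) ^ 2 * v ^ 6 =
      N ^ 4 * ((56 + 52 * σ) * (A ^ 2 + B ^ 2) ^ 2 * v ^ 6) := by ring
  rw [this]
  have : 0 < N ^ 4 := by positivity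
  nlinarith

theorem mem_dil_outB {σ ε N : ℝ} (hσ : σ = 1 ∨ σ = -1) (hN : 0 < N) {f : Form ℤ} {u v A B : ℝ}
    (h : toR f = psi σ u v A B) (hA : 0 < A)
    (hu : 0 ≤ u) (hu1 : u ≤ 1 / 2) (hn : 1 ≤ u ^ 2 + v ^ 2) (hv : 0 < v) (hv1 : 2 * v * ε ≤ 1)
    (hd : σ * ((disc f : ℤ) : ℝ) ≤ N ^ 4) : f ∈ dil (outB σ ε) N := by
  have h1 : (fun i => (f i : ℝ) / N) = psi σ u v (N⁻¹ * A) (N⁻¹ * B) := by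
    rw [psi_smul, ← h]
    funext i
    simp [toR]
    field_simp
  change _ ∈ outB σ ε
  rw [h1]
  refine mem_outB hσ (by positivity) hu hu1 hn hv hv1 ?_
  rw [sigma_disc hσ h] at hd
  have : (56 + 52 * σ) * ((N⁻¹ * A) ^ 2 + (N⁻¹ * B) ^ 2) ^ 2 * v ^ 6 =
      ((56 + 52 * σ) * (A ^ 2 + B ^ 2) ^ 2 * v ^ 6) / N ^ 4 := by field_simp
  rw [this, div_le_one (by positivity)]
  exact hd

/-- Number of integral points in a box, each of whose sides is at least one. -/
theorem card_box_le {R : Fin 4 → ℝ} (hR : ∀ i, 1 ≤ R i) :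
    ({f : Form ℤ | ∀ i, |(f i : ℝ)| ≤ R i}).Finite ∧
    (({f : Form ℤ | ∀ i, |(f i : ℝ)| ≤ R i}).ncard : ℝ) ≤ 81 * ∏ i, R i := by
  have h : {f : Form ℤ | ∀ i, |(f i : ℝ)| ≤ R i} =
      ((Fintype.piFinset fun i => Finset.Icc (-⌊R i⌋) ⌊R i⌋ : Finset (Form ℤ)) : Set (Form ℤ)) := by
    ext f
    simp only [Set.mem_ofPred_eq, Finset.mem_coe, Fintype.mem_piFinset, Finset.mem_Icc]
    refine forall_congr' fun i => ?_
    rw [← abs_le, Int.le_floor]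
    push_cast
    rfl
  refine ⟨h ▸ Finset.finite_toSet _, ?_⟩
  rw [h, Set.ncard_coe_finset, Fintype.card_piFinset]
  push_cast
  calc ∏ i, ((Finset.Icc (-⌊R i⌋) ⌊R i⌋).card : ℝ) ≤ ∏ i, 3 * R i := by
        refine Finset.prod_le_prod (fun i _ => by positivity) fun i _ => ?_
        rw [Int.card_Icc]
        have h1 : 0 ≤ ⌊R i⌋ := Int.floor_nonneg.2 (by linarith [hR i])
        have h2 : ((⌊R i⌋ + 1 - -⌊R i⌋).toNat : ℤ) = ⌊R i⌋ + 1 - -⌊R i⌋ :=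
          Int.toNat_of_nonneg (by omega)
        have h3 : ((⌊R i⌋ + 1 - -⌊R i⌋).toNat : ℝ) = ⌊R i⌋ + 1 - -⌊R i⌋ := by exact_mod_cast h2
        rw [h3]
        linarith [Int.floor_le (R i), hR i]
    _ = 81 * ∏ i, R i := by
        rw [Finset.prod_mul_distrib]
        norm_num

/-- The part of the fundamental domain with `V ≤ v < 2 V`. -/
def Cusp (σ X V : ℝ) : Set (Form ℤ) := {f | ∃ u v A B : ℝ, toR f = psi σ u v A B ∧ 0 < A ∧ 0 ≤ u ∧
  u ≤ 1 / 2 ∧ V ≤ v ∧ v < 2 * V ∧ σ * ((disc f : ℤ) : ℝ) < X}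

theorem psi_shift (σ u v A B n : ℝ) :
    act (psi σ u v A B) !![1, -n; 0, 1] = psi σ (u + n) v A B := by
  apply form_ext <;> simp [psi, act] <;> ring

theorem abs_psi_le {σ u v A B r W : ℝ} (hσ : σ = 1 ∨ σ = -1) (hA : |A| ≤ r) (hB : |B| ≤ r)
    (hu : 0 ≤ u) (hu1 : u ≤ W) (hv : 0 ≤ v) (hv1 : v ≤ W) (i : Fin 4) :
    |psi σ u v A B i| ≤ (![r, 6 * r * W, 12 * r * W ^ 2, 8 * r * W ^ 3] : Fin 4 → ℝ) i := by
  have hr : 0 ≤ r := (abs_nonneg _).trans hA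
  have hW : 0 ≤ W := hu.trans hu1
  have e1 : |(2 + σ) * B| ≤ 3 * r := by
    rw [abs_mul]
    refine mul_le_mul ?_ hB (abs_nonneg _) (by norm_num)
    rcases hσ with rfl | rfl <;> norm_num
  have e2 : |(-1 - 2 * σ) * A| ≤ 3 * r := by
    rw [abs_mul]
    refine mul_le_mul ?_ hA (abs_nonneg _) (by norm_num)
    rcases hσ with rfl | rfl <;> norm_num
  have e3 : |-σ * B| ≤ r := by
    rw [abs_mul, ← one_mul r]
    refine mul_le_mul ?_ hB (abs_nonneg _) (by norm_num)
    rcases hσ with rfl | rfl <;> norm_num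
  have mon : ∀ {x y C : ℝ}, 0 ≤ x → x ≤ y → |C| ≤ r → |x * C| ≤ y * r := by
    intro x y C h1 h2 h3
    rw [abs_mul, abs_of_nonneg h1]
    exact mul_le_mul h2 h3 (abs_nonneg _) (h1.trans h2)
  have mon3 : ∀ {x y C : ℝ}, 0 ≤ x → x ≤ y → |C| ≤ 3 * r → |x * C| ≤ y * (3 * r) := by
    intro x y C h1 h2 h3
    rw [abs_mul, abs_of_nonneg h1]
    exact mul_le_mul h2 h3 (abs_nonneg _) (h1.trans h2)
  fin_cases i
  · simpa [psi] using hA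
  · have t1 := abs_le.1 (mon3 hv hv1 e1)
    have t2 := abs_le.1 (mon (x := 3 * u) (y := 3 * W) (by positivity) (by linarith) hA)
    simp only [psi, Fin.mk_one, Matrix.cons_val]
    rw [abs_le]
    constructor <;> linarith [t1.1, t1.2, t2.1, t2.2]
  · have t1 := abs_le.1 (mon (x := 3 * u ^ 2) (y := 3 * W ^ 2) (by positivity) (by gcongr) hA)
    have t2 := abs_le.1 (mon3 (x := 2 * u * v) (y := 2 * W * W) (by positivity) (by gcongr) e1)
    have t3 := abs_le.1 (mon3 (x := v ^ 2) (y := W ^ 2) (by positivity) (by gcongr) e2)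
    simp only [psi, Fin.reduceFinMk, Matrix.cons_val]
    rw [abs_le]
    constructor <;> nlinarith [t1.1, t1.2, t2.1, t2.2, t3.1, t3.2]
  · have t1 := abs_le.1 (mon (x := u ^ 3) (y := W ^ 3) (by positivity) (by gcongr) hA)
    have t2 := abs_le.1 (mon3 (x := u ^ 2 * v) (y := W ^ 2 * W) (by positivity) (by gcongr) e1)
    have t3 := abs_le.1 (mon3 (x := u * v ^ 2) (y := W * W ^ 2) (by positivity) (by gcongr) e2)
    have t4 := abs_le.1 (mon (x := v ^ 3) (y := W ^ 3) (by positivity) (by gcongr) e3)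
    simp only [psi, Fin.reduceFinMk, Matrix.cons_val]
    rw [abs_le]
    constructor <;> nlinarith [t1.1, t1.2, t2.1, t2.2, t3.1, t3.2, t4.1, t4.2]

theorem card_Cusp_le {σ X V : ℝ} (hσ : σ = 1 ∨ σ = -1) (hX : 0 < X) (hV : 1 / 2 ≤ V) :
    (Cusp σ X V).Finite ∧ ((Cusp σ X V).ncard : ℝ) * V ≤ 746496 * X := by
  have hκ := kappa_pos hσ
  have hκ4 : 4 ≤ 56 + 52 * σ := by rcases hσ with rfl | rfl <;> norm_num
  have hV0 : 0 < V := by linarith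
  rcases (Cusp σ X V).eq_empty_or_nonempty with he | ⟨f₀, hf₀⟩
  · simp [he]; positivity
  set ρ := (X / ((56 + 52 * σ) * V ^ 6)) ^ (1 / 4 : ℝ) with hρ
  have hρ0 : 0 < ρ := Real.rpow_pos_of_pos (by positivity) _
  have hρ4 : ρ ^ 4 = X / ((56 + 52 * σ) * V ^ 6) := by
    rw [hρ, ← Real.rpow_natCast, ← Real.rpow_mul (by positivity)]
    norm_num
  have key : ∀ f ∈ Cusp σ X V, ∃ u v A B : ℝ, toR f = psi σ u v A B ∧ 0 < A ∧ 0 ≤ u ∧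
      u ≤ 1 / 2 ∧ V ≤ v ∧ v < 2 * V ∧ |A| ≤ ρ ∧ |B| ≤ ρ := by
    rintro f ⟨u, v, A, B, h, hA, hu, hu1, hv, hv1, hd⟩
    rw [sigma_disc hσ h] at hd
    have h1 : (A ^ 2 + B ^ 2) ^ 2 ≤ ρ ^ 4 := by
      rw [hρ4, le_div_iff₀ (by positivity)]
      refine le_trans ?_ hd.le
      have : V ^ 6 ≤ v ^ 6 := by gcongr
      have h2 : 0 ≤ (56 + 52 * σ) * (A ^ 2 + B ^ 2) ^ 2 := by positivity
      nlinarith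
    have h2 : A ^ 2 + B ^ 2 ≤ ρ ^ 2 := by
      rw [show ρ ^ 4 = (ρ ^ 2) ^ 2 by ring] at h1
      exact le_of_sq_le_sq h1 (by positivity)
    exact ⟨u, v, A, B, h, hA, hu, hu1, hv, hv1, abs_le_of_sq_le_sq (by nlinarith) hρ0.le,
      abs_le_of_sq_le_sq (by nlinarith) hρ0.le⟩
  have hρ1 : 1 ≤ ρ := by
    obtain ⟨u, v, A, B, h, hA, -, -, -, -, hA', -⟩ := key f₀ hf₀
    have h0 : ((f₀ 0 : ℤ) : ℝ) = A := congrFun h 0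
    rw [abs_of_pos hA, ← h0] at hA'
    rw [← h0] at hA
    have : (1 : ℤ) ≤ f₀ 0 := by exact_mod_cast hA
    have : (1 : ℝ) ≤ f₀ 0 := by exact_mod_cast this
    linarith
  set R : Fin 4 → ℝ := ![ρ, 6 * ρ * (2 * V), 12 * ρ * (2 * V) ^ 2, 8 * ρ * (2 * V) ^ 3] with hR
  have hR1 : ∀ i, 1 ≤ R i := by
    have hW : 1 ≤ 2 * V := by linarith
    have h2 : 1 ≤ (2 * V) ^ 2 := one_le_pow₀ hW
    have h3 : 1 ≤ (2 * V) ^ 3 := one_le_pow₀ hW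
    intro i
    fin_cases i
    · exact hρ1
    · change 1 ≤ 6 * ρ * (2 * V); nlinarith
    · change 1 ≤ 12 * ρ * (2 * V) ^ 2; nlinarith
    · change 1 ≤ 8 * ρ * (2 * V) ^ 3; nlinarith
  obtain ⟨hfin, hcard⟩ := card_box_le hR1
  have hprod : ∏ i, R i = 576 * 64 * (X / (56 + 52 * σ)) := by
    have : X / (56 + 52 * σ) = ρ ^ 4 * V ^ 6 := by rw [hρ4]; field_simp
    rw [this, hR]
    simp [Fin.prod_univ_four]
    ring
  let F : Form ℤ × ℕ → Form ℤ := fun x => act x.1 !![1, -(x.2 : ℤ); 0, 1]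
  have hF : ∀ (f : Form ℤ) (n : ℕ) (u v A B : ℝ), toR f = psi σ u v A B →
      toR (F (f, n)) = psi σ (u + n) v A B := by
    intro f n u v A B h
    rw [← psi_shift, ← h, toR_act]
    simp
  have hmaps : Set.MapsTo F (Cusp σ X V ×ˢ Set.Iio (⌊V⌋₊ + 1))
      {f : Form ℤ | ∀ i, |(f i : ℝ)| ≤ R i} := by
    rintro ⟨f, n⟩ ⟨hf, hn⟩ i
    obtain ⟨u, v, A, B, h, hA, hu, hu1, hv, hv1, hA', hB'⟩ := key f hf
    have h1 := congrFun (hF f n u v A B h) i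
    simp only [toR] at h1
    rw [h1]
    have hn' : (n : ℝ) ≤ V := (Nat.le_floor_iff hV0.le).1 (Nat.lt_succ_iff.1 hn)
    exact abs_psi_le hσ hA' hB' (by positivity) (by linarith) (by linarith) hv1.le i
  have hinj : Set.InjOn F (Cusp σ X V ×ˢ Set.Iio (⌊V⌋₊ + 1)) := by
    rintro ⟨f, n⟩ ⟨hf, -⟩ ⟨f', n'⟩ ⟨hf', -⟩ h
    obtain ⟨u, v, A, B, h1, hA, hu, hu1, hv, hv1, hA', hB'⟩ := key f hf
    obtain ⟨u', v', A', B', h1', hA1, hu', hu1', hv', hv1', hA1', hB1'⟩ := key f' hf'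
    have h2 := hF f n u v A B h1
    rw [h, hF f' n' u' v' A' B' h1'] at h2
    obtain ⟨e1, rfl, rfl, rfl⟩ := psi_injective hσ hA1.ne' (by linarith) (by linarith) h2
    have hn : n' = n := by
      have a1 : (n' : ℝ) < n + 1 := by linarith
      have a2 : (n : ℝ) < n' + 1 := by linarith
      have a1' : n' < n + 1 := by exact_mod_cast a1
      have a2' : n < n' + 1 := by exact_mod_cast a2
      omega
    subst hn
    have hu2 : u' = u := by linarith
    subst hu2
    rw [toR_injective (h1.trans h1'.symm)]
  have hfin2 : (Cusp σ X V ×ˢ Set.Iio (⌊V⌋₊ + 1)).Finite := Set.Finite.of_injOn hmaps hinj hfin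
  have hle := Set.ncard_le_ncard_of_injOn F hmaps hinj hfin
  rw [Set.ncard_prod] at hle
  have h5 : (Set.Iio (⌊V⌋₊ + 1)).ncard = ⌊V⌋₊ + 1 := by
    rw [← Finset.coe_Iio, Set.ncard_coe_finset, Nat.card_Iio]
  rw [h5] at hle
  refine ⟨(hfin2.image Prod.fst).subset fun f hf => ⟨(f, 0), ⟨hf, by simp⟩, rfl⟩, ?_⟩
  have hle' : ((Cusp σ X V).ncard : ℝ) * (⌊V⌋₊ + 1) ≤ 81 * ∏ i, R i :=
    le_trans (by exact_mod_cast hle) hcard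
  rw [hprod] at hle'
  have h6 : V ≤ ⌊V⌋₊ + 1 := (Nat.lt_floor_add_one V).le
  have h7 : X / (56 + 52 * σ) ≤ X / 4 := by gcongr
  have h8 : (0 : ℝ) ≤ (Cusp σ X V).ncard := by positivity
  nlinarith

theorem ncard_le_tsum {α ι : Type*} [Countable ι] {S : Set α} {T : ι → Set α} (hS : S ⊆ ⋃ k, T k)
    (hT : ∀ k, (T k).Finite) {c : ι → ℝ} (hc : ∀ k, ((T k).ncard : ℝ) ≤ c k) (hs : Summable c) :
    S.Finite ∧ (S.ncard : ℝ) ≤ ∑' k, c k := by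
  let _ : MeasurableSpace α := ⊤
  have hc0 : ∀ k, 0 ≤ c k := fun k => le_trans (by positivity) (hc k)
  have count_eq : ∀ U : Set α, U.Finite →
      MeasureTheory.Measure.count U = ENNReal.ofReal U.ncard := by
    intro U hU
    rw [MeasureTheory.Measure.count_apply_finite U hU, Set.ncard_eq_toFinset_card _ hU,
      ENNReal.ofReal_natCast]
  have h1 : MeasureTheory.Measure.count S ≤ ENNReal.ofReal (∑' k, c k) := by
    calc MeasureTheory.Measure.count S ≤ MeasureTheory.Measure.count (⋃ k, T k) :=
          MeasureTheory.measure_mono hS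
      _ ≤ ∑' k, MeasureTheory.Measure.count (T k) := MeasureTheory.measure_iUnion_le _
      _ ≤ ∑' k, ENNReal.ofReal (c k) := by
          refine ENNReal.tsum_le_tsum fun k => ?_
          rw [count_eq _ (hT k)]
          exact ENNReal.ofReal_le_ofReal (hc k)
      _ = _ := (ENNReal.ofReal_tsum_of_nonneg hc0 hs).symm
  have hfin : S.Finite := by
    rw [← MeasureTheory.Measure.count_apply_lt_top]
    exact h1.trans_lt ENNReal.ofReal_lt_top
  refine ⟨hfin, ?_⟩
  rw [count_eq S hfin] at h1
  exact (ENNReal.ofReal_le_ofReal_iff (tsum_nonneg hc0)).1 h1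

/-- The part of the fundamental domain with `V ≤ v`. -/
def Tail (σ X V : ℝ) : Set (Form ℤ) := {f | ∃ u v A B : ℝ, toR f = psi σ u v A B ∧ 0 < A ∧ 0 ≤ u ∧
  u ≤ 1 / 2 ∧ V ≤ v ∧ σ * ((disc f : ℤ) : ℝ) < X}

theorem card_Tail_le {σ X V : ℝ} (hσ : σ = 1 ∨ σ = -1) (hX : 0 < X) (hV : 1 / 2 ≤ V) :
    (Tail σ X V).Finite ∧ ((Tail σ X V).ncard : ℝ) ≤ 1492992 * X / V := by
  have hV0 : 0 < V := by linarith
  have hk : ∀ k : ℕ, 1 / 2 ≤ V * 2 ^ k := fun k => by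
    have : (1 : ℝ) ≤ 2 ^ k := one_le_pow₀ one_le_two
    nlinarith
  have hsum : HasSum (fun k : ℕ => 746496 * X / V * (1 / 2) ^ k) (746496 * X / V * 2) :=
    hasSum_geometric_two.mul_left _
  have := ncard_le_tsum (S := Tail σ X V) (T := fun k : ℕ => Cusp σ X (V * 2 ^ k))
    (c := fun k : ℕ => 746496 * X / V * (1 / 2) ^ k) ?_
    (fun k => (card_Cusp_le hσ hX (hk k)).1) ?_ hsum.summable
  · refine ⟨this.1, this.2.trans ?_⟩
    rw [hsum.tsum_eq]
    exact le_of_eq (by ring)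
  · rintro f ⟨u, v, A, B, h, hA, hu, hu1, hv, hd⟩
    have h1 : 1 ≤ v / V := by rwa [one_le_div hV0]
    obtain ⟨n, hn, hn'⟩ := exists_nat_pow_near h1 (one_lt_two)
    rw [le_div_iff₀ hV0] at hn
    rw [div_lt_iff₀ hV0, pow_succ] at hn'
    exact Set.mem_iUnion.2 ⟨n, u, v, A, B, h, hA, hu, hu1, by linarith, by linarith, hd⟩
  · intro k
    have h := (card_Cusp_le hσ hX (hk k)).2
    have h2 : (0 : ℝ) < 2 ^ k := by positivity
    rw [← le_div_iff₀ (by positivity)] at h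
    refine h.trans (le_of_eq ?_)
    rw [one_div, inv_pow]
    field_simp

/-- Classes of irreducible forms of bounded discriminant satisfying a further condition. -/
def irrCls (σ X : ℝ) (P : Form ℤ → Prop) : Set Cls := {c | ∃ f, cls f = c ∧ Irr f ∧ P f ∧
  0 < σ * ((disc f : ℤ) : ℝ) ∧ σ * ((disc f : ℤ) : ℝ) < X}

theorem card_irrCls_le {σ X : ℝ} (hσ : σ = 1 ∨ σ = -1) (hX : 0 < X) (P : Form ℤ → Prop) :
    (irrCls σ X P).Finite ∧ ((irrCls σ X P).ncard : ℝ) ≤ 2985984 * X := by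
  obtain ⟨hfin, hcard⟩ := card_Tail_le hσ hX (V := 1 / 2) le_rfl
  have hsub : irrCls σ X P ⊆ cls '' Tail σ X (1 / 2) := by
    rintro c ⟨f, rfl, hf, -, h0, hd⟩
    obtain ⟨g, hg, u, v, A, B, h, hA, hu, hu1, hn, hv⟩ := Red.exists_eqv hσ hf h0
    refine ⟨g, ⟨u, v, A, B, h, hA, hu, hu1, by nlinarith, ?_⟩, (cls_eq.2 hg).symm⟩
    rwa [hg.disc_eq]
  refine ⟨(hfin.image _).subset hsub, ?_⟩
  calc ((irrCls σ X P).ncard : ℝ) ≤ ((Tail σ X (1 / 2)).ncard : ℝ) := by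
        exact_mod_cast (Set.ncard_le_ncard hsub (hfin.image _)).trans (Set.ncard_image_le hfin)
    _ ≤ _ := hcard.trans (le_of_eq (by ring))

/-- Nonzero multiples of `y` bounded by `Y`. -/
def mults (y : ℤ) (Y : ℝ) : Set ℤ := {a | a ≠ 0 ∧ y ∣ a ∧ |(a : ℝ)| ≤ Y}

theorem card_mults_le {y : ℤ} (hy : y ≠ 0) {Y : ℝ} (hY : 0 < Y) : (mults y Y).Finite ∧
    ((mults y Y).ncard : ℝ) ≤ 3 * (Y / |(y : ℝ)|) ^ (5 / 4 : ℝ) := by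
  have hy' : 0 < |(y : ℝ)| := abs_pos.2 (by exact_mod_cast hy)
  by_cases h1 : 1 ≤ Y / |(y : ℝ)|
  · have hsub : mults y Y ⊆ (fun k => y * k) ''
        ((Finset.Icc (-⌊Y / |(y : ℝ)|⌋) ⌊Y / |(y : ℝ)|⌋ : Finset ℤ) : Set ℤ) := by
      rintro _ ⟨-, ⟨k, rfl⟩, hk⟩
      refine ⟨k, ?_, rfl⟩
      rw [Finset.mem_coe, Finset.mem_Icc, ← abs_le, Int.le_floor, le_div_iff₀ hy']
      push_cast at hk ⊢
      rwa [abs_mul, mul_comm] at hk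
    have hfin : ((fun k => y * k) ''
        ((Finset.Icc (-⌊Y / |(y : ℝ)|⌋) ⌊Y / |(y : ℝ)|⌋ : Finset ℤ) : Set ℤ)).Finite :=
      (Finset.finite_toSet _).image _
    refine ⟨hfin.subset hsub, ?_⟩
    have h2 := (Set.ncard_le_ncard hsub hfin).trans (Set.ncard_image_le (Finset.finite_toSet _))
    rw [Set.ncard_coe_finset, Int.card_Icc] at h2
    have h3 : 0 ≤ ⌊Y / |(y : ℝ)|⌋ := Int.floor_nonneg.2 (by linarith)
    have h4 : ((mults y Y).ncard : ℤ) ≤ 2 * ⌊Y / |(y : ℝ)|⌋ + 1 := by omega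
    have h5 : ((mults y Y).ncard : ℝ) ≤ 2 * ⌊Y / |(y : ℝ)|⌋ + 1 := by exact_mod_cast h4
    have h6 := Int.floor_le (Y / |(y : ℝ)|)
    have h7 : Y / |(y : ℝ)| ≤ (Y / |(y : ℝ)|) ^ (5 / 4 : ℝ) :=
      Real.self_le_rpow_of_one_le h1 (by norm_num)
    linarith
  · have : mults y Y = ∅ := by
      rw [Set.eq_empty_iff_forall_notMem]
      rintro _ ⟨h0, ⟨k, rfl⟩, hk⟩
      apply h1
      rw [le_div_iff₀ hy', one_mul]
      refine le_trans ?_ hk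
      have hk0 : k ≠ 0 := by rintro rfl; simp at h0
      have : (1 : ℝ) ≤ |(k : ℝ)| := by exact_mod_cast Int.one_le_abs hk0
      push_cast
      rw [abs_mul]
      nlinarith
    rw [this]
    refine ⟨Set.finite_empty, ?_⟩
    simp
    positivity

/-- Forms of bounded height with given rational zero and nonzero extremal coefficients. -/
def zeroForms (Y : ℝ) (z : ℤ × ℤ) : Set (Form ℤ) := {f | (∀ i, |(f i : ℝ)| ≤ Y) ∧ f 0 ≠ 0 ∧
  f 3 ≠ 0 ∧ ev f z.1 z.2 = 0 ∧ IsCoprime z.1 z.2}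

theorem card_zeroForms_le {Y : ℝ} (hY : 1 ≤ Y) (z : ℤ × ℤ) : (zeroForms Y z).Finite ∧
    ((zeroForms Y z).ncard : ℝ) ≤ 27 * Y ^ (7 / 2 : ℝ) * (|(z.1 : ℝ)| ^ (-(5 / 4) : ℝ) *
      |(z.2 : ℝ)| ^ (-(5 / 4) : ℝ)) := by
  obtain ⟨x, y⟩ := z
  by_cases hxy : x = 0 ∨ y = 0
  · have : zeroForms Y (x, y) = ∅ := by
      rw [Set.eq_empty_iff_forall_notMem]
      rintro f ⟨-, h0, h3, hev, hco⟩
      simp only [ev] at hev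
      rcases hxy with rfl | rfl
      · replace hco := (isCoprime_zero_left.1 hco).ne_zero
        simp_all
      · replace hco := (isCoprime_zero_right.1 hco).ne_zero
        simp_all
    rw [this]
    refine ⟨Set.finite_empty, ?_⟩
    simp
    positivity
  push Not at hxy
  obtain ⟨hx, hy⟩ := hxy
  have hY0 : 0 < Y := by linarith
  obtain ⟨fx, cx⟩ := card_mults_le hx hY0
  obtain ⟨fy, cy⟩ := card_mults_le hy hY0
  obtain ⟨f1, c1⟩ := card_mults_le one_ne_zero hY0
  have f1' : (insert 0 (mults 1 Y)).Finite := f1.insert _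
  have hfin := (fy.prod (f1'.prod fx))
  have hmaps : Set.MapsTo (fun f : Form ℤ => (f 0, f 1, f 3)) (zeroForms Y (x, y))
      (mults y Y ×ˢ (insert 0 (mults 1 Y)) ×ˢ mults x Y) := by
    rintro f ⟨hb, h0, h3, hev, hco⟩
    simp only [ev] at hev
    have hco' : IsCoprime y x := hco.symm
    refine ⟨⟨h0, ?_, hb 0⟩, ?_, h3, ?_, hb 3⟩
    · refine (hco'.pow_right (n := 3)).dvd_of_dvd_mul_right
        ⟨-(f 1 * x ^ 2 + f 2 * x * y + f 3 * y ^ 2), by linarith⟩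
    · by_cases h1 : f 1 = 0
      · exact Or.inl h1
      · exact Or.inr ⟨h1, one_dvd _, hb 1⟩
    · refine (hco.pow_right (n := 3)).dvd_of_dvd_mul_right
        ⟨-(f 0 * x ^ 2 + f 1 * x * y + f 2 * y ^ 2), by linarith⟩
  have hinj : Set.InjOn (fun f : Form ℤ => (f 0, f 1, f 3)) (zeroForms Y (x, y)) := by
    rintro f ⟨-, -, -, hev, -⟩ g ⟨-, -, -, hev', -⟩ h
    simp only [Prod.mk.injEq] at h
    obtain ⟨e0, e1, e3⟩ := h
    simp only [ev] at hev hev'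
    refine form_ext e0 e1 ?_ e3
    rw [e0, e1, e3] at hev
    have : (f 2 - g 2) * (x * y ^ 2) = 0 := by linarith
    rcases mul_eq_zero.1 this with h | h
    · linarith
    · exact absurd h (mul_ne_zero hx (pow_ne_zero 2 hy))
  refine ⟨Set.Finite.of_injOn hmaps hinj hfin, ?_⟩
  have hle := Set.ncard_le_ncard_of_injOn _ hmaps hinj hfin
  rw [Set.ncard_prod, Set.ncard_prod] at hle
  have c1' : ((insert 0 (mults 1 Y)).ncard : ℝ) ≤ 3 * Y := by
    have h1 : insert 0 (mults 1 Y) ⊆ ((Finset.Icc (-⌊Y⌋) ⌊Y⌋ : Finset ℤ) : Set ℤ) := by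
      intro k hk
      rw [Finset.mem_coe, Finset.mem_Icc, ← abs_le, Int.le_floor]
      rcases hk with rfl | hk
      · simp; positivity
      · exact_mod_cast hk.2.2
    have h2 := Set.ncard_le_ncard h1 (Finset.finite_toSet _)
    rw [Set.ncard_coe_finset, Int.card_Icc] at h2
    have h3 : 0 ≤ ⌊Y⌋ := Int.floor_nonneg.2 (by linarith)
    have h4 : ((insert 0 (mults 1 Y)).ncard : ℤ) ≤ 2 * ⌊Y⌋ + 1 := by omega
    have h5 : ((insert 0 (mults 1 Y)).ncard : ℝ) ≤ 2 * ⌊Y⌋ + 1 := by exact_mod_cast h4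
    linarith [Int.floor_le Y]
  have hx' : 0 < |(x : ℝ)| := abs_pos.2 (by exact_mod_cast hx)
  have hy' : 0 < |(y : ℝ)| := abs_pos.2 (by exact_mod_cast hy)
  calc ((zeroForms Y (x, y)).ncard : ℝ) ≤
      (mults y Y).ncard * ((insert 0 (mults 1 Y)).ncard * (mults x Y).ncard) := by
        exact_mod_cast hle
    _ ≤ (3 * (Y / |(y : ℝ)|) ^ (5 / 4 : ℝ)) * ((3 * Y) * (3 * (Y / |(x : ℝ)|) ^ (5 / 4 : ℝ))) := by
        gcongr
    _ = _ := by
        rw [Real.div_rpow hY0.le hy'.le, Real.div_rpow hY0.le hx'.le, Real.rpow_neg hx'.le,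
          Real.rpow_neg hy'.le, show (7 / 2 : ℝ) = 5 / 4 + 1 + 5 / 4 by norm_num,
          Real.rpow_add hY0, Real.rpow_add hY0, Real.rpow_one]
        simp only [div_eq_mul_inv]
        ring

theorem exists_card_reducible_le : ∃ C : ℝ, ∀ Y : ℝ, 1 ≤ Y →
    ({f : Form ℤ | (∀ i, |(f i : ℝ)| ≤ Y) ∧ f 0 ≠ 0 ∧ ¬Irr f}.ncard : ℝ) ≤ C * Y ^ (7 / 2 : ℝ) := by
  have hs := (Real.summable_abs_int_rpow (b := 5 / 4) (by norm_num)).mul_of_nonneg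
    (Real.summable_abs_int_rpow (b := 5 / 4) (by norm_num)) (fun _ => by positivity)
    (fun _ => by positivity)
  refine ⟨81 + 27 * ∑' z : ℤ × ℤ, |(z.1 : ℝ)| ^ (-(5 / 4) : ℝ) * |(z.2 : ℝ)| ^ (-(5 / 4) : ℝ), ?_⟩
  intro Y hY
  have h1 := ncard_le_tsum (S := ⋃ z, zeroForms Y z) subset_rfl
    (fun z => (card_zeroForms_le hY z).1) (fun z => (card_zeroForms_le hY z).2) (hs.mul_left _)
  rw [tsum_mul_left] at h1
  obtain ⟨h2, h3⟩ := card_box_le (R := ![Y, Y, Y, 1]) (by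
    intro i; fin_cases i <;> first | exact hY | exact le_rfl)
  have hsub : {f : Form ℤ | (∀ i, |(f i : ℝ)| ≤ Y) ∧ f 0 ≠ 0 ∧ ¬Irr f} ⊆
      {f : Form ℤ | ∀ i, |(f i : ℝ)| ≤ (![Y, Y, Y, 1] : Fin 4 → ℝ) i} ∪ ⋃ z, zeroForms Y z := by
    rintro f ⟨hb, h0, hirr⟩
    by_cases h3 : f 3 = 0
    · left
      intro i
      fin_cases i
      · exact hb 0
      · exact hb 1
      · exact hb 2
      · simp [h3]
    · right
      unfold Irr at hirr
      push Not at hirr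
      obtain ⟨x, y, hev, hxy⟩ := hirr
      obtain ⟨M, k, hM, hk, rfl, rfl⟩ := exists_primitive (x := x) (y := y) (by tauto)
      refine Set.mem_iUnion.2 ⟨(M 0 0, M 1 0), hb, h0, h3, ?_, ?_⟩
      · rw [ev_mul] at hev
        simpa [hk] using hev
      · rw [Matrix.det_fin_two] at hM
        exact ⟨M 1 1, -M 0 1, by linarith⟩
  have h4 := (Set.ncard_le_ncard hsub (h2.union h1.1)).trans (Set.ncard_union_le _ _)
  have h5 : ∏ i, (![Y, Y, Y, 1] : Fin 4 → ℝ) i = Y ^ (3 : ℝ) := by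
    simp [Fin.prod_univ_four]
    ring
  have h6 : Y ^ (3 : ℝ) ≤ Y ^ (7 / 2 : ℝ) := Real.rpow_le_rpow_of_exponent_le hY (by norm_num)
  rw [h5] at h3
  have h7 : ({f : Form ℤ | (∀ i, |(f i : ℝ)| ≤ Y) ∧ f 0 ≠ 0 ∧ ¬Irr f}.ncard : ℝ) ≤
      ({f : Form ℤ | ∀ i, |(f i : ℝ)| ≤ (![Y, Y, Y, 1] : Fin 4 → ℝ) i}.ncard : ℝ) +
        ((⋃ z, zeroForms Y z).ncard : ℝ) := by exact_mod_cast h4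
  linarith [h1.2]

/-- Representatives of the points of the projective line, as first columns of invertible
matrices. -/
def gam (R : Type*) [CommRing R] : Option ℕ → Mat R
  | none => !![0, 1; 1, 0]
  | some t => !![1, 0; (t : R), 1]

/-- Indices for the points of the projective line over `ZMod p`. -/
def pts (p : ℕ) : Finset (Option ℕ) := Finset.insertNone (Finset.range p)

theorem card_pts (p : ℕ) : (pts p).card = p + 1 := by
  simp [pts]

theorem isUnit_det_gam (R : Type*) [CommRing R] (s : Option ℕ) : IsUnit (gam R s).det := by
  rcases s with _ | t <;> simp [gam, Matrix.det_fin_two]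

theorem dvd_act_of_triangular {R : Type*} [CommRing R] {p : R} {g : Form R} {N : Mat R}
    (h0 : p ^ 2 ∣ g 0) (h1 : p ∣ g 1) (hN : p ∣ N 1 0) : p ^ 2 ∣ act g N 0 ∧ p ∣ act g N 1 := by
  obtain ⟨a, ha⟩ := h0
  obtain ⟨b, hb⟩ := h1
  obtain ⟨n, hn⟩ := hN
  constructor
  · refine ⟨a * N 0 0 ^ 3 + b * N 0 0 ^ 2 * n + g 2 * N 0 0 * n ^ 2 + g 3 * p * n ^ 3, ?_⟩
    simp [act, ha, hb, hn]
    ring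
  · refine ⟨3 * p * a * N 0 0 ^ 2 * N 0 1 + b * (N 0 0 ^ 2 * N 1 1 + 2 * N 0 0 * N 0 1 * N 1 0)
      + g 2 * (2 * N 0 0 * n * N 1 1 + N 0 1 * p * n ^ 2) + 3 * g 3 * p * n ^ 2 * N 1 1, ?_⟩
    simp [act, ha, hb, hn]
    ring

/-- Every point of the projective line over `ZMod p` is represented by some `gam`. -/
theorem exists_gam {p : ℕ} (hp : p.Prime) {M : Mat ℤ} (hM : IsUnit M.det) :
    ∃ s ∈ pts p, (p : ℤ) ∣ (M⁻¹ * gam ℤ s) 1 0 := by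
  have hinv (s : Option ℕ) : (M⁻¹ * gam ℤ s) 1 0 =
      M.det * (M 0 0 * gam ℤ s 1 0 - M 1 0 * gam ℤ s 0 0) := by
    rw [Matrix.inv_def, Matrix.adjugate_fin_two]
    have : Ring.inverse M.det = M.det := by
      rcases Int.isUnit_iff.1 hM with h | h <;> rw [h]
      · exact Ring.inverse_unit (1 : ℤˣ)
      · exact Ring.inverse_unit (-1 : ℤˣ)
    rw [this]
    simp [Matrix.mul_apply, Fin.sum_univ_two]
    ring
  simp only [hinv]
  by_cases hd : (p : ℤ) ∣ M 0 0
  · exact ⟨none, by simp [pts], by simpa [gam] using hd.mul_left _⟩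
  · have : Fact p.Prime := ⟨hp⟩
    have hd' : (M 0 0 : ZMod p) ≠ 0 := by
      rwa [Ne, ZMod.intCast_zmod_eq_zero_iff_dvd]
    refine ⟨some ((M 1 0 : ZMod p) * (M 0 0 : ZMod p)⁻¹).val, ?_, ?_⟩
    · simp [pts, ZMod.val_lt]
    · apply Dvd.dvd.mul_left
      rw [← ZMod.intCast_zmod_eq_zero_iff_dvd]
      simp [gam]
      field_simp
      simp

/-- Nonmaximality at `p` is detected by the points of the projective line over `ZMod p`. -/
theorem nonMax_iff {p : ℕ} (hp : p.Prime) {f : Form ℤ} : NonMax p f ↔ (∀ i, (p : ℤ) ∣ f i) ∨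
    ∃ s ∈ pts p, (p : ℤ) ^ 2 ∣ act f (gam ℤ s) 0 ∧ (p : ℤ) ∣ act f (gam ℤ s) 1 := by
  constructor
  · rintro (h | ⟨g, ⟨M, hM, rfl⟩, h0, h1⟩)
    · exact Or.inl h
    right
    obtain ⟨s, hs, hd⟩ := exists_gam hp hM
    refine ⟨s, hs, ?_⟩
    have := dvd_act_of_triangular h0 h1 hd
    rwa [act_act, ← mul_assoc, Matrix.mul_nonsing_inv _ hM, one_mul] at this
  · rintro (h | ⟨s, -, h0, h1⟩)
    · exact Or.inl h
    · exact Or.inr ⟨_, ⟨_, isUnit_det_gam ℤ s, rfl⟩, h0, h1⟩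

/-- Distinct double roots force a form to vanish. -/
theorem dvd_of_two_double_roots {R : Type*} [CommRing R] {p : R} {h : Form R} {N : Mat R}
    (h0 : p ∣ h 0) (h1 : p ∣ h 1) (k0 : p ∣ act h N 0) (k1 : p ∣ act h N 1) (hN : IsUnit (N 1 0))
    (hd : IsUnit N.det) (i : Fin 4) : p ∣ h i := by
  obtain ⟨a, ha⟩ := h0
  obtain ⟨b, hb⟩ := h1
  have e0 : p ∣ N 1 0 ^ 2 * (h 2 * N 0 0 + h 3 * N 1 0) := by
    convert k0.sub (dvd_mul_right p (a * N 0 0 ^ 3 + b * N 0 0 ^ 2 * N 1 0)) using 1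
    simp [act, ha, hb]
    ring
  have e1 : p ∣ N 1 0 * (h 2 * (2 * N 0 0 * N 1 1 + N 0 1 * N 1 0) + 3 * h 3 * N 1 0 * N 1 1) := by
    convert k1.sub (dvd_mul_right p (3 * a * N 0 0 ^ 2 * N 0 1 +
      b * (N 0 0 ^ 2 * N 1 1 + 2 * N 0 0 * N 0 1 * N 1 0))) using 1
    simp [act, ha, hb]
    ring
  rw [(hN.pow 2).dvd_mul_left] at e0
  rw [hN.dvd_mul_left] at e1
  have e2 : p ∣ h 2 := by
    rw [← hd.dvd_mul_left, Matrix.det_fin_two]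
    convert (e0.mul_left (3 * N 1 1)).sub e1 using 1
    ring
  have e3 : p ∣ h 3 := by
    rw [← hN.dvd_mul_left]
    convert e0.sub (e2.mul_left (N 0 0)) using 1
    ring
  fin_cases i
  exacts [⟨a, ha⟩, ⟨b, hb⟩, e2, e3]

theorem ncard_univ_pi {ι : Type*} [Finite ι] {α : ι → Type*} [∀ i, Finite (α i)]
    (S : ∀ i, Set (α i)) [Fintype ι] : (Set.univ.pi S).ncard = ∏ i, (S i).ncard := by
  classical
  have h (i : ι) : (S i).Finite := Set.toFinite _
  have : Set.univ.pi S = (Fintype.piFinset fun i => (h i).toFinset : Set (∀ i, α i)) := by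
    rw [Fintype.coe_piFinset]
    simp
  rw [this, Set.ncard_coe_finset, Fintype.card_piFinset]
  exact Finset.prod_congr rfl fun i _ => (Set.ncard_eq_toFinset_card _ (h i)).symm

theorem dvd_intCast_iff {p : ℕ} {x : ℤ} : (p : ZMod (p ^ 2)) ∣ (x : ZMod (p ^ 2)) ↔ (p : ℤ) ∣ x := by
  constructor
  · rintro ⟨c, hc⟩
    obtain ⟨d, rfl⟩ := ZMod.intCast_surjective c
    have : ((x - p * d : ℤ) : ZMod (p ^ 2)) = 0 := by
      push_cast
      rw [hc, sub_self]
    rw [ZMod.intCast_zmod_eq_zero_iff_dvd] at this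
    push_cast at this
    have h := (Dvd.intro_left (p : ℤ) (by ring : (p : ℤ) * p = (p : ℤ) ^ 2)).trans this
    simpa using h.add (dvd_mul_right (p : ℤ) d)
  · rintro ⟨c, rfl⟩
    push_cast
    exact dvd_mul_right _ _

theorem redm_act (m : ℕ) (f : Form ℤ) (s : Option ℕ) :
    redm m (act f (gam ℤ s)) = act (redm m f) (gam (ZMod m) s) := by
  rcases s with _ | t <;> apply form_ext <;> simp [redm, act, gam]

/-- The residues divisible by `p`. -/
def multSet (p : ℕ) : Set (ZMod (p ^ 2)) := {x | (p : ZMod (p ^ 2)) ∣ x}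

theorem ncard_multSet {p : ℕ} (hp : p.Prime) : (multSet p).ncard = p := by
  have : NeZero (p ^ 2) := ⟨by simp [hp.ne_zero]⟩
  have h : multSet p = (fun j : ℕ => ((p * j : ℕ) : ZMod (p ^ 2))) '' (Finset.range p) := by
    ext x
    constructor
    · rintro ⟨c, rfl⟩
      obtain ⟨n, rfl⟩ := ZMod.natCast_zmod_surjective c
      refine ⟨n % p, by simp [Nat.mod_lt _ hp.pos], ?_⟩
      simp only
      rw [← Nat.cast_mul, ZMod.natCast_eq_natCast_iff, pow_two]
      exact (Nat.mod_modEq n p).mul_left' p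
    · rintro ⟨j, -, rfl⟩
      exact ⟨j, by push_cast; rfl⟩
  rw [h, Set.InjOn.ncard_image, Set.ncard_coe_finset, Finset.card_range]
  intro i hi j hj hij
  simp only [Finset.coe_range, Set.mem_Iio] at hi hj
  simp only at hij
  rw [ZMod.natCast_eq_natCast_iff, pow_two] at hij
  have := Nat.ModEq.mul_left_cancel' hp.ne_zero hij
  exact Nat.ModEq.eq_of_lt_of_lt this hi hj

/-- The forms modulo `p ^ 2` all of whose coefficients are divisible by `p`. -/
def contentSet (p : ℕ) : Set (Form (ZMod (p ^ 2))) := Set.univ.pi fun _ => multSet p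

theorem ncard_contentSet {p : ℕ} (hp : p.Prime) : (contentSet p).ncard = p ^ 4 := by
  have : NeZero (p ^ 2) := ⟨by simp [hp.ne_zero]⟩
  rw [contentSet, ncard_univ_pi]
  simp [ncard_multSet hp]

/-- The primitive forms modulo `p ^ 2` that have a double root modulo `p` at the point at
infinity and are not maximal there. -/
def stdSet (p : ℕ) : Set (Form (ZMod (p ^ 2))) :=
  {f | f 0 = 0 ∧ f 1 ∈ multSet p} \ contentSet p

theorem ncard_stdSet {p : ℕ} (hp : p.Prime) : (stdSet p).ncard = p ^ 5 - p ^ 3 := by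
  have : NeZero (p ^ 2) := ⟨by simp [hp.ne_zero]⟩
  have h1 : {f : Form (ZMod (p ^ 2)) | f 0 = 0 ∧ f 1 ∈ multSet p} =
      Set.univ.pi ![{0}, multSet p, Set.univ, Set.univ] := by
    ext f
    simp [Fin.forall_fin_succ]
  have h2 : {f : Form (ZMod (p ^ 2)) | f 0 = 0 ∧ f 1 ∈ multSet p} ∩ contentSet p =
      Set.univ.pi ![{0}, multSet p, multSet p, multSet p] := by
    ext f
    simp only [contentSet, Set.mem_inter_iff, Set.mem_ofPred_eq, Set.mem_univ_pi,
      Fin.forall_fin_succ]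
    simp
    constructor
    · tauto
    · rintro ⟨h0, h1, h2, h3⟩
      refine ⟨⟨h0, h1⟩, ?_, h1, h2, h3⟩
      rw [h0]
      exact dvd_zero _
  have h3 := Set.ncard_inter_add_ncard_sdiff_eq_ncard {f : Form (ZMod (p ^ 2)) | f 0 = 0 ∧ f 1 ∈ multSet p}
    (contentSet p)
  rw [h2, h1, ncard_univ_pi, ncard_univ_pi] at h3
  simp [Fin.prod_univ_four, ncard_multSet hp, Set.ncard_univ] at h3
  rw [stdSet, h1]
  have : p * p * p = p ^ 3 := by ring
  have : p * p ^ 2 * p ^ 2 = p ^ 5 := by ring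
  omega

/-- The forms modulo `p ^ 2` that are primitive and not maximal at the point `s`. -/
def ptSet (p : ℕ) (s : Option ℕ) : Set (Form (ZMod (p ^ 2))) :=
  {f | act f (gam _ s) ∈ stdSet p}

theorem act_mem_contentSet {p : ℕ} {f : Form (ZMod (p ^ 2))} (M : Mat (ZMod (p ^ 2)))
    (hM : IsUnit M.det) : act f M ∈ contentSet p ↔ f ∈ contentSet p := by
  simp only [contentSet, Set.mem_univ_pi]
  constructor
  · intro h i
    have := dvd_act h M⁻¹ i
    rwa [act_act, Matrix.mul_nonsing_inv _ hM, act_one] at this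
  · intro h i
    exact dvd_act h M i

theorem ncard_ptSet {p : ℕ} (hp : p.Prime) (s : Option ℕ) : (ptSet p s).ncard = p ^ 5 - p ^ 3 := by
  rw [← ncard_stdSet hp]
  have hu := isUnit_det_gam (ZMod (p ^ 2)) s
  have : ptSet p s = (fun f => act f (gam _ s)⁻¹) '' stdSet p := by
    ext f
    constructor
    · intro h
      exact ⟨_, h, by simp only [act_act, Matrix.mul_nonsing_inv _ hu, act_one]⟩
    · rintro ⟨g, hg, rfl⟩
      simpa only [ptSet, Set.mem_ofPred_eq, act_act, Matrix.nonsing_inv_mul _ hu, act_one] using hg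
  rw [this, Set.ncard_image_of_injective]
  intro f g h
  have := congrArg (fun k => act k (gam _ s)) h
  simpa only [act_act, Matrix.nonsing_inv_mul _ hu, act_one] using this

theorem isUnit_sub {p : ℕ} (hp : p.Prime) {s t : ℕ} (hs : s < p) (ht : t < p) (hst : s ≠ t) :
    IsUnit ((s : ZMod (p ^ 2)) - t) := by
  have : ((s : ZMod (p ^ 2)) - t) = ((s - t : ℤ) : ZMod (p ^ 2)) := by push_cast; rfl
  rw [this, ZMod.coe_int_isUnit_iff_isCoprime]
  push_cast
  apply IsCoprime.pow_left
  rw [(Nat.prime_iff_prime_int.1 hp).coprime_iff_not_dvd]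
  intro h
  have := Int.eq_zero_of_abs_lt_dvd h (by rw [abs_lt]; omega)
  omega

theorem disjoint_ptSet {p : ℕ} (hp : p.Prime) {s t : Option ℕ} (hs : s ∈ pts p) (ht : t ∈ pts p)
    (hst : s ≠ t) : Disjoint (ptSet p s) (ptSet p t) := by
  rw [Set.disjoint_left]
  rintro f ⟨⟨h0, h1⟩, hc⟩ ⟨⟨k0, k1⟩, -⟩
  have hu := isUnit_det_gam (ZMod (p ^ 2)) s
  have hv := isUnit_det_gam (ZMod (p ^ 2)) t
  apply hc
  have e : act f (gam _ t) = act (act f (gam _ s)) ((gam _ s)⁻¹ * gam _ t) := by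
    rw [act_act, ← mul_assoc, Matrix.mul_nonsing_inv _ hu, one_mul]
  rw [e] at k0 k1
  have h0' : (p : ZMod (p ^ 2)) ∣ act f (gam _ s) 0 := by rw [h0]; exact dvd_zero _
  have k0' := dvd_zero (p : ZMod (p ^ 2))
  rw [← k0] at k0'
  have hd : IsUnit ((gam (ZMod (p ^ 2)) s)⁻¹ * gam _ t).det := by
    rw [Matrix.det_mul]
    exact IsUnit.mul (by simpa using hu) hv
  refine fun i _ => dvd_of_two_double_roots h0' h1 k0' k1 ?_ hd i
  simp only [pts, Finset.mem_insertNone, Finset.mem_range] at hs ht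
  rcases s with _ | s <;> rcases t with _ | t
  · simp at hst
  · simp [gam, Matrix.inv_def, Matrix.adjugate_fin_two, Matrix.mul_apply, Fin.sum_univ_two]
  · simp [gam, Matrix.inv_def, Matrix.adjugate_fin_two, Matrix.mul_apply, Fin.sum_univ_two]
  · have := isUnit_sub hp (ht t rfl) (hs s rfl) (by rintro rfl; simp at hst)
    simp [gam, Matrix.inv_def, Matrix.adjugate_fin_two, Matrix.mul_apply, Fin.sum_univ_two]
    convert this using 1
    ring

/-- The forms modulo `p ^ 2` that are not maximal at `p`. -/
def nonMaxSet (p : ℕ) : Set (Form (ZMod (p ^ 2))) := contentSet p ∪ ⋃ s ∈ pts p, ptSet p s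

theorem redm_mem_nonMaxSet {p : ℕ} (hp : p.Prime) (f : Form ℤ) :
    redm (p ^ 2) f ∈ nonMaxSet p ↔ NonMax p f := by
  have hc : redm (p ^ 2) f ∈ contentSet p ↔ ∀ i, (p : ℤ) ∣ f i := by
    simp [contentSet, multSet, redm, dvd_intCast_iff]
  have hz (x : ℤ) : (x : ZMod (p ^ 2)) = 0 ↔ (p : ℤ) ^ 2 ∣ x := by
    rw [ZMod.intCast_zmod_eq_zero_iff_dvd]
    push_cast
    rfl
  rw [nonMax_iff hp, ← hc, nonMaxSet, Set.mem_union]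
  simp only [Set.mem_iUnion, ptSet, stdSet, Set.mem_ofPred_eq, Set.mem_sdiff, exists_prop,
    act_mem_contentSet _ (isUnit_det_gam _ _), ← redm_act]
  simp only [multSet, redm, Set.mem_ofPred_eq, dvd_intCast_iff, hz]
  tauto

theorem ncard_nonMaxSet {p : ℕ} (hp : p.Prime) :
    (nonMaxSet p).ncard = p ^ 4 + (p + 1) * (p ^ 5 - p ^ 3) := by
  have : NeZero (p ^ 2) := ⟨by simp [hp.ne_zero]⟩
  rw [nonMaxSet, Set.ncard_union_eq, ncard_contentSet hp]
  · congr 1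
    classical
    have h (s : Option ℕ) : (ptSet p s).Finite := Set.toFinite _
    have : (⋃ s ∈ pts p, ptSet p s) =
        ((pts p).biUnion fun s => (h s).toFinset : Finset (Form (ZMod (p ^ 2)))) := by
      simp
    rw [this, Set.ncard_coe_finset, Finset.card_biUnion]
    · simp_rw [← Set.ncard_eq_toFinset_card _ (h _), ncard_ptSet hp]
      simp [card_pts]
    · intro s hs t ht hst
      simpa using disjoint_ptSet hp hs ht hst
  · rw [Set.disjoint_left]
    simp only [Set.mem_iUnion, not_exists]
    intro f hf s _ hs
    exact hs.2 ((act_mem_contentSet _ (isUnit_det_gam _ _)).2 hf)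

theorem density_maximal {p : ℕ} (hp : p.Prime) : ((nonMaxSet p)ᶜ.ncard : ℝ) =
    ((p ^ 2 : ℕ) : ℝ) ^ 4 * ((1 - ((p : ℝ) ^ 2)⁻¹) * (1 - ((p : ℝ) ^ 3)⁻¹)) := by
  have : NeZero (p ^ 2) := ⟨by simp [hp.ne_zero]⟩
  have h1 := Set.ncard_add_ncard_compl (nonMaxSet p)
  have h2 : Nat.card (Form (ZMod (p ^ 2))) = p ^ 8 := by
    simp [Nat.card_eq_fintype_card, ← pow_mul]
  rw [h2, ncard_nonMaxSet hp] at h1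
  have h3 : p ^ 3 ≤ p ^ 5 := Nat.pow_le_pow_right hp.pos (by norm_num)
  have h4 := congrArg (Nat.cast : ℕ → ℝ) h1
  push_cast [Nat.cast_sub h3] at h4
  have hp0 : (p : ℝ) ≠ 0 := Nat.cast_ne_zero.2 hp.ne_zero
  push_cast
  field_simp
  linear_combination h4

/-- The set of forms that are maximal at finitely many given primes is periodic, with the expected
density. -/
theorem exists_periodic_maximal (P : Finset ℕ) (hP : ∀ p ∈ P, p.Prime) :
    ∃ (m : ℕ) (_ : NeZero m) (S : Set (Form (ZMod m))),
      (∀ f : Form ℤ, redm m f ∈ S ↔ ∀ p ∈ P, ¬NonMax p f) ∧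
      (S.ncard : ℝ) / (m : ℝ) ^ 4 =
        ∏ p ∈ P, ((1 - ((p : ℝ) ^ 2)⁻¹) * (1 - ((p : ℝ) ^ 3)⁻¹)) := by
  have hpr (i : P) : (i : ℕ).Prime := hP i i.2
  have hne (i : P) : NeZero ((i : ℕ) ^ 2) := ⟨by simp [(hpr i).ne_zero]⟩
  have hco : Pairwise (Function.onFun Nat.Coprime fun i : P => (i : ℕ) ^ 2) := by
    intro i j hij
    exact Nat.Coprime.pow 2 2
      ((Nat.coprime_primes (hpr i) (hpr j)).2 fun h => hij (Subtype.ext h))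
  let m := ∏ i : P, (i : ℕ) ^ 2
  have hm0 : m ≠ 0 := Finset.prod_ne_zero_iff.2 fun i _ => (hne i).1
  have hm : NeZero m := ⟨hm0⟩
  let e : ZMod m ≃+* ∀ i : P, ZMod ((i : ℕ) ^ 2) := ZMod.prodEquivPi _ hco
  let φ : Form (ZMod m) ≃ ∀ i : P, Form (ZMod ((i : ℕ) ^ 2)) :=
    (Equiv.arrowCongr (Equiv.refl _) e.toEquiv).trans (Equiv.piComm _)
  have hφ (f : Form ℤ) (i : P) : φ (redm m f) i = redm ((i : ℕ) ^ 2) f := by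
    funext j
    change e ((f j : ℤ) : ZMod m) i = _
    rw [map_intCast]
    rfl
  refine ⟨m, hm, φ ⁻¹' Set.univ.pi fun i => (nonMaxSet (i : ℕ))ᶜ, ?_, ?_⟩
  · intro f
    simp only [Set.mem_preimage, Set.mem_univ_pi, hφ, Set.mem_compl_iff]
    constructor
    · intro h p hp
      rw [← redm_mem_nonMaxSet (hP p hp)]
      exact h ⟨p, hp⟩
    · intro h i
      rw [redm_mem_nonMaxSet (hpr i)]
      exact h i i.2
  · rw [← Equiv.image_symm_eq_preimage, Set.ncard_image_of_injective _ φ.symm.injective,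
      ncard_univ_pi]
    push_cast
    rw [Finset.prod_congr rfl fun i _ => density_maximal (hpr i), Finset.prod_mul_distrib,
      ← Finset.prod_coe_sort P]
    have : ((m : ℕ) : ℝ) ^ 4 = ∏ i : P, (((i : ℕ) ^ 2 : ℕ) : ℝ) ^ 4 := by
      rw [Finset.prod_pow, ← Nat.cast_prod]
    rw [this, mul_div_cancel_left₀]
    rw [← this]
    positivity

theorem eqv_smul_iff {t : ℤ} (ht : t ≠ 0) {f g : Form ℤ} : Eqv (t • f) (t • g) ↔ Eqv f g := by
  constructor
  · rintro ⟨M, hM, h⟩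
    rw [act_smul] at h
    exact ⟨M, hM, smul_right_injective _ ht h⟩
  · rintro ⟨M, hM, rfl⟩
    exact ⟨M, hM, (act_smul _ _ _).symm⟩

/-- The form attached to a primitive form that is not maximal at `p` arises from a form of smaller
discriminant together with a root of the latter modulo `p`. -/
theorem exists_overform {p : ℕ} (hp : p.Prime) {f : Form ℤ} (hf : Irr f) (hm : NonMax p f)
    (hc : ¬∀ i, (p : ℤ) ∣ f i) : ∃ g : Form ℤ, Irr g ∧ disc f = (p : ℤ) ^ 2 * disc g ∧
      ∃ s ∈ pts p, Eqv ((p : ℤ) • f) (act (Quotient.out (cls g)) (gam ℤ s * !![1, 0; 0, (p : ℤ)])) := by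
  rcases hm with h | ⟨k, hk, ⟨a, ha⟩, ⟨b, hb⟩⟩
  · exact absurd h hc
  have hp0 : (p : ℤ) ≠ 0 := Nat.cast_ne_zero.2 hp.ne_zero
  let g : Form ℤ := ![p * k 3, k 2, b, a]
  let k' : Form ℤ := ![k 3, k 2, k 1, k 0]
  have hk' : Eqv f k' := by
    refine hk.trans ⟨!![0, 1; 1, 0], by simp [Matrix.det_fin_two], ?_⟩
    apply form_ext <;> simp [act, k']
  have hgk : act g !![1, 0; 0, (p : ℤ)] = (p : ℤ) • k' := by
    apply form_ext <;> simp [act, k', g, ha, hb] <;> ring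
  have hdet : (!![1, 0; 0, (p : ℤ)]).det = p := by simp [Matrix.det_fin_two]
  have hdisc := congrArg disc hgk
  rw [disc_act, hdet, disc_smul, hk'.disc_eq] at hdisc
  refine ⟨g, ?_, ?_, ?_⟩
  · intro x y hxy
    have h1 : ev ((p : ℤ) • k') (p * x) y = 0 := by
      rw [← hgk, ev_act]
      have := ev_mul g p x y
      simp only [Matrix.of_apply, Matrix.cons_val]
      simpa [hxy] using this
    rw [ev_smul] at h1
    have h2 := (hf.eqv hk') _ _ ((mul_eq_zero.1 h1).resolve_left hp0)
    exact ⟨(mul_eq_zero.1 h2.1).resolve_left hp0, h2.2⟩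
  · have : (p : ℤ) ^ 4 * (disc f - p ^ 2 * disc g) = 0 := by linear_combination -hdisc
    exact sub_eq_zero.1 ((mul_eq_zero.1 this).resolve_left (pow_ne_zero 4 hp0))
  · have he : Eqv (Quotient.out (cls g)) g := cls_eq.1 (Quotient.out_eq _)
    obtain ⟨M, hM, hg⟩ := he
    obtain ⟨s, hs, n, hn⟩ := exists_gam hp hM
    refine ⟨s, hs, ((eqv_smul_iff hp0).2 hk').trans ?_⟩
    set L := M⁻¹ * gam ℤ s with hL
    have hLdet : IsUnit L.det := by
      rw [hL, Matrix.det_mul]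
      exact IsUnit.mul (by simpa using hM) (isUnit_det_gam _ _)
    refine ⟨!![L 0 0, p * L 0 1; n, L 1 1], ?_, ?_⟩
    · convert hLdet using 1
      simp only [Matrix.det_fin_two, hn, Matrix.of_apply, Matrix.cons_val]
      ring
    · have e1 : gam ℤ s = M * L := by
        rw [hL, ← mul_assoc, Matrix.mul_nonsing_inv _ hM, one_mul]
      have e2 : L * !![1, 0; 0, (p : ℤ)] = !![1, 0; 0, (p : ℤ)] * !![L 0 0, p * L 0 1; n, L 1 1] := by
        ext i j
        fin_cases i <;> fin_cases j <;> simp [Matrix.mul_apply, Fin.sum_univ_two, hn, mul_comm]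
      rw [e1, mul_assoc, e2, ← act_act, ← act_act, ← hg, hgk]

/-- The points of the projective line over `ZMod p` at which `g` vanishes. -/
noncomputable def rootPts (p : ℕ) (g : Form ℤ) : Finset (Option ℕ) :=
  {s ∈ pts p | (p : ℤ) ∣ act g (gam ℤ s) 0}

theorem card_rootPts_le {p : ℕ} (hp : p.Prime) {g : Form ℤ} (hc : ¬∀ i, (p : ℤ) ∣ g i) :
    (rootPts p g).card ≤ 4 := by
  classical
  have : Fact p.Prime := ⟨hp⟩
  let q : Cubic (ZMod p) := ⟨g 3, g 2, g 1, g 0⟩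
  have hq : q.toPoly ≠ 0 := by
    intro h
    rw [Cubic.toPoly_eq_zero_iff, Cubic.ext_iff] at h
    apply hc
    intro i
    rw [← ZMod.intCast_zmod_eq_zero_iff_dvd]
    fin_cases i
    exacts [h.2.2.2, h.2.2.1, h.2.1, h.1]
  have hsub : rootPts p g ⊆ Finset.insertNone
      (q.toPoly.roots.toFinset.image ZMod.val) := by
    intro s hs
    simp only [rootPts, Finset.mem_filter, pts, Finset.mem_insertNone, Finset.mem_range] at hs
    rw [Finset.mem_insertNone]
    rintro t rfl
    refine Finset.mem_image.2 ⟨(t : ZMod p), ?_, ZMod.val_cast_of_lt (hs.1 t rfl)⟩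
    rw [Multiset.mem_toFinset, Polynomial.mem_roots hq, Polynomial.IsRoot, Cubic.toPoly]
    have := hs.2
    rw [act_zero_apply, ← ZMod.intCast_zmod_eq_zero_iff_dvd] at this
    simp [ev, gam] at this
    simp [q]
    linear_combination this
  have h3 : Multiset.card q.toPoly.roots ≤ 3 :=
    (Polynomial.card_roots' _).trans Polynomial.natDegree_cubic_le
  have h4 := (Finset.card_image_le (s := q.toPoly.roots.toFinset) (f := ZMod.val)).trans
    ((Multiset.toFinset_card_le _).trans h3)
  have h5 := Finset.card_le_card hsub
  rw [Finset.card_insertNone] at h5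
  omega

theorem finite_irrCls {σ : ℝ} (hσ : σ = 1 ∨ σ = -1) {X : ℝ} (hX : 0 < X) (P : Form ℤ → Prop) :
    (irrCls σ X P).Finite := (card_irrCls_le hσ hX P).1

theorem card_irrCls_dvd_le {σ : ℝ} (hσ : σ = 1 ∨ σ = -1) {X : ℝ} (hX : 0 < X) {p : ℕ}
    (hp : p.Prime) : ((irrCls σ X fun f => ∀ i, (p : ℤ) ∣ f i).ncard : ℝ) ≤
      2985984 * (X / (p : ℝ) ^ 4) := by
  have hp0 : (p : ℤ) ≠ 0 := Nat.cast_ne_zero.2 hp.ne_zero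
  have hpp : (0 : ℝ) < (p : ℝ) ^ 4 := by have := hp.pos; positivity
  have hX' : 0 < X / (p : ℝ) ^ 4 := by positivity
  refine le_trans (Nat.cast_le.2 ?_) (card_irrCls_le hσ hX' fun _ => True).2
  refine (Set.ncard_le_ncard (t := (fun c => cls ((p : ℤ) • Quotient.out c)) ''
    irrCls σ (X / (p : ℝ) ^ 4) fun _ => True) ?_ ((finite_irrCls hσ hX' _).image _)).trans
    (Set.ncard_image_le (finite_irrCls hσ hX' _))
  rintro c ⟨f, rfl, hf, hd, h0, h1⟩
  choose g hg using hd
  obtain rfl : f = (p : ℤ) • g := funext hg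
  rw [disc_smul] at h0 h1
  push_cast at h0 h1
  refine ⟨cls g, ⟨g, rfl, hf.of_smul, trivial, ?_, ?_⟩, ?_⟩
  · rw [mul_left_comm] at h0
    exact pos_of_mul_pos_right h0 hpp.le
  · rw [lt_div_iff₀ hpp]
    linarith
  · simp only
    rw [cls_eq, eqv_smul_iff hp0]
    exact cls_eq.1 (Quotient.out_eq _)

theorem card_irrCls_nonMax_le {σ : ℝ} (hσ : σ = 1 ∨ σ = -1) {X : ℝ} (hX : 0 < X) {p : ℕ}
    (hp : p.Prime) : ((irrCls σ X (NonMax p)).ncard : ℝ) ≤ 20901888 * (X / (p : ℝ) ^ 2) := by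
  classical
  have hp0 : (p : ℤ) ≠ 0 := Nat.cast_ne_zero.2 hp.ne_zero
  have hpR : (1 : ℝ) ≤ p := by exact_mod_cast hp.one_le
  have hp2 : (0 : ℝ) < (p : ℝ) ^ 2 := by positivity
  have hX2 : 0 < X / (p : ℝ) ^ 2 := by positivity
  set D : Form ℤ → Prop := fun f => ∀ i, (p : ℤ) ∣ f i with hD
  have hI := finite_irrCls hσ hX2 fun _ => True
  set I := hI.toFinset
  set Q : Finset (Σ _ : Cls, Option ℕ) := I.sigma fun c => rootPts p (Quotient.out c) with hQ
  set B : Set Cls := {c ∈ irrCls σ X (NonMax p) | c ∉ irrCls σ X D}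
  have hB : (B.ncard : ℝ) ≤ Q.card := by
    have hex : ∀ c ∈ B, ∃ q ∈ Q, ∃ f, cls f = c ∧
        Eqv ((p : ℤ) • f) (act (Quotient.out q.1) (gam ℤ q.2 * !![1, 0; 0, (p : ℤ)])) := by
      rintro c ⟨⟨f, rfl, hf, hm, h0, h1⟩, hc⟩
      have hc' : ¬D f := fun h => hc ⟨f, rfl, hf, h, h0, h1⟩
      obtain ⟨g, hg, hdisc, s, hs, he⟩ := exists_overform hp hf hm hc'
      rw [hdisc] at h0 h1
      push_cast at h0 h1
      refine ⟨⟨cls g, s⟩, ?_, f, rfl, he⟩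
      rw [hQ, Finset.mem_sigma, Set.Finite.mem_toFinset]
      refine ⟨⟨g, rfl, hg, trivial, ?_, ?_⟩, ?_⟩
      · rw [mul_left_comm] at h0
        exact pos_of_mul_pos_right h0 hp2.le
      · rw [lt_div_iff₀ hp2]
        linarith
      · obtain ⟨M, hM, h⟩ := he
        rw [rootPts, Finset.mem_filter]
        refine ⟨hs, ?_⟩
        have := dvd_act (p := (p : ℤ)) (f := (p : ℤ) • f) (fun i => ⟨f i, rfl⟩) M 0
        rw [← h, ← act_act] at this
        simpa [act] using this
    choose! F hF hFf using hex
    rw [← Set.ncard_coe_finset]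
    refine Nat.cast_le.2 (Set.ncard_le_ncard_of_injOn F hF ?_ (Finset.finite_toSet _))
    intro c hc c' hc' h
    obtain ⟨f, rfl, e⟩ := hFf c hc
    obtain ⟨f', rfl, e'⟩ := hFf c' hc'
    rw [← h] at e'
    exact cls_eq.2 ((eqv_smul_iff hp0).1 (e.trans e'.symm))
  have hroot (c : Cls) : (rootPts p (Quotient.out c)).card ≤
      4 + if D (Quotient.out c) then p + 1 else 0 := by
    split_ifs with h
    · exact (Finset.card_filter_le _ _).trans (by rw [card_pts]; omega)
    · exact card_rootPts_le hp h
  have hQc : (Q.card : ℝ) ≤ 4 * (2985984 * (X / (p : ℝ) ^ 2)) +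
      (p + 1) * (2985984 * (X / (p : ℝ) ^ 2 / (p : ℝ) ^ 4)) := by
    have h1 : Q.card ≤ 4 * I.card + (p + 1) * (I.filter fun c => D (Quotient.out c)).card := by
      rw [hQ, Finset.card_sigma]
      refine (Finset.sum_le_sum fun c _ => hroot c).trans ?_
      rw [Finset.sum_add_distrib, ← Finset.sum_filter]
      simp [mul_comm]
    have h2 : (I.card : ℝ) ≤ 2985984 * (X / (p : ℝ) ^ 2) := by
      rw [← Set.ncard_eq_toFinset_card _ hI]
      exact (card_irrCls_le hσ hX2 _).2
    have h3 : ((I.filter fun c => D (Quotient.out c)).card : ℝ) ≤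
        2985984 * (X / (p : ℝ) ^ 2 / (p : ℝ) ^ 4) := by
      refine le_trans (Nat.cast_le.2 ?_) (card_irrCls_dvd_le hσ hX2 hp)
      rw [← Set.ncard_coe_finset]
      refine Set.ncard_le_ncard ?_ (finite_irrCls hσ hX2 _)
      intro c hc
      simp only [Finset.coe_filter, Set.mem_ofPred_eq, I, Set.Finite.mem_toFinset] at hc
      obtain ⟨⟨f, rfl, hf, -, h0, h1⟩, hd⟩ := hc
      have he : Eqv f (Quotient.out (cls f)) := (cls_eq.1 (Quotient.out_eq _)).symm
      exact ⟨_, Quotient.out_eq _, hf.eqv he, hd, by rwa [he.disc_eq], by rwa [he.disc_eq]⟩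
    have h1' : (Q.card : ℝ) ≤ 4 * I.card + (p + 1) * (I.filter fun c => D (Quotient.out c)).card :=
      by exact_mod_cast h1
    nlinarith
  have hu : irrCls σ X (NonMax p) ⊆ irrCls σ X D ∪ B := by
    intro c hc
    by_cases h : c ∈ irrCls σ X D
    · exact Or.inl h
    · exact Or.inr ⟨hc, h⟩
  have h1 : ((irrCls σ X (NonMax p)).ncard : ℝ) ≤ (irrCls σ X D).ncard + B.ncard := by
    have := (Set.ncard_le_ncard hu ((finite_irrCls hσ hX _).union
      ((finite_irrCls hσ hX _).subset (Set.sep_subset _ _)))).trans (Set.ncard_union_le _ _)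
    exact_mod_cast this
  have h2 := card_irrCls_dvd_le hσ hX hp
  have h3 : X / (p : ℝ) ^ 4 ≤ X / (p : ℝ) ^ 2 := by gcongr; norm_num
  have h4 : (p + 1) * (X / (p : ℝ) ^ 2 / (p : ℝ) ^ 4) ≤ 2 * (X / (p : ℝ) ^ 2) := by
    rw [← mul_div_assoc, div_le_iff₀ (by positivity)]
    have : (p : ℝ) ≤ (p : ℝ) ^ 4 := le_self_pow₀ hpR (by norm_num)
    nlinarith
  linarith

open Topology

/-- The truncated density of maximal forms. -/
noncomputable def dens (n : ℕ) : ℝ :=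
  ∏ p ∈ Nat.primesBelow n, ((1 - ((p : ℝ) ^ 2)⁻¹) * (1 - ((p : ℝ) ^ 3)⁻¹))

theorem tendsto_prod_inv {k : ℕ} (hk : 2 ≤ k) :
    Tendsto (fun n : ℕ => ∏ p ∈ Nat.primesBelow n, (1 - ((p : ℝ) ^ k)⁻¹)) atTop
      (𝓝 (riemannZeta k).re⁻¹) := by
  have hs : 1 < (k : ℂ).re := by
    rw [Complex.natCast_re]
    exact_mod_cast (by omega : 1 < k)
  have h := riemannZeta_eulerProduct hs
  have e (n : ℕ) : ∏ p ∈ Nat.primesBelow n, (1 - (p : ℂ) ^ (-(k : ℂ)))⁻¹ =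
      ((∏ p ∈ Nat.primesBelow n, (1 - ((p : ℝ) ^ k)⁻¹)⁻¹ : ℝ) : ℂ) := by
    push_cast
    simp only [Complex.cpow_neg, Complex.cpow_natCast]
  simp_rw [e] at h
  have h1 := (Complex.continuous_re.tendsto _).comp h
  simp only [Function.comp_def, Complex.ofReal_re] at h1
  have h2 := tendsto_nhds_unique ((Complex.continuous_ofReal.tendsto _).comp h1) h
  have h3 : (riemannZeta k).re ≠ 0 := by
    intro h0
    rw [h0, Complex.ofReal_zero] at h2
    exact riemannZeta_ne_zero_of_one_lt_re hs h2.symm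
  simpa using h1.inv₀ h3

theorem tendsto_dens : Tendsto dens atTop (𝓝 (6 / Real.pi ^ 2 * (riemannZeta 3).re⁻¹)) := by
  have h2 := tendsto_prod_inv (k := 2) le_rfl
  have h3 := tendsto_prod_inv (k := 3) (by norm_num)
  have e : (riemannZeta 2).re = Real.pi ^ 2 / 6 := by
    rw [riemannZeta_two]
    norm_cast
  push_cast at h2 h3
  rw [e, inv_div] at h2
  exact (h2.mul h3).congr fun n => Finset.prod_mul_distrib.symm

/-- Maximality at all primes. -/
def Maximal (f : Form ℤ) : Prop := ∀ p : ℕ, p.Prime → ¬NonMax p f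

/-- The number of classes of irreducible maximal forms, normalized. -/
noncomputable def ratio (σ N : ℝ) : ℝ := (irrCls σ (N ^ 4) Maximal).ncard / N ^ 4

/-- The volume of the fundamental domain. -/
noncomputable def vol (σ : ℝ) : ℝ := (20 + 16 * σ) / (4 * (56 + 52 * σ)) * (Real.pi ^ 2 / 6)

theorem eventually_ratio_lt {σ ε : ℝ} (hσ : σ = 1 ∨ σ = -1) (hε : 0 < ε) (hε1 : ε < 1) (n : ℕ)
    {b : ℝ} (hb : vol σ * (1 - ε) * dens n + 2985984 * ε < b) :
    ∀ᶠ N in atTop, ratio σ N < b := by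
  obtain ⟨m, hm, S, hS, hd⟩ := exists_periodic_maximal (Nat.primesBelow n)
    fun p hp => Nat.prime_of_mem_primesBelow hp
  have hlim := tendsto_dil_periodic (isCompact_outB hσ hε).isBounded
    (isCompact_outB hσ hε).measurableSet (volume_frontier_outB hσ hε) m S
  rw [measureReal_outB hσ hε, measureReal_inB hσ hε hε1, hd] at hlim
  have hb' : (20 + 16 * σ) / (4 * (56 + 52 * σ)) * (Real.pi ^ 2 / 6 * (1 - ε)) * dens n <
      b - 2985984 * ε := by
    rw [vol] at hb
    linarith
  filter_upwards [hlim.eventually_lt_const hb', eventually_gt_atTop 0] with N hN hN0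
  have hN4 : 0 < N ^ 4 := by positivity
  have hV : 1 / 2 ≤ 1 / (2 * ε) := by
    rw [div_le_div_iff₀ (by norm_num) (by positivity)]
    linarith
  obtain ⟨hT, hTc⟩ := card_Tail_le hσ hN4 hV
  set A := {f ∈ dil (outB σ ε) N | redm m f ∈ S}
  have hA : A.Finite := (finite_dil (isCompact_outB hσ hε).isBounded hN0).subset (Set.sep_subset _ _)
  have hsub : irrCls σ (N ^ 4) Maximal ⊆ cls '' (A ∪ Tail σ (N ^ 4) (1 / (2 * ε))) := by
    rintro c ⟨f, rfl, hf, hmax, h0, h1⟩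
    obtain ⟨g, hg, u, v, A', B', hpsi, hA, hu, hu1, hn, hv⟩ := Red.exists_eqv hσ hf h0
    refine ⟨g, ?_, cls_eq.2 hg.symm⟩
    rw [← hg.disc_eq] at h1
    by_cases hvε : 2 * v * ε ≤ 1
    · refine Or.inl ⟨mem_dil_outB hσ hN0 hpsi hA hu hu1 hn hv hvε h1.le, ?_⟩
      exact (hS g).2 fun p hp hpg =>
        hmax p (Nat.prime_of_mem_primesBelow hp) (hpg.eqv hg.symm)
    · refine Or.inr ⟨u, v, A', B', hpsi, hA, hu, hu1, ?_, h1⟩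
      rw [div_le_iff₀ (by positivity)]
      linarith
  have h1 : ((irrCls σ (N ^ 4) Maximal).ncard : ℝ) ≤ A.ncard + (Tail σ (N ^ 4) (1 / (2 * ε))).ncard := by
    have := ((Set.ncard_le_ncard hsub ((hA.union hT).image _)).trans
      (Set.ncard_image_le (hA.union hT))).trans (Set.ncard_union_le _ _)
    exact_mod_cast this
  have h2 : 1492992 * N ^ 4 / (1 / (2 * ε)) = 2985984 * ε * N ^ 4 := by
    field_simp
    ring
  rw [div_lt_iff₀ hN4] at hN
  rw [ratio, div_lt_iff₀ hN4]
  nlinarith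

theorem eventually_lt_ratio {σ ε : ℝ} (hσ : σ = 1 ∨ σ = -1) (hε : 0 < ε) (hε1 : ε < 1) {n : ℕ}
    (hn : 1 ≤ n) {a : ℝ} (ha : a < vol σ * (1 - ε) * dens n -
      20901888 * ∑' k : ℕ, (((k + n : ℕ) : ℝ) ^ 2)⁻¹) :
    ∀ᶠ N in atTop, a < ratio σ N := by
  obtain ⟨m, hm, S, hS, hd⟩ := exists_periodic_maximal (Nat.primesBelow n)
    fun p hp => Nat.prime_of_mem_primesBelow hp
  have hbd : Bornology.IsBounded (inB σ ε) := (isCompact_outB hσ hε).isBounded.subset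
    (inB_subset_outB σ ε)
  have hlim := tendsto_dil_periodic hbd
    (isOpen_inB hσ hε).measurableSet (volume_frontier_inB hσ hε) m S
  rw [measureReal_inB hσ hε hε1, hd] at hlim
  obtain ⟨C, hC⟩ := exists_card_reducible_le
  obtain ⟨R, hR⟩ := hbd.exists_norm_le
  set R' := max R 1
  have hR' : 1 ≤ R' := le_max_right _ _
  have hlim2 : Tendsto (fun N : ℝ => C * (R' * N) ^ (7 / 2 : ℝ) / N ^ 4) atTop (𝓝 0) := by
    have h1 : Tendsto (fun N : ℝ => C * R' ^ (7 / 2 : ℝ) * N ^ (-(1 / 2) : ℝ)) atTop (𝓝 0) := by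
      simpa using (tendsto_rpow_neg_atTop (y := 1 / 2) (by norm_num)).const_mul _
    refine h1.congr' ?_
    filter_upwards [eventually_gt_atTop 0] with N hN
    have : N ^ (-(1 / 2) : ℝ) = N ^ (7 / 2 : ℝ) / N ^ 4 := by
      rw [← Real.rpow_natCast, ← Real.rpow_sub hN]
      norm_num
    rw [Real.mul_rpow (by positivity) hN.le, this]
    ring
  have hlim3 := hlim.sub hlim2
  set τ := ∑' k : ℕ, (((k + n : ℕ) : ℝ) ^ 2)⁻¹ with hτ
  have ha' : a + 20901888 * τ <
      (20 + 16 * σ) / (4 * (56 + 52 * σ)) * (Real.pi ^ 2 / 6 * (1 - ε)) * dens n - 0 := by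
    rw [vol] at ha
    linarith
  have hsum : Summable fun k : ℕ => (((k + n : ℕ) : ℝ) ^ 2)⁻¹ :=
    (summable_nat_add_iff n).2 (Real.summable_nat_pow_inv.2 (by norm_num : 1 < 2))
  filter_upwards [hlim3.eventually_const_lt ha', eventually_ge_atTop 1] with N hN hN1
  have hN0 : 0 < N := by linarith
  have hN4 : 0 < N ^ 4 := by positivity
  set A := {f ∈ dil (inB σ ε) N | redm m f ∈ S}
  have hA : A.Finite := (finite_dil hbd hN0).subset (Set.sep_subset _ _)
  set I := irrCls σ (N ^ 4) Maximal
  have hI : I.Finite := finite_irrCls hσ hN4 _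
  set U := irrCls σ (N ^ 4) fun f => ∃ k : ℕ, (k + n).Prime ∧ NonMax (k + n) f
  have hU : U.Finite ∧ (U.ncard : ℝ) ≤ ∑' k : ℕ, 20901888 * (N ^ 4 * (((k + n : ℕ) : ℝ) ^ 2)⁻¹) := by
    refine ncard_le_tsum (T := fun k => {c ∈ irrCls σ (N ^ 4) (NonMax (k + n)) | (k + n).Prime})
      ?_ ?_ ?_ ((hsum.mul_left _).mul_left _)
    · rintro c ⟨f, rfl, hf, ⟨k, hk, hkf⟩, h⟩
      exact Set.mem_iUnion.2 ⟨k, ⟨f, rfl, hf, hkf, h⟩, hk⟩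
    · exact fun k => (finite_irrCls hσ hN4 _).subset (Set.sep_subset _ _)
    · intro k
      by_cases hk : (k + n).Prime
      · simp only [hk, and_true, ← div_eq_mul_inv]
        exact card_irrCls_nonMax_le hσ hN4 hk
      · simp only [hk, and_false]
        simp
        positivity
  rw [tsum_mul_left, tsum_mul_left, ← hτ] at hU
  set Z := {f : Form ℤ | (∀ i, |(f i : ℝ)| ≤ R' * N) ∧ f 0 ≠ 0 ∧ ¬Irr f}
  have hZ := hC (R' * N) (by nlinarith)
  set A₁ := {f ∈ A | Irr f}
  have h1 : A₁.ncard ≤ (I ∪ U).ncard := by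
    refine Set.ncard_le_ncard_of_injOn cls ?_ ?_ (hI.union hU.1)
    · rintro f ⟨⟨hfB, hfS⟩, hf⟩
      obtain ⟨-, h0, h1⟩ := of_mem_dil_inB hσ hε hN0 hfB
      by_cases hmax : Maximal f
      · exact Or.inl ⟨f, rfl, hf, hmax, h0, h1⟩
      · right
        simp only [Maximal] at hmax
        push Not at hmax
        obtain ⟨p, hp, hpf⟩ := hmax
        have hpn : n ≤ p := by
          by_contra hlt
          exact (hS f).1 hfS p (Nat.mem_primesBelow.2 ⟨by omega, hp⟩) hpf
        obtain ⟨k, rfl⟩ := Nat.exists_eq_add_of_le' hpn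
        exact ⟨f, rfl, hf, ⟨k, hp, hpf⟩, h0, h1⟩
    · rintro f ⟨⟨hfB, -⟩, -⟩ g ⟨⟨hgB, -⟩, -⟩ h
      exact (of_mem_dil_inB hσ hε hN0 hfB).1.unique hσ (of_mem_dil_inB hσ hε hN0 hgB).1 (cls_eq.1 h)
  have h2 : A ⊆ A₁ ∪ (A ∩ Z) := by
    intro f hf
    by_cases hi : Irr f
    · exact Or.inl ⟨hf, hi⟩
    · refine Or.inr ⟨hf, ?_, ?_, hi⟩
      · intro i
        have := (norm_le_pi_norm _ i).trans (hR _ hf.1)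
        rw [Real.norm_eq_abs, abs_div, abs_of_pos hN0, div_le_iff₀ hN0] at this
        exact this.trans (by gcongr; exact le_max_left _ _)
      · obtain ⟨u, v, A', B', hpsi, hA', -⟩ := (of_mem_dil_inB hσ hε hN0 hf.1).1
        have := congrFun hpsi 0
        rw [psi_zero, toR] at this
        intro h0
        rw [h0, Int.cast_zero] at this
        linarith
  have hZf : Z.Finite := (card_box_le (R := fun _ => R' * N) fun _ => by nlinarith).1.subset
    fun f hf => hf.1
  have h3 : (A.ncard : ℝ) ≤ I.ncard + U.ncard + Z.ncard := by
    have h4 := (Set.ncard_le_ncard h2 ((hA.subset (Set.sep_subset _ _)).union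
      (hZf.subset Set.inter_subset_right))).trans (Set.ncard_union_le _ _)
    have h5 := Set.ncard_union_le I U
    have h6 := Set.ncard_le_ncard (Set.inter_subset_right (s := A) (t := Z)) hZf
    exact_mod_cast (by omega : A.ncard ≤ I.ncard + U.ncard + Z.ncard)
  rw [← sub_div, lt_div_iff₀ hN4] at hN
  rw [ratio, lt_div_iff₀ hN4]
  have := hU.2
  nlinarith

theorem tendsto_tail : Tendsto (fun n : ℕ => ∑' k : ℕ, (((k + n : ℕ) : ℝ) ^ 2)⁻¹) atTop (𝓝 0) :=
  tendsto_sum_nat_add fun k : ℕ => ((k : ℝ) ^ 2)⁻¹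

theorem tendsto_ratio {σ : ℝ} (hσ : σ = 1 ∨ σ = -1) : Tendsto (ratio σ) atTop
    (𝓝 (vol σ * (6 / Real.pi ^ 2 * (riemannZeta 3).re⁻¹))) := by
  have hε : Tendsto (fun n : ℕ => 1 / ((n : ℝ) + 1)) atTop (𝓝 0) :=
    tendsto_one_div_add_atTop_nhds_zero_nat
  have hmain := (((hε.const_sub 1).const_mul (vol σ)).mul tendsto_dens)
  have hup := hmain.add (hε.const_mul 2985984)
  have hlo := hmain.sub (tendsto_tail.const_mul 20901888)
  simp only [sub_zero, mul_one, mul_zero, add_zero] at hup hlo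
  have hε1 (n : ℕ) (hn : 1 ≤ n) : 1 / ((n : ℝ) + 1) < 1 := by
    have : (1 : ℝ) ≤ n := by exact_mod_cast hn
    rw [div_lt_one (by positivity)]
    linarith
  rw [tendsto_order]
  constructor
  · intro a ha
    obtain ⟨n, hn, hn1⟩ := ((hlo.eventually_const_lt ha).and (eventually_ge_atTop 1)).exists
    exact eventually_lt_ratio hσ (by positivity) (hε1 n hn1) hn1 hn
  · intro b hb
    obtain ⟨n, hn, hn1⟩ := ((hup.eventually_lt_const hb).and (eventually_ge_atTop 1)).exists
    exact eventually_ratio_lt hσ (by positivity) (hε1 n hn1) n hn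

theorem isLittleO_count {σ : ℝ} (hσ : σ = 1 ∨ σ = -1) {c : ℝ} (F : ℝ → ℕ)
    (hF : ∀ X, F X = (irrCls σ X Maximal).ncard)
    (hc : vol σ * (6 / Real.pi ^ 2 * (riemannZeta 3).re⁻¹) = c) :
    (fun X : ℝ => (F X : ℝ) - X * c) =o[atTop] fun X : ℝ => X := by
  have h := (tendsto_ratio hσ).comp (tendsto_rpow_atTop (y := 1 / 4) (by norm_num))
  rw [hc] at h
  rw [Asymptotics.isLittleO_iff_tendsto' ((eventually_ne_atTop 0).mono fun X h h' => absurd h' h)]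
  have h' := h.sub_const c
  rw [sub_self] at h'
  refine h'.congr' ?_
  filter_upwards [eventually_gt_atTop 0] with X hX
  have : (X ^ (1 / 4 : ℝ)) ^ 4 = X := by
    rw [← Real.rpow_natCast, ← Real.rpow_mul hX.le]
    norm_num
  rw [Function.comp_apply, ratio, this, hF, sub_div, mul_div_cancel_left₀ _ hX.ne']

end DH

theorem davenport_heilbronn :
    ((fun X : ℝ => (cubicFieldCount 0 X : ℝ) - X / (12 * (riemannZeta 3).re)) =o[atTop]
      fun X : ℝ => X) ∧
    ((fun X : ℝ => (cubicFieldCount (-X) 0 : ℝ) - X / (4 * (riemannZeta 3).re)) =o[atTop]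
      fun X : ℝ => X) := by
  have hπ := Real.pi_ne_zero
  constructor
  · have h := DH.isLittleO_count (σ := 1) (c := 1 / (12 * (riemannZeta 3).re)) (Or.inl rfl)
      (fun X => cubicFieldCount 0 X) (fun X => by
        rw [DH.cubicFieldCount_eq]
        simp [DH.maxCls, DH.irrCls, DH.Maximal]) (by
        rw [DH.vol]
        field_simp
        norm_num)
    simpa only [mul_one_div] using h
  · have h := DH.isLittleO_count (σ := -1) (c := 1 / (4 * (riemannZeta 3).re)) (Or.inr rfl)
      (fun X => cubicFieldCount (-X) 0) (fun X => by
        rw [DH.cubicFieldCount_eq]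
        congr 1
        ext c
        simp only [DH.maxCls, DH.irrCls, DH.Maximal, Set.mem_ofPred_eq]
        refine exists_congr fun f => and_congr_right fun _ => and_congr_right fun _ =>
          and_congr_right fun _ => ?_
        constructor <;> rintro ⟨h1, h2⟩ <;> constructor <;> linarith) (by
        rw [DH.vol]
        field_simp
        norm_num)
    simpa only [mul_one_div] using h
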